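/- Assume the local multiplier setup with g of the standard form, let ε be the ball exponent of g with ε ≥ 1/2, and suppose there is at least one unit direction whose strip exponent is less than 1/2. Let l be a line through the origin with unit direction v and let δ_v, e_v be the strip exponents of g in direction v. If δ_v < 1/2 then, provided the support of φ is sufficiently small, there is C such that |K_φ(t,u)| ≤ C (2+|(t,u)|)^{−δ_v} (ln(2+|(t,u)|))^{e_v} for all (t,u) ∈ l_H. If δ_v ≥ 1/2 then instead |K_φ(t,u)| ≤ C (2+|(t,u)|)^{−1/2} (ln(2+|(t,u)|))^{2} for all (t,u) ∈ l_H. -/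

import Mathlib

open MeasureTheory Real Set Filter Metric
open scoped Topology ENNReal

noncomputable section

/-- The Euclidean magnitude `|(x,y)| = √(x²+y²)` of a point of `ℝ²`. -/
def nrm2 (p : ℝ × ℝ) : ℝ := Real.sqrt (p.1 ^ 2 + p.2 ^ 2)

/-- The open Euclidean disk `{(x,y) : x²+y² < r²}` centered at the origin. -/
def disk2 (r : ℝ) : Set (ℝ × ℝ) := {p : ℝ × ℝ | p.1 ^ 2 + p.2 ^ 2 < r ^ 2}

/-- The closed Euclidean disk `{(x,y) : x²+y² ≤ r²}` centered at the origin. -/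
def closedDisk2 (r : ℝ) : Set (ℝ × ℝ) := {p : ℝ × ℝ | p.1 ^ 2 + p.2 ^ 2 ≤ r ^ 2}

/-- The circle `{(x,y) : x²+y² = r²}` centered at the origin. -/
def circle2 (r : ℝ) : Set (ℝ × ℝ) := {p : ℝ × ℝ | p.1 ^ 2 + p.2 ^ 2 = r ^ 2}

/-- Dot product on `ℝ²`. -/
def dot2 (p q : ℝ × ℝ) : ℝ := p.1 * q.1 + p.2 * q.2

/-- The perpendicular vector `v^⊥ = (v₂, −v₁)`. -/
def perp2 (v : ℝ × ℝ) : ℝ × ℝ := (v.2, -v.1)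

/-- The function `g = χ_E · ∏ᵢ |fᵢ|^(γᵢ)`. -/
def stdFun (n : ℕ) (f : Fin n → ℝ × ℝ → ℝ) (γ : Fin n → ℝ) (E : Set (ℝ × ℝ)) :
    ℝ × ℝ → ℝ :=
  E.indicator fun p => ∏ i, |f i p| ^ (γ i)

/-- A boundary curve for the region `E`: one half of a graph `y = h(|x|^{1/N})` or
`x = h(|y|^{1/N})` with `h` real analytic, `h 0 = 0`, joining the origin to the circle
of radius `r₀`. -/
def IsPuiseuxBdryCurve (r₀ : ℝ) (C : Set (ℝ × ℝ)) : Prop :=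
  ∃ (N : ℕ) (h : ℝ → ℝ) (I : Set ℝ) (σ : ℝ),
    0 < N ∧ (σ = 1 ∨ σ = -1) ∧ IsOpen I ∧ Icc (0:ℝ) (r₀ ^ ((N:ℝ)⁻¹)) ⊆ I ∧
    AnalyticOnNhd ℝ h I ∧ h 0 = 0 ∧
    (C = {p : ℝ × ℝ | p ∈ closedDisk2 r₀ ∧ 0 ≤ σ * p.1 ∧
            p.2 = h (|p.1| ^ ((N:ℝ)⁻¹))} ∨
     C = {p : ℝ × ℝ | p ∈ closedDisk2 r₀ ∧ 0 ≤ σ * p.2 ∧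
            p.1 = h (|p.2| ^ ((N:ℝ)⁻¹))}) ∧
    (0:ℝ×ℝ) ∈ C ∧ ∃ p ∈ C, nrm2 p = r₀

/-- The admissible form of the set `E`: either a disk centered at the origin, or a finite
disjoint union of open regions, each bounded by two Puiseux boundary curves joining the
origin to the circle of radius `r₀` together with an arc of that circle, where all the
boundary curves are pairwise disjoint in the closed disk minus the origin. -/
def IsStdDomain (E : Set (ℝ × ℝ)) : Prop :=
  (∃ r₀ > (0:ℝ), E = disk2 r₀) ∨
  (∃ r₀ > (0:ℝ), ∃ m : ℕ, ∃ Es : Fin m → Set (ℝ × ℝ), ∃ Cs : Fin m → Fin 2 → Set (ℝ × ℝ),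
    E = Set.iUnion Es ∧
    (Pairwise fun i j => Disjoint (Es i) (Es j)) ∧
    (∀ i, IsOpen (Es i) ∧ Es i ⊆ disk2 r₀ ∧ (0:ℝ×ℝ) ∈ closure (Es i) ∧
      frontier (Es i) ⊆ Cs i 0 ∪ Cs i 1 ∪ circle2 r₀) ∧
    (∀ i j, IsPuiseuxBdryCurve r₀ (Cs i j)) ∧
    (Pairwise fun (q q' : Fin m × Fin 2) =>
      Disjoint (Cs q.1 q.2 ∩ (closedDisk2 r₀ \ {0}))
               (Cs q'.1 q'.2 ∩ (closedDisk2 r₀ \ {0}))))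

/-- The standard form of the paper: the `fᵢ` are real analytic and not identically zero
near the origin, `g = χ_E ∏ |fᵢ|^(γᵢ)` is integrable near the origin, and `E` is an
admissible domain. -/
structure StandardForm (n : ℕ) (f : Fin n → ℝ × ℝ → ℝ) (γ : Fin n → ℝ)
    (E : Set (ℝ × ℝ)) : Prop where
  analytic : ∃ U ∈ 𝓝 (0 : ℝ × ℝ), ∀ i, AnalyticOnNhd ℝ (f i) U
  nontriv : ∀ i, ¬ (∀ᶠ p in 𝓝 (0 : ℝ × ℝ), f i p = 0)
  integ : ∃ U ∈ 𝓝 (0 : ℝ × ℝ), IntegrableOn (stdFun n f γ E) U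
  domain : IsStdDomain E

/-- The two-sided bound `c₁ rᵉ |log r|^d ≤ ∫_{x²+y²<r²} g ≤ c₂ rᵉ |log r|^d` for all small
`r` ("ball exponents" `ε`, `d` of `g`, as in Lemma 1.1). -/
def BallBound (g : ℝ × ℝ → ℝ) (ε : ℝ) (d : ℕ) : Prop :=
  0 < ε ∧ d ≤ 1 ∧ ∃ c₁ > (0:ℝ), ∃ c₂ > (0:ℝ), ∃ c₃ > (0:ℝ), ∀ r : ℝ, 0 < r → r < c₃ →
    c₁ * r ^ ε * |Real.log r| ^ d ≤ (∫ p in disk2 r, g p) ∧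
    (∫ p in disk2 r, g p) ≤ c₂ * r ^ ε * |Real.log r| ^ d

/-- The strip `{(x,y) : |(x,y)·v| < r, |(x,y)·v^⊥| < c}`. -/
def strip2 (v : ℝ × ℝ) (r c : ℝ) : Set (ℝ × ℝ) :=
  {p : ℝ × ℝ | |dot2 p v| < r ∧ |dot2 p (perp2 v)| < c}

/-- The two-sided bound `a r^δ |log r|^e ≤ ∫_{strip} g ≤ b r^δ |log r|^e` for all small `r`,
for every small `c` ("strip exponents" `δ_v`, `e_v` of `g` in the direction `v`, as in
Lemma 1.2). -/
def StripBound (g : ℝ × ℝ → ℝ) (v : ℝ × ℝ) (δ : ℝ) (e : ℕ) : Prop :=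
  0 < δ ∧ e ≤ 1 ∧ ∃ cv > (0:ℝ), ∀ c : ℝ, 0 < c → c < cv →
    ∃ a > (0:ℝ), ∃ b > (0:ℝ), ∀ r : ℝ, 0 < r → r < c →
      a * r ^ δ * |Real.log r| ^ e ≤ (∫ p in strip2 v r c, g p) ∧
      (∫ p in strip2 v r c, g p) ≤ b * r ^ δ * |Real.log r| ^ e

/-- The order of vanishing of `f` at the origin. -/
def vanishingOrder (f : ℝ × ℝ → ℝ) : ℕ :=
  sInf {k : ℕ | iteratedFDeriv ℝ k f 0 ≠ 0}

/-- (A constant multiple of) the sum of the terms of lowest total degree in the Taylor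
expansion of `f` at the origin, as a homogeneous function on `ℝ²`. -/
def lowestPart (f : ℝ × ℝ → ℝ) (p : ℝ × ℝ) : ℝ :=
  iteratedFDeriv ℝ (vanishingOrder f) f 0 (fun _ => p)

/-- `w` is a tangent direction of the set `C` at the origin. -/
def IsTangentDirAt (C : Set (ℝ × ℝ)) (w : ℝ × ℝ) : Prop :=
  ∃ p : ℕ → ℝ × ℝ, (∀ k, p k ∈ C ∧ p k ≠ 0) ∧
    Tendsto p atTop (𝓝 (0:ℝ×ℝ)) ∧
    (Tendsto (fun k => (nrm2 (p k))⁻¹ • p k) atTop (𝓝 w) ∨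
     Tendsto (fun k => (nrm2 (p k))⁻¹ • p k) atTop (𝓝 (-w)))

/-- `w` is the direction of one of the lines `l₁, …, l_p`: a line through the origin in the
zero set of the lowest-degree Taylor part of some `fᵢ`, or a tangent line at the origin to
one of the boundary curves of `E`. -/
def ExceptionalDir (n : ℕ) (f : Fin n → ℝ × ℝ → ℝ) (E : Set (ℝ × ℝ)) (w : ℝ × ℝ) : Prop :=
  (∃ i, lowestPart (f i) w = 0) ∨ IsTangentDirAt (frontier E) w

/-- Conditions (1.2)-(1.3) on the factor `α`: `C¹` away from the origin, bounded by `A`,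
with gradient bounded by `A (x²+y²)^{-1/2}`. -/
def AlphaBound (α : ℝ × ℝ → ℝ) (A : ℝ) : Prop :=
  ContDiffOn ℝ 1 α {(0:ℝ×ℝ)}ᶜ ∧ (∀ p, |α p| ≤ A) ∧
  ∀ p : ℝ × ℝ, p ≠ 0 → ‖fderiv ℝ α p‖ ≤ A * (nrm2 p)⁻¹

/-- A smooth bump function equal to `1` near `(x₀, y₀)`, supported within (Euclidean)
distance `r` of `(x₀, y₀)`. -/
def IsBump (φ : ℝ × ℝ → ℝ) (x₀ y₀ : ℝ) (r : ℝ) : Prop :=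
  ContDiff ℝ (⊤ : ℕ∞) φ ∧ HasCompactSupport φ ∧ (∀ᶠ p in 𝓝 ((x₀, y₀) : ℝ × ℝ), φ p = 1) ∧
    tsupport φ ⊆ {p : ℝ × ℝ | (p.1 - x₀) ^ 2 + (p.2 - y₀) ^ 2 < r ^ 2}

/-- The oscillatory integral `∫_S h(x,y) e^{i(tx+uy)} dx dy`. -/
def oscInt (h : ℝ × ℝ → ℝ) (S : Set (ℝ × ℝ)) (t u : ℝ) : ℂ :=
  ∫ p in S, (h p : ℂ) * Complex.exp (Complex.I * ((t : ℂ) * (p.1 : ℂ) + (u : ℂ) * (p.2 : ℂ)))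

/-- The convolution kernel `K(t,u) = ∫ m(x,y) e^{i(tx+uy)} dx dy`. -/
def Kfull (m : ℝ × ℝ → ℝ) (t u : ℝ) : ℂ :=
  oscInt m Set.univ t u

/-- The localized kernel `K_φ(t,u) = ∫ φ(x,y) m(x,y) e^{i(tx+uy)} dx dy`. -/
def Kphi (φ m : ℝ × ℝ → ℝ) (t u : ℝ) : ℂ :=
  oscInt (fun p => φ p * m p) Set.univ t u

/-- `k` is a Puiseux function of index `N` on `[0,a]`: `k(x) = k'(x^{1/N})` for a function
`k'` real analytic on an open set containing `[0, a^{1/N}]`; equivalently `x ↦ k(x^N)` is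
real analytic. -/
def PuiseuxOn (N : ℕ) (a : ℝ) (k : ℝ → ℝ) : Prop :=
  ∃ (k' : ℝ → ℝ) (I : Set ℝ), IsOpen I ∧ Icc (0:ℝ) (a ^ ((N:ℝ)⁻¹)) ⊆ I ∧
    AnalyticOnNhd ℝ k' I ∧ ∀ x ∈ Icc (0:ℝ) a, k x = k' (x ^ ((N:ℝ)⁻¹))

/-- `k(x) = l·x^s + higher order terms` as `x → 0⁺`. -/
def LeadingTerm (k : ℝ → ℝ) (l s : ℝ) : Prop :=
  Tendsto (fun x => k x / x ^ s) (𝓝[>] (0:ℝ)) (𝓝 l)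

/-- The mixed partial derivative `∂_x^l ∂_y^m F`. -/
def pderiv2 (l m : ℕ) (F : ℝ × ℝ → ℝ) (p : ℝ × ℝ) : ℝ :=
  iteratedDeriv l (fun x => iteratedDeriv m (fun y => F (x, y)) p.2) p.1

/-- The descending product `α(α−1)⋯(α−l+1)`. -/
def descProd (α : ℝ) (l : ℕ) : ℝ := ∏ j ∈ Finset.range l, (α - (j : ℝ))

/-- The sliver `{(x,y) : 0 < x < a, g(x) < y < G(x)}`. -/
def sliverSet (a : ℝ) (g G : ℝ → ℝ) : Set (ℝ × ℝ) :=
  {q : ℝ × ℝ | 0 < q.1 ∧ q.1 < a ∧ g q.1 < q.2 ∧ q.2 < G q.1}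

/-- A wedge of radius `r₀` at the origin: a region bounded by two lines through the origin
and the circle of radius `r₀`. -/
def IsWedge (r₀ : ℝ) (W : Set (ℝ × ℝ)) : Prop :=
  ∃ θ₁ θ₂ : ℝ, θ₁ < θ₂ ∧ θ₂ ≤ θ₁ + 2 * π ∧
    W = {p : ℝ × ℝ | ∃ ρ θ : ℝ, 0 < ρ ∧ ρ < r₀ ∧ θ₁ < θ ∧ θ < θ₂ ∧
      p = (ρ * Real.cos θ, ρ * Real.sin θ)}

/-- logarithmically Lipschitz functions on `(0,τ)` -/
def LL (τ C : ℝ) (F : ℝ → ℝ) : Prop :=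
  ∀ t ∈ Ioo (0:ℝ) τ, F t ≠ 0 ∧ DifferentiableAt ℝ F t ∧ |t * deriv F t| ≤ C * |F t|

lemma LL.mono {τ τ' C C' : ℝ} {F : ℝ → ℝ} (h : LL τ C F) (hτ : τ' ≤ τ) (hC : C ≤ C') :
    LL τ' C' F := by
  intro t ht
  obtain ⟨h1, h2, h3⟩ := h t ⟨ht.1, ht.2.trans_le hτ⟩
  exact ⟨h1, h2, h3.trans (mul_le_mul_of_nonneg_right hC (abs_nonneg _))⟩

lemma LL.congr {τ C : ℝ} {F G : ℝ → ℝ} (h : LL τ C F) (hFG : ∀ t ∈ Ioo (0:ℝ) τ, G t = F t) :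
    LL τ C G := by
  intro t ht
  obtain ⟨h1, h2, h3⟩ := h t ht
  have he : G =ᶠ[𝓝 t] F := by
    filter_upwards [isOpen_Ioo.mem_nhds ht] with s hs using hFG s hs
  refine ⟨by rw [hFG t ht]; exact h1, h2.congr_of_eventuallyEq he, ?_⟩
  rw [he.deriv_eq, hFG t ht]; exact h3

lemma LL.of_hasDerivAt {τ C : ℝ} {F F' : ℝ → ℝ}
    (h : ∀ t ∈ Ioo (0:ℝ) τ, F t ≠ 0 ∧ HasDerivAt F (F' t) t ∧ |t * F' t| ≤ C * |F t|) :
    LL τ C F := by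
  intro t ht
  obtain ⟨h1, h2, h3⟩ := h t ht
  exact ⟨h1, h2.differentiableAt, by rw [h2.deriv]; exact h3⟩

lemma LL.mul {τ C D : ℝ} {F G : ℝ → ℝ} (hF : LL τ C F) (hG : LL τ D G) :
    LL τ (C + D) (fun t => F t * G t) := by
  intro t ht
  obtain ⟨h1, h2, h3⟩ := hF t ht
  obtain ⟨k1, k2, k3⟩ := hG t ht
  refine ⟨mul_ne_zero h1 k1, h2.mul k2, ?_⟩
  rw [show deriv (fun t => F t * G t) t = deriv F t * G t + F t * deriv G t from
    (h2.hasDerivAt.mul k2.hasDerivAt).deriv]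
  have : t * (deriv F t * G t + F t * deriv G t)
      = (t * deriv F t) * G t + F t * (t * deriv G t) := by ring
  rw [this]
  calc _ ≤ |(t * deriv F t) * G t| + |F t * (t * deriv G t)| := abs_add_le _ _
    _ = |t * deriv F t| * |G t| + |F t| * |t * deriv G t| := by rw [abs_mul, abs_mul (F t)]
    _ ≤ (C * |F t|) * |G t| + |F t| * (D * |G t|) := by gcongr
    _ = (C + D) * |F t * G t| := by rw [abs_mul]; ring

lemma LL.const (τ : ℝ) {c : ℝ} (hc : c ≠ 0) : LL τ 0 (fun _ => c) := by
  intro t ht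
  exact ⟨hc, differentiableAt_const _, by simp⟩

lemma LL.id (τ : ℝ) : LL τ 1 (fun t => t) := by
  intro t ht
  exact ⟨ht.1.ne', differentiableAt_id, by simp⟩

lemma LL.pow {τ C : ℝ} {F : ℝ → ℝ} (hF : LL τ C F) (n : ℕ) :
    LL τ (n * C) (fun t => F t ^ n) := by
  induction n with
  | zero => simpa using LL.const τ one_ne_zero
  | succ n ih =>
    have := ih.mul hF
    simp only [pow_succ]
    push_cast
    convert this using 1; ring

lemma LL.abs_rpow {τ C : ℝ} {F : ℝ → ℝ} (hF : LL τ C F) (γ : ℝ) :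
    LL τ (|γ| * C) (fun t => |F t| ^ γ) := by
  intro t ht
  obtain ⟨h1, h2, h3⟩ := hF t ht
  have hpos : 0 < |F t| := abs_pos.mpr h1
  have hd : HasDerivAt (fun t => |F t| ^ γ)
      ((SignType.sign (F t) * deriv F t) * γ * |F t| ^ (γ - 1)) t := by
    have := (hasDerivAt_abs h1).comp t h2.hasDerivAt
    exact this.rpow_const (Or.inl hpos.ne')
  refine ⟨(rpow_pos_of_pos hpos γ).ne', hd.differentiableAt, ?_⟩
  rw [hd.deriv]
  have hs : |((SignType.sign (F t) : SignType) : ℝ)| ≤ 1 := by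
    rcases lt_trichotomy (F t) 0 with h | h | h
    · simp [sign_neg h]
    · exact absurd h h1
    · simp [sign_pos h]
  rw [rpow_sub_one hpos.ne']
  have e : |t * ((SignType.sign (F t) * deriv F t) * γ * (|F t| ^ γ / |F t|))|
      = |((SignType.sign (F t) : SignType) : ℝ)| * (|t * deriv F t| * |γ| * (|F t| ^ γ / |F t|)) := by
    have hp : 0 < |F t| ^ γ / |F t| := div_pos (rpow_pos_of_pos hpos γ) hpos
    simp only [abs_mul]
    rw [abs_of_pos hp]
    ring
  rw [e, abs_of_pos (rpow_pos_of_pos hpos γ)]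
  calc _ ≤ 1 * ((C * |F t|) * |γ| * (|F t| ^ γ / |F t|)) := by
        gcongr
    _ = |γ| * C * |F t| ^ γ := by field_simp

lemma LL.prod {ι : Type*} (s : Finset ι) {τ : ℝ} {C : ι → ℝ} {F : ι → ℝ → ℝ}
    (h : ∀ i ∈ s, LL τ (C i) (F i)) : LL τ (∑ i ∈ s, C i) (fun t => ∏ i ∈ s, F i t) := by
  classical
  induction s using Finset.induction_on with
  | empty => simpa using LL.const τ one_ne_zero
  | insert a s ha ih =>
    simp only [Finset.sum_insert ha, Finset.prod_insert ha]
    exact (h a (Finset.mem_insert_self _ _)).mul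
      (ih fun i hi => h i (Finset.mem_insert_of_mem hi))

/-- composition with the `N`-th root -/
lemma LL.root {τ C : ℝ} {F : ℝ → ℝ} (hτ : 0 < τ) (hF : LL τ C F) {N : ℕ} (hN : 0 < N) :
    LL (τ ^ N) C (fun y => F (y ^ ((N:ℝ)⁻¹))) := by
  intro y hy
  have hN' : (0:ℝ) < N := by exact_mod_cast hN
  have hN1 : (1:ℝ) ≤ N := by exact_mod_cast hN
  have hmem : y ^ ((N:ℝ)⁻¹) ∈ Ioo (0:ℝ) τ := by
    refine ⟨rpow_pos_of_pos hy.1 _, ?_⟩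
    have := rpow_lt_rpow hy.1.le hy.2 (inv_pos.mpr hN')
    rwa [pow_rpow_inv_natCast hτ.le hN.ne'] at this
  obtain ⟨h1, h2, h3⟩ := hF _ hmem
  have hd : HasDerivAt (fun y : ℝ => y ^ ((N:ℝ)⁻¹)) ((N:ℝ)⁻¹ * y ^ ((N:ℝ)⁻¹ - 1)) y :=
    Real.hasDerivAt_rpow_const (Or.inl hy.1.ne')
  have hc : HasDerivAt (fun y => F (y ^ ((N:ℝ)⁻¹))) _ y := h2.hasDerivAt.comp y hd
  refine ⟨h1, hc.differentiableAt, ?_⟩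
  rw [hc.deriv, rpow_sub_one hy.1.ne']
  have : y * (deriv F (y ^ (N:ℝ)⁻¹) * ((N:ℝ)⁻¹ * (y ^ (N:ℝ)⁻¹ / y)))
      = (N:ℝ)⁻¹ * (y ^ (N:ℝ)⁻¹ * deriv F (y ^ (N:ℝ)⁻¹)) := by
    have := hy.1.ne'
    field_simp
  rw [this, abs_mul, abs_of_pos (inv_pos.mpr hN')]
  calc _ ≤ 1 * |y ^ (N:ℝ)⁻¹ * deriv F (y ^ (N:ℝ)⁻¹)| := by
        gcongr
        exact inv_le_one_of_one_le₀ hN1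
    _ ≤ _ := by rw [one_mul]; exact h3

/-- Cell decomposition adapted to a family `f` of the region `a t < x < b t`, `0 < t < τ`. -/
def HasCells {ι : Type} (f : ι → ℝ × ℝ → ℝ) (a b : ℝ → ℝ) (τ : ℝ) : Prop :=
  ∃ (κ : Type) (_ : Fintype κ) (ψ J : κ → ℝ → ℝ → ℝ) (C : ℝ),
    (∀ k, ContinuousOn (fun p : ℝ × ℝ => ψ k p.1 p.2) (Ioo 0 1 ×ˢ Ioo 0 τ)) ∧
    (∀ k, ContinuousOn (fun p : ℝ × ℝ => J k p.1 p.2) (Ioo 0 1 ×ˢ Ioo 0 τ)) ∧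
    (∀ k, ∀ u ∈ Ioo (0:ℝ) 1, ∀ t ∈ Ioo (0:ℝ) τ, 0 < J k u t ∧ ψ k u t ∈ Ioo (a t) (b t)) ∧
    (∀ k, ∀ u ∈ Ioo (0:ℝ) 1, LL τ C (J k u)) ∧
    (∀ k, ∀ u ∈ Ioo (0:ℝ) 1, ∀ i, LL τ C (fun t => f i (ψ k u t, t))) ∧
    (∀ t ∈ Ioo (0:ℝ) τ, ∀ F : ℝ → ℝ≥0∞, Measurable F →
      ∫⁻ x in Ioo (a t) (b t), F x
        = ∑ k, ∫⁻ u in Ioo (0:ℝ) 1, F (ψ k u t) * ENNReal.ofReal (J k u t))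

lemma HasCells.mono {ι : Type} {f : ι → ℝ × ℝ → ℝ} {a b : ℝ → ℝ} {τ τ' : ℝ}
    (h : HasCells f a b τ) (hτ : τ' ≤ τ) : HasCells f a b τ' := by
  obtain ⟨κ, _, ψ, J, C, h1, h2, h3, h4, h5, h6⟩ := h
  have hs : Ioo (0:ℝ) τ' ⊆ Ioo 0 τ := Ioo_subset_Ioo_right hτ
  exact ⟨κ, inferInstance, ψ, J, C, fun k => (h1 k).mono (prod_mono le_rfl hs),
    fun k => (h2 k).mono (prod_mono le_rfl hs), fun k u hu t ht => h3 k u hu t (hs ht),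
    fun k u hu => (h4 k u hu).mono hτ le_rfl, fun k u hu i => (h5 k u hu i).mono hτ le_rfl,
    fun t ht => h6 t (hs ht)⟩

lemma HasCells.concat {ι : Type} {f : ι → ℝ × ℝ → ℝ} {a b c : ℝ → ℝ} {τ : ℝ}
    (h : HasCells f a b τ) (h' : HasCells f b c τ)
    (hab : ∀ t ∈ Ioo (0:ℝ) τ, a t < b t) (hbc : ∀ t ∈ Ioo (0:ℝ) τ, b t < c t) :
    HasCells f a c τ := by
  obtain ⟨κ, _, ψ, J, C, h1, h2, h3, h4, h5, h6⟩ := h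
  obtain ⟨κ', _, ψ', J', C', h1', h2', h3', h4', h5', h6'⟩ := h'
  refine ⟨κ ⊕ κ', inferInstance, Sum.elim ψ ψ', Sum.elim J J', max C C', ?_, ?_, ?_, ?_, ?_, ?_⟩
  · rintro (k | k)
    · exact h1 k
    · exact h1' k
  · rintro (k | k)
    · exact h2 k
    · exact h2' k
  · rintro (k | k) u hu t ht
    · exact ⟨(h3 k u hu t ht).1, (h3 k u hu t ht).2.1, (h3 k u hu t ht).2.2.trans (hbc t ht)⟩
    · exact ⟨(h3' k u hu t ht).1, (hab t ht).trans (h3' k u hu t ht).2.1, (h3' k u hu t ht).2.2⟩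
  · rintro (k | k) u hu
    · exact (h4 k u hu).mono le_rfl (le_max_left _ _)
    · exact (h4' k u hu).mono le_rfl (le_max_right _ _)
  · rintro (k | k) u hu i
    · exact (h5 k u hu i).mono le_rfl (le_max_left _ _)
    · exact (h5' k u hu i).mono le_rfl (le_max_right _ _)
  · intro t ht F hF
    rw [Fintype.sum_sum_type]
    simp only [Sum.elim_inl, Sum.elim_inr]
    rw [← h6 t ht F hF, ← h6' t ht F hF, ← Ioo_union_Ico_eq_Ioo (hab t ht) (hbc t ht).le,
      lintegral_union measurableSet_Ico]
    · congr 1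
      exact setLIntegral_congr Ioo_ae_eq_Ico.symm
    · rw [Set.disjoint_left]
      intro x hx hx'
      exact absurd hx.2 (not_lt.mpr hx'.1)

/-- affine change of variable for lower integrals on an interval. -/
lemma lintegral_affine (q s a b : ℝ) (hs : s ≠ 0) (F : ℝ → ℝ≥0∞) (hF : Measurable F) (S : Set ℝ)
    (hS : S = (fun z => q + s * z) '' Ioo a b) :
    ∫⁻ x in S, F x = ∫⁻ z in Ioo a b, F (q + s * z) * ENNReal.ofReal |s| := by
  rw [hS, lintegral_image_eq_lintegral_abs_deriv_mul measurableSet_Ioo (f' := fun _ => s)]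
  · simp_rw [mul_comm]
  · intro x _
    have := ((hasDerivAt_id x).const_mul s).const_add q
    simpa using this.hasDerivWithinAt
  · intro x _ y _ hxy
    simpa [hs] using hxy

lemma image_affine_pos (q s a b : ℝ) (hs : 0 < s) :
    (fun z => q + s * z) '' Ioo a b = Ioo (q + s * a) (q + s * b) := by
  ext x
  constructor
  · rintro ⟨z, hz, rfl⟩
    exact ⟨by nlinarith [hz.1], by nlinarith [hz.2]⟩
  · rintro ⟨h1, h2⟩
    refine ⟨(x - q) / s, ⟨?_, ?_⟩, by field_simp; ring⟩
    · rw [lt_div_iff₀ hs]; nlinarith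
    · rw [div_lt_iff₀ hs]; nlinarith

lemma image_affine_neg (q s a b : ℝ) (hs : s < 0) :
    (fun z => q + s * z) '' Ioo a b = Ioo (q + s * b) (q + s * a) := by
  ext x
  constructor
  · rintro ⟨z, hz, rfl⟩
    exact ⟨by nlinarith [hz.2], by nlinarith [hz.1]⟩
  · rintro ⟨h1, h2⟩
    refine ⟨(x - q) / s, ⟨?_, ?_⟩, by field_simp [hs.ne]; ring⟩
    · rw [lt_div_iff_of_neg hs]; nlinarith
    · rw [div_lt_iff_of_neg hs]; nlinarith

lemma HasCells.affine {ι : Type} [Fintype ι] {f f' : ι → ℝ × ℝ → ℝ} {a b a' b' q s : ℝ → ℝ}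
    {e : ι → ℝ → ℝ} {τ Cs : ℝ} {Ce : ι → ℝ}
    (h : HasCells f' a' b' τ)
    (hq : ContinuousOn q (Ioo 0 τ)) (hs : LL τ Cs s)
    (he : ∀ i, LL τ (Ce i) (e i))
    (himg : ∀ t ∈ Ioo (0:ℝ) τ, Ioo (a t) (b t) = (fun z => q t + s t * z) '' Ioo (a' t) (b' t))
    (hf : ∀ i, ∀ t ∈ Ioo (0:ℝ) τ, ∀ z ∈ Ioo (a' t) (b' t),
      f i (q t + s t * z, t) = e i t * f' i (z, t)) :
    HasCells f a b τ := by
  obtain ⟨κ, _, ψ, J, C, h1, h2, h3, h4, h5, h6⟩ := h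
  have hsc : ContinuousOn s (Ioo 0 τ) := fun t ht =>
    ((hs t ht).2.1.continuousAt).continuousWithinAt
  have hsnd : MapsTo (fun p : ℝ × ℝ => p.2) (Ioo (0:ℝ) 1 ×ˢ Ioo 0 τ) (Ioo 0 τ) :=
    fun p hp => hp.2
  have hs2 : ContinuousOn (fun p : ℝ × ℝ => s p.2) (Ioo (0:ℝ) 1 ×ˢ Ioo 0 τ) :=
    hsc.comp continuousOn_snd hsnd
  have hq2 : ContinuousOn (fun p : ℝ × ℝ => q p.2) (Ioo (0:ℝ) 1 ×ˢ Ioo 0 τ) :=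
    hq.comp continuousOn_snd hsnd
  obtain ⟨M, hM⟩ : ∃ M, ∀ i, Ce i ≤ M := by
    refine ⟨∑ i, |Ce i|, fun i => (le_abs_self _).trans ?_⟩
    exact Finset.single_le_sum (f := fun i => |Ce i|) (fun _ _ => abs_nonneg _)
      (Finset.mem_univ i)
  have hsabs : LL τ Cs (fun t => |s t|) := by
    have := hs.abs_rpow 1
    simpa using this
  refine ⟨κ, inferInstance, fun k u t => q t + s t * ψ k u t, fun k u t => |s t| * J k u t,
    max (Cs + C) (M + C), ?_, ?_, ?_, ?_, ?_, ?_⟩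
  · intro k; exact hq2.add (hs2.mul (h1 k))
  · intro k; exact hs2.abs.mul (h2 k)
  · intro k u hu t ht
    refine ⟨mul_pos (abs_pos.mpr (hs t ht).1) (h3 k u hu t ht).1, ?_⟩
    rw [himg t ht]
    exact ⟨_, (h3 k u hu t ht).2, rfl⟩
  · intro k u hu
    exact (hsabs.mul (h4 k u hu)).mono le_rfl (le_max_left _ _)
  · intro k u hu i
    refine LL.congr (((he i).mul (h5 k u hu i)).mono le_rfl ?_) ?_
    · exact (add_le_add_left (hM i) C).trans (le_max_right _ _)
    · intro t ht
      exact hf i t ht _ (h3 k u hu t ht).2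
  · intro t ht F hF
    rw [lintegral_affine (q t) (s t) (a' t) (b' t) (hs t ht).1 F hF _ (himg t ht),
      h6 t ht (fun z => F (q t + s t * z) * ENNReal.ofReal |s t|) (by fun_prop)]
    refine Finset.sum_congr rfl fun k _ => ?_
    refine setLIntegral_congr_fun measurableSet_Ioo fun u hu => ?_
    simp only
    rw [mul_assoc, ← ENNReal.ofReal_mul (abs_nonneg _)]

lemma HasCells.root {ι : Type} {f : ι → ℝ × ℝ → ℝ} {a b τ : ℝ} {N : ℕ} (hN : 0 < N) (hτ : 0 < τ)
    (h : HasCells (fun i p => f i (p.1, p.2 ^ N)) (fun _ => a) (fun _ => b) τ) :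
    HasCells f (fun _ => a) (fun _ => b) (τ ^ N) := by
  obtain ⟨κ, _, ψ, J, C, h1, h2, h3, h4, h5, h6⟩ := h
  have hN' : (0:ℝ) < N := by exact_mod_cast hN
  have hmem : ∀ y ∈ Ioo (0:ℝ) (τ ^ N), y ^ ((N:ℝ)⁻¹) ∈ Ioo (0:ℝ) τ := by
    intro y hy
    refine ⟨rpow_pos_of_pos hy.1 _, ?_⟩
    have := rpow_lt_rpow hy.1.le hy.2 (inv_pos.mpr hN')
    rwa [pow_rpow_inv_natCast hτ.le hN.ne'] at this
  have hm : MapsTo (fun p : ℝ × ℝ => (p.1, p.2 ^ ((N:ℝ)⁻¹))) (Ioo (0:ℝ) 1 ×ˢ Ioo 0 (τ ^ N))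
      (Ioo (0:ℝ) 1 ×ˢ Ioo 0 τ) := fun p hp => ⟨hp.1, hmem _ hp.2⟩
  have hc : ContinuousOn (fun p : ℝ × ℝ => (p.1, p.2 ^ ((N:ℝ)⁻¹)))
      (Ioo (0:ℝ) 1 ×ˢ Ioo 0 (τ ^ N)) := by
    refine ContinuousOn.prodMk continuousOn_fst ?_
    exact continuousOn_snd.rpow_const fun p hp => Or.inl hp.2.1.ne'
  refine ⟨κ, inferInstance, fun k u y => ψ k u (y ^ ((N:ℝ)⁻¹)),
    fun k u y => J k u (y ^ ((N:ℝ)⁻¹)), C, ?_, ?_, ?_, ?_, ?_, ?_⟩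
  · intro k; exact (h1 k).comp hc hm
  · intro k; exact (h2 k).comp hc hm
  · intro k u hu t ht; exact h3 k u hu _ (hmem t ht)
  · intro k u hu; exact (h4 k u hu).root hτ hN
  · intro k u hu i
    refine LL.congr ((h5 k u hu i).root hτ hN) ?_
    intro y hy
    simp only
    rw [rpow_inv_natCast_pow hy.1.le hN.ne']
  · intro t ht F hF
    exact h6 _ (hmem t ht) F hF

lemma HasCells.linear {ι : Type} {f : ι → ℝ × ℝ → ℝ} {a b : ℝ → ℝ} {τ C : ℝ}
    (ha : ContinuousOn a (Ioo 0 τ)) (hb : ContinuousOn b (Ioo 0 τ))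
    (hab : ∀ t ∈ Ioo (0:ℝ) τ, a t < b t)
    (hJ : LL τ C (fun t => b t - a t))
    (hf : ∀ u ∈ Ioo (0:ℝ) 1, ∀ i, LL τ C (fun t => f i (a t + (b t - a t) * u, t))) :
    HasCells f a b τ := by
  have hsnd : MapsTo (fun p : ℝ × ℝ => p.2) (Ioo (0:ℝ) 1 ×ˢ Ioo 0 τ) (Ioo 0 τ) :=
    fun p hp => hp.2
  have ha2 : ContinuousOn (fun p : ℝ × ℝ => a p.2) (Ioo (0:ℝ) 1 ×ˢ Ioo 0 τ) :=
    ha.comp continuousOn_snd hsnd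
  have hb2 : ContinuousOn (fun p : ℝ × ℝ => b p.2) (Ioo (0:ℝ) 1 ×ˢ Ioo 0 τ) :=
    hb.comp continuousOn_snd hsnd
  have key : ∀ t ∈ Ioo (0:ℝ) τ,
      Ioo (a t) (b t) = (fun z => a t + (b t - a t) * z) '' Ioo 0 1 := by
    intro t ht
    rw [image_affine_pos _ _ _ _ (sub_pos.mpr (hab t ht))]
    congr 1 <;> ring
  refine ⟨Unit, inferInstance, fun _ u t => a t + (b t - a t) * u, fun _ u t => b t - a t, C,
    ?_, ?_, ?_, ?_, ?_, ?_⟩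
  · intro _; exact ha2.add ((hb2.sub ha2).mul continuousOn_fst)
  · intro _; exact hb2.sub ha2
  · intro _ u hu t ht
    refine ⟨sub_pos.mpr (hab t ht), ?_⟩
    rw [key t ht]
    exact ⟨u, hu, rfl⟩
  · intro _ u hu; exact hJ
  · intro _ u hu i; exact hf u hu i
  · intro t ht F hF
    have hp := sub_pos.mpr (hab t ht)
    rw [lintegral_affine (a t) (b t - a t) 0 1 hp.ne' F hF _ (key t ht)]
    simp [abs_of_pos hp]

def LS (s : ℝ) : ℝ × ℝ →L[ℝ] ℝ × ℝ :=
  (s • ContinuousLinearMap.fst ℝ ℝ ℝ).prod (ContinuousLinearMap.snd ℝ ℝ ℝ)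

lemma LS_apply (s : ℝ) (p : ℝ × ℝ) : LS s p = (s * p.1, p.2) := rfl

lemma LS_continuous : Continuous LS := by
  have : LS = fun s => s • (ContinuousLinearMap.fst ℝ ℝ ℝ).prod (0 : ℝ × ℝ →L[ℝ] ℝ)
      + (0 : ℝ × ℝ →L[ℝ] ℝ).prod (ContinuousLinearMap.snd ℝ ℝ ℝ) := by
    funext s; ext p <;> simp [LS]
  rw [this]
  fun_prop

lemma LS_norm {s : ℝ} (hs : s ∈ Icc (0:ℝ) 1) : ‖LS s‖ ≤ 1 := by
  refine ContinuousLinearMap.opNorm_le_bound _ zero_le_one fun p => ?_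
  rw [LS_apply, Prod.norm_def, Prod.norm_def, one_mul]
  refine max_le_max ?_ le_rfl
  simp only [norm_mul, Real.norm_eq_abs, abs_of_nonneg hs.1]
  nlinarith [abs_nonneg p.1, hs.2]

lemma analyticAt_avg {g : ℝ × ℝ → ℝ} (hg : AnalyticAt ℝ g 0) :
    AnalyticAt ℝ (fun p => ∫ s in (0:ℝ)..1, g (LS s p)) 0 := by
  obtain ⟨P, r, hP⟩ := hg
  have hcont : ∀ n, Continuous fun s => (P n).compContinuousLinearMap (fun _ => LS s) := by
    intro n
    have h1 := (ContinuousMultilinearMap.compContinuousLinearMapContinuousMultilinear ℝ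
      (fun _ : Fin n => ℝ × ℝ) (fun _ : Fin n => ℝ × ℝ) ℝ).cont
    have h2 : Continuous fun s : ℝ => (fun _ : Fin n => LS s) :=
      continuous_pi fun _ => LS_continuous
    have h3 := h1.comp h2
    have h4 := h3.clm_apply (continuous_const (y := P n))
    exact h4
  have hnorm : ∀ n, ∀ s ∈ Icc (0:ℝ) 1, ‖(P n).compContinuousLinearMap (fun _ => LS s)‖ ≤ ‖P n‖ := by
    intro n s hs
    refine (ContinuousMultilinearMap.norm_compContinuousLinearMap_le _ _).trans ?_
    refine mul_le_of_le_one_right (norm_nonneg _) ?_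
    exact Finset.prod_le_one (fun _ _ => norm_nonneg _) (fun _ _ => LS_norm hs)
  let Q : FormalMultilinearSeries ℝ (ℝ × ℝ) ℝ := fun n =>
    ∫ s in (0:ℝ)..1, (P n).compContinuousLinearMap (fun _ => LS s)
  have hQn : ∀ n, ‖Q n‖ ≤ ‖P n‖ := by
    intro n
    have := intervalIntegral.norm_integral_le_of_norm_le_const (a := 0) (b := 1) (C := ‖P n‖)
      (f := fun s => (P n).compContinuousLinearMap (fun _ => LS s)) (by
        intro s hs
        rw [uIoc_of_le zero_le_one] at hs
        exact hnorm n s ⟨hs.1.le, hs.2⟩)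
    simpa using this
  have hQa : ∀ n (y : ℝ × ℝ), Q n (fun _ => y) = ∫ s in (0:ℝ)..1, P n (fun _ => LS s y) := by
    intro n y
    have := ContinuousLinearMap.intervalIntegral_comp_comm (a := (0:ℝ)) (b := 1) (μ := volume)
      (ContinuousMultilinearMap.apply ℝ (fun _ : Fin n => ℝ × ℝ) ℝ (fun _ => y))
      ((hcont n).intervalIntegrable 0 1)
    rw [ContinuousMultilinearMap.apply_apply] at this
    exact this.symm
  refine ⟨Q, r, ?_, hP.r_pos, ?_⟩
  · refine hP.r_le.trans ?_
    refine ENNReal.le_of_forall_nnreal_lt fun r' hr' => ?_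
    obtain ⟨C, hC, h⟩ := P.norm_mul_pow_le_of_lt_radius hr'
    refine Q.le_radius_of_bound C fun n => ?_
    exact le_trans (mul_le_mul_of_nonneg_right (hQn n) (by positivity)) (h n)
  · intro y hy
    simp only [zero_add]
    have hy' : (‖y‖₊ : ℝ≥0∞) < r := by
      have := Metric.mem_eball.1 hy
      rwa [edist_zero_right, enorm_eq_nnnorm] at this
    have hsum : Summable fun n => ‖P n‖ * ‖y‖ ^ n :=
      P.summable_norm_mul_pow (r := ‖y‖₊) (lt_of_lt_of_le hy' hP.r_le)
    simp only [hQa]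
    refine intervalIntegral.hasSum_integral_of_dominated_convergence
      (fun n _ => ‖P n‖ * ‖y‖ ^ n) ?_ ?_ ?_ ?_ ?_
    · intro n
      have : Continuous fun s => P n (fun _ => LS s y) := by
        refine (P n).cont.comp (continuous_pi fun _ => ?_)
        exact LS_continuous.clm_apply continuous_const
      exact this.aestronglyMeasurable
    · intro n
      refine Eventually.of_forall fun s hs => ?_
      rw [uIoc_of_le zero_le_one] at hs
      have := ((P n).compContinuousLinearMap (fun _ => LS s)).le_opNorm (fun _ => y)
      simp only [Finset.prod_const, Finset.card_univ, Fintype.card_fin] at this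
      exact this.trans (mul_le_mul_of_nonneg_right (hnorm n s ⟨hs.1.le, hs.2⟩) (by positivity))
    · exact Eventually.of_forall fun _ _ => hsum
    · simp
    · refine Eventually.of_forall fun s hs => ?_
      rw [uIoc_of_le zero_le_one] at hs
      have hmem : LS s y ∈ Metric.eball (0 : ℝ × ℝ) r := by
        rw [Metric.mem_eball, edist_zero_right]
        refine lt_of_le_of_lt ?_ hy'
        rw [enorm_eq_nnnorm]
        norm_cast
        have h1 := (LS s).le_opNorm y
        have h2 := LS_norm ⟨hs.1.le, hs.2⟩
        have : ‖LS s y‖ ≤ ‖y‖ := by nlinarith [norm_nonneg y]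
        exact this
      simpa using hP.hasSum hmem

lemma analytic_div {f : ℝ × ℝ → ℝ} (hf : AnalyticAt ℝ f 0) :
    ∃ h : ℝ × ℝ → ℝ, AnalyticAt ℝ h 0 ∧ ∀ᶠ p in 𝓝 (0 : ℝ × ℝ), f p = f (0, p.2) + p.1 * h p := by
  have hg : AnalyticAt ℝ (fun p => fderiv ℝ f p (1, 0)) 0 :=
    ((ContinuousLinearMap.apply ℝ ℝ ((1, 0) : ℝ × ℝ)).analyticAt _).comp hf.fderiv
  refine ⟨_, analyticAt_avg hg, ?_⟩
  obtain ⟨ε, hε, hball⟩ := Metric.eventually_nhds_iff_ball.1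
    (hf.eventually_analyticAt.and hg.eventually_analyticAt)
  filter_upwards [ball_mem_nhds (0:ℝ×ℝ) hε] with p hp
  have hin : ∀ s ∈ Icc (0:ℝ) 1, LS s p ∈ ball (0 : ℝ × ℝ) ε := by
    intro s hs
    rw [mem_ball_zero_iff] at hp ⊢
    have h1 := (LS s).le_opNorm p
    have h2 := LS_norm hs
    nlinarith [norm_nonneg p]
  have hd : ∀ s ∈ uIcc (0:ℝ) 1, HasDerivAt (fun s => f (LS s p))
      (p.1 * fderiv ℝ f (LS s p) (1, 0)) s := by
    intro s hs
    rw [uIcc_of_le zero_le_one] at hs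
    have h1 := (hball _ (hin s hs)).1.differentiableAt.hasFDerivAt
    have h2 : HasDerivAt (fun s => LS s p) ((p.1, 0) : ℝ × ℝ) s := by
      simp only [LS_apply]
      simpa using ((hasDerivAt_id s).mul_const p.1).prodMk (hasDerivAt_const s p.2)
    have h3 := h1.comp_hasDerivAt s h2
    have : ((p.1, 0) : ℝ × ℝ) = p.1 • (1, 0) := by simp
    rw [this, map_smul, smul_eq_mul] at h3
    exact h3
  have hint : IntervalIntegrable (fun s => p.1 * fderiv ℝ f (LS s p) (1, 0)) volume 0 1 := by
    refine ContinuousOn.intervalIntegrable fun s hs => ?_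
    rw [uIcc_of_le zero_le_one] at hs
    have h1 := (hball _ (hin s hs)).2.continuousAt
    have h2 : ContinuousAt (fun s => LS s p) s :=
      (LS_continuous.clm_apply continuous_const).continuousAt
    have h3 : ContinuousAt (fun s => fderiv ℝ f (LS s p) (1, 0)) s :=
      ContinuousAt.comp (f := fun s => LS s p) (g := fun q => fderiv ℝ f q (1, 0)) h1 h2
    exact (continuousAt_const.mul h3).continuousWithinAt
  have := intervalIntegral.integral_eq_sub_of_hasDerivAt hd hint
  rw [intervalIntegral.integral_const_mul] at this
  simp only [LS_apply, one_mul, zero_mul] at this ⊢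
  rw [this]; simp

def DD (k : ℕ) (f : ℝ × ℝ → ℝ) (p : ℝ × ℝ) : ℝ := iteratedDeriv k (fun x => f (x, p.2)) p.1

lemma DD_succ (k : ℕ) (f : ℝ × ℝ → ℝ) (p : ℝ × ℝ) :
    DD (k+1) f p = deriv (fun x => DD k f (x, p.2)) p.1 := by
  simp only [DD, iteratedDeriv_succ]

lemma DD_analyticAt {f : ℝ × ℝ → ℝ} {p₀ : ℝ × ℝ} (hf : AnalyticAt ℝ f p₀) (k : ℕ) :
    AnalyticAt ℝ (DD k f) p₀ := by
  induction k with
  | zero =>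
    have : DD 0 f = f := by funext p; simp [DD]
    rwa [this]
  | succ k ih =>
    have h1 : AnalyticAt ℝ (fun p => fderiv ℝ (DD k f) p (1, 0)) p₀ :=
      ((ContinuousLinearMap.apply ℝ ℝ ((1, 0) : ℝ × ℝ)).analyticAt _).comp ih.fderiv
    refine h1.congr ?_
    filter_upwards [ih.eventually_analyticAt] with p hp
    rw [DD_succ]
    have h2 : HasDerivAt (fun x : ℝ => ((x, p.2) : ℝ × ℝ)) (1, 0) p.1 :=
      (hasDerivAt_id p.1).prodMk (hasDerivAt_const p.1 p.2)
    have h3 : HasFDerivAt (DD k f) (fderiv ℝ (DD k f) p) ((fun x : ℝ => ((x, p.2) : ℝ × ℝ)) p.1) :=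
      hp.differentiableAt.hasFDerivAt
    exact (h3.comp_hasDerivAt p.1 h2).deriv.symm

lemma analyticAt_slice {f : ℝ × ℝ → ℝ} {x t : ℝ} (hf : AnalyticAt ℝ f (x, t)) :
    AnalyticAt ℝ (fun x => f (x, t)) x :=
  AnalyticAt.comp (f := fun x : ℝ => ((x, t) : ℝ × ℝ)) (g := f) hf
    (analyticAt_id.prod analyticAt_const)

lemma analyticAt_slice_snd {f : ℝ × ℝ → ℝ} {x t : ℝ} (hf : AnalyticAt ℝ f (x, t)) :
    AnalyticAt ℝ (fun t => f (x, t)) t :=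
  AnalyticAt.comp (f := fun t : ℝ => ((x, t) : ℝ × ℝ)) (g := f) hf
    (analyticAt_const.prod analyticAt_id)

lemma iteratedDeriv_x_mul {h : ℝ → ℝ} (hh : AnalyticAt ℝ h 0) (a : ℝ) (k : ℕ) :
    iteratedDeriv (k+1) (fun x => a + x * h x) 0 = (k+1) * iteratedDeriv k h 0 := by
  rw [iteratedDeriv_const_add (Nat.succ_pos k)]
  have := iteratedDeriv_mul (n := k+1) (f := fun x : ℝ => x) (g := h) (x := (0:ℝ))
    contDiffAt_id (hh.contDiffAt)
  have e : (fun x : ℝ => x) * h = fun x => x * h x := rfl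
  rw [e] at this
  rw [this, Finset.sum_eq_single 1]
  · simp [iteratedDeriv_fun_id_zero]
  · intro b _ hb
    simp [iteratedDeriv_fun_id_zero, hb]
  · intro hb; simp at hb

/-- eventual statements near `0` in the plane restrict to the `t` axis -/
lemma eventually_axis {P : ℝ × ℝ → Prop} (h : ∀ᶠ p in 𝓝 (0 : ℝ × ℝ), P p) :
    ∀ᶠ t in 𝓝 (0 : ℝ), ∀ᶠ x in 𝓝 (0 : ℝ), P (x, t) := by
  have h' : ∀ᶠ p in (𝓝 (0:ℝ)) ×ˢ (𝓝 (0:ℝ)), P p := by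
    rw [← nhds_prod_eq]; exact h
  have := (eventually_swap_iff.1 h').curry
  exact this

lemma DD_zero_of_div {f h : ℝ × ℝ → ℝ} (hh : AnalyticAt ℝ h 0)
    (H : ∀ᶠ p in 𝓝 (0 : ℝ × ℝ), f p = f (0, p.2) + p.1 * h p) (k : ℕ) :
    ∀ᶠ t in 𝓝 (0 : ℝ), DD (k+1) f (0, t) = (k+1) * DD k h (0, t) := by
  filter_upwards [eventually_axis H, eventually_axis hh.eventually_analyticAt] with t ht1 ht2
  have h1 : (fun x => f (x, t)) =ᶠ[𝓝 0] fun x => f (0, t) + x * h (x, t) := ht1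
  simp only [DD]
  rw [h1.iteratedDeriv_eq (k+1)]
  exact iteratedDeriv_x_mul (h := fun x => h (x, t)) (analyticAt_slice ht2.self_of_nhds) _ k

lemma taylor2 (m : ℕ) : ∀ {f : ℝ × ℝ → ℝ}, AnalyticAt ℝ f 0 →
    ∃ u : ℝ × ℝ → ℝ, AnalyticAt ℝ u 0 ∧ ∀ᶠ p in 𝓝 (0 : ℝ × ℝ),
      f p = (∑ k ∈ Finset.range m, DD k f (0, p.2) / (k.factorial : ℝ) * p.1 ^ k) + p.1 ^ m * u p := by
  induction m with
  | zero => intro f hf; exact ⟨f, hf, by simp⟩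
  | succ m ih =>
    intro f hf
    obtain ⟨h, hh, H⟩ := analytic_div hf
    obtain ⟨u, hu, HU⟩ := ih hh
    refine ⟨u, hu, ?_⟩
    have h1 : ∀ k ∈ Finset.range m, ∀ᶠ p in 𝓝 (0 : ℝ × ℝ),
        DD (k+1) f (0, p.2) = (k+1) * DD k h (0, p.2) := by
      intro k _
      exact (continuous_snd.tendsto (0:ℝ×ℝ)).eventually (DD_zero_of_div hh H k)
    have h2 := (Finset.eventually_all (Finset.range m)).2 h1
    filter_upwards [H, HU, h2] with p hp1 hp2 hp3
    rw [Finset.sum_range_succ', hp1, hp2]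
    have h3 : ∑ k ∈ Finset.range m, DD (k+1) f (0, p.2) / ((k+1).factorial : ℝ) * p.1 ^ (k+1)
        = p.1 * ∑ k ∈ Finset.range m, DD k h (0, p.2) / (k.factorial : ℝ) * p.1 ^ k := by
      rw [Finset.mul_sum]
      refine Finset.sum_congr rfl fun k hk => ?_
      rw [hp3 k hk, Nat.factorial_succ]
      have : (k.factorial : ℝ) ≠ 0 := by positivity
      push_cast
      field_simp
      ring
    rw [h3]
    simp [DD]
    ring

lemma DD_shift (k : ℕ) (f : ℝ × ℝ → ℝ) (q : ℝ → ℝ) (p : ℝ × ℝ) :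
    DD k (fun p => f (p.1 + q p.2, p.2)) p = DD k f (p.1 + q p.2, p.2) := by
  simp only [DD]
  have := iteratedDeriv_comp_add_const (n := k) (f := fun x => f (x, p.2)) (s := q p.2)
  exact congrFun this p.1

lemma implicit_line {F : ℝ × ℝ → ℝ} (hF : AnalyticAt ℝ F 0) (h0 : F 0 = 0)
    (h1 : DD 1 F 0 ≠ 0) :
    ∃ q : ℝ → ℝ, AnalyticAt ℝ q 0 ∧ q 0 = 0 ∧ ∀ᶠ t in 𝓝 (0:ℝ), F (q t, t) = 0 := by
  let G : ℝ × ℝ → ℝ := fun p => F (p.2, p.1)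
  have hG : AnalyticAt ℝ G 0 :=
    AnalyticAt.comp (f := fun p : ℝ × ℝ => ((p.2, p.1) : ℝ × ℝ)) (g := F) (x := (0:ℝ×ℝ)) hF
      (analyticAt_snd.prod analyticAt_fst)
  have hGc : ContDiffAt ℝ (⊤ : WithTop ℕ∞) G 0 := hG.contDiffAt
  have hd : (fderiv ℝ G 0) (0, 1) = DD 1 F 0 := by
    have h2 : HasDerivAt (fun x : ℝ => (((0:ℝ), x) : ℝ × ℝ)) (0, 1) 0 :=
      (hasDerivAt_const (0:ℝ) (0:ℝ)).prodMk (hasDerivAt_id (0:ℝ))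
    have h3 : HasFDerivAt G (fderiv ℝ G 0) ((fun x : ℝ => (((0:ℝ), x) : ℝ × ℝ)) 0) :=
      hG.differentiableAt.hasFDerivAt
    have := (h3.comp_hasDerivAt 0 h2).deriv
    rw [← this]
    simp only [DD, iteratedDeriv_one]
    rfl
  have hinv : (fderiv ℝ G 0 ∘L .inr ℝ ℝ ℝ).IsInvertible := by
    refine ⟨ContinuousLinearEquiv.unitsEquivAut ℝ (Units.mk0 _ h1), ?_⟩
    ext
    simp [hd]
  refine ⟨hGc.implicitFunction (by simp) hinv, ?_, ?_, ?_⟩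
  · have := hGc.contDiffAt_implicitFunction (by simp) hinv
    exact this.analyticAt
  · exact hGc.implicitFunction_apply_self (by simp) hinv
  · have := hGc.eventually_apply_implicitFunction (by simp) hinv
    have hG0 : G 0 = 0 := h0
    rw [hG0] at this
    exact this

lemma analytic_div_snd {f : ℝ × ℝ → ℝ} (hf : AnalyticAt ℝ f 0) :
    ∃ h : ℝ × ℝ → ℝ, AnalyticAt ℝ h 0 ∧ ∀ᶠ p in 𝓝 (0 : ℝ × ℝ), f p = f (p.1, 0) + p.2 * h p := by
  have hsw : ∀ {F : ℝ × ℝ → ℝ}, AnalyticAt ℝ F 0 → AnalyticAt ℝ (fun p : ℝ × ℝ => F (p.2, p.1)) 0 :=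
    fun {F} hF => AnalyticAt.comp (f := fun p : ℝ × ℝ => ((p.2, p.1) : ℝ × ℝ)) (g := F)
      (x := (0:ℝ×ℝ)) hF (analyticAt_snd.prod analyticAt_fst)
  obtain ⟨h, hh, H⟩ := analytic_div (hsw hf)
  refine ⟨fun p => h (p.2, p.1), hsw hh, ?_⟩
  have hc : Tendsto (fun p : ℝ × ℝ => ((p.2, p.1) : ℝ × ℝ)) (𝓝 0) (𝓝 0) := by
    have : Continuous (fun p : ℝ × ℝ => ((p.2, p.1) : ℝ × ℝ)) := by fun_prop
    exact this.tendsto (0:ℝ×ℝ)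
  exact hc.eventually H

lemma analytic_zero_of_rays {f : ℝ × ℝ → ℝ} (hf : AnalyticAt ℝ f 0)
    (h : ∀ p : ℝ × ℝ, ∀ᶠ s in 𝓝 (0:ℝ), f (s • p) = 0) : ∀ᶠ p in 𝓝 (0 : ℝ × ℝ), f p = 0 := by
  obtain ⟨ε, hε, hball⟩ := Metric.eventually_nhds_iff_ball.1 hf.eventually_analyticAt
  filter_upwards [ball_mem_nhds (0:ℝ×ℝ) hε] with p hp
  let S : Set ℝ := (fun s : ℝ => s • p) ⁻¹' ball (0:ℝ×ℝ) ε
  have hS : Convex ℝ S := by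
    have := (convex_ball (0:ℝ×ℝ) ε).linear_preimage ((LinearMap.id : ℝ →ₗ[ℝ] ℝ).smulRight p)
    exact this
  have han : AnalyticOnNhd ℝ (fun s : ℝ => f (s • p)) S := by
    intro s hs
    refine AnalyticAt.comp (f := fun s : ℝ => s • p) (g := f) (hball _ hs) ?_
    exact analyticAt_id.smul analyticAt_const
  have h0 : (0:ℝ) ∈ S := by simp [S, hε]
  have h1 : (1:ℝ) ∈ S := by simpa [S] using hp
  have := han.eqOn_zero_of_preconnected_of_eventuallyEq_zero hS.isPreconnected h0 (h p) h1
  simpa using this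

lemma factor_snd {f : ℝ × ℝ → ℝ} (hf : AnalyticAt ℝ f 0)
    (hnz : ¬ ∀ᶠ p in 𝓝 (0 : ℝ × ℝ), f p = 0) :
    ∃ (k : ℕ) (h : ℝ × ℝ → ℝ), AnalyticAt ℝ h 0 ∧ (∀ᶠ p in 𝓝 (0 : ℝ × ℝ), f p = p.2 ^ k * h p) ∧
      ¬ ∀ᶠ x in 𝓝 (0:ℝ), h (x, 0) = 0 := by
  by_contra hcon
  push Not at hcon
  have hall : ∀ k : ℕ, ∃ h : ℝ × ℝ → ℝ, AnalyticAt ℝ h 0 ∧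
      (∀ᶠ p in 𝓝 (0 : ℝ × ℝ), f p = p.2 ^ k * h p) := by
    intro k
    induction k with
    | zero => exact ⟨f, hf, by simp⟩
    | succ k ih =>
      obtain ⟨h, hh, H⟩ := ih
      have hz := hcon k h hh H
      obtain ⟨h', hh', H'⟩ := analytic_div_snd hh
      refine ⟨h', hh', ?_⟩
      filter_upwards [H, H', (continuous_fst.tendsto (0:ℝ×ℝ)).eventually hz] with p h1 h2 h3
      rw [h1, h2, h3]; ring
  refine hnz (analytic_zero_of_rays hf fun p => ?_)
  have hc : ContinuousAt (fun s : ℝ => s • p) 0 := by fun_prop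
  have hc0 : Tendsto (fun s : ℝ => s • p) (𝓝 0) (𝓝 (0:ℝ×ℝ)) := by
    have := hc.tendsto; simpa using this
  have hcomp : ∀ {F : ℝ × ℝ → ℝ}, AnalyticAt ℝ F 0 → AnalyticAt ℝ (fun s : ℝ => F (s • p)) 0 := by
    intro F hF
    refine AnalyticAt.comp (f := fun s : ℝ => s • p) (g := F) ?_ (analyticAt_id.smul analyticAt_const)
    simpa using hF
  rw [← analyticOrderAt_eq_top]
  refine ENat.eq_top_iff_forall_ge.2 fun k => ?_
  rw [natCast_le_analyticOrderAt (hcomp hf)]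
  obtain ⟨h, hh, H⟩ := hall k
  refine ⟨fun s => p.2 ^ k * h (s • p), analyticAt_const.mul (hcomp hh), ?_⟩
  filter_upwards [hc0.eventually H] with s hs
  rw [hs]; simp; ring

/-- germ of a one variable analytic function -/
lemma germ_cases {a : ℝ → ℝ} (ha : AnalyticAt ℝ a 0) :
    (∀ᶠ t in 𝓝 (0:ℝ), a t = 0) ∨ ∃ (n : ℕ) (b : ℝ → ℝ), AnalyticAt ℝ b 0 ∧ b 0 ≠ 0 ∧
      ∀ᶠ t in 𝓝 (0:ℝ), a t = t ^ n * b t := by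
  by_cases h : analyticOrderAt a 0 = ⊤
  · left; exact analyticOrderAt_eq_top.1 h
  · right
    obtain ⟨n, hn⟩ := ENat.ne_top_iff_exists.1 h
    obtain ⟨b, hb, hb0, H⟩ := (ha.analyticOrderAt_eq_natCast).1 hn.symm
    exact ⟨n, b, hb, hb0, by simpa using H⟩

/-- Log-Lipschitz along curves staying near a point where an analytic function is nonzero. -/
lemma LL_of_curve {E : Type*} [NormedAddCommGroup E] [NormedSpace ℝ E] {V : E → ℝ} {e₀ : E}
    (hV : AnalyticAt ℝ V e₀) (h0 : V e₀ ≠ 0) :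
    ∃ ρ > 0, ∃ K > 0, ∀ (τ B : ℝ) (c c' : ℝ → E),
      (∀ t ∈ Ioo 0 τ, HasDerivAt c (c' t) t ∧ ‖c t - e₀‖ < ρ ∧ ‖t • c' t‖ ≤ B) →
      LL τ (K * B) (fun t => V (c t)) := by
  have hc : ContinuousAt (fun e => ‖fderiv ℝ V e‖) e₀ := by
    have := (hV.contDiffAt (n := 1)).continuousAt_fderiv (by simp)
    exact this.norm
  set D := ‖fderiv ℝ V e₀‖ + 1
  have hDpos : 0 < D := by positivity
  have h1 : ∀ᶠ e in 𝓝 e₀, ‖fderiv ℝ V e‖ < D := hc.eventually_lt_const (by simp [D])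
  have h2 : ∀ᶠ e in 𝓝 e₀, |V e₀| / 2 < |V e| :=
    hV.continuousAt.abs.eventually_const_lt (by have := abs_pos.2 h0; linarith)
  have h3 : ∀ᶠ e in 𝓝 e₀, DifferentiableAt ℝ V e := by
    have := (hV.contDiffAt (n := 1)).eventually (by simp)
    filter_upwards [this] with e he using he.differentiableAt (by simp)
  obtain ⟨ρ, hρ, hb⟩ := Metric.eventually_nhds_iff_ball.1 (h1.and (h2.and h3))
  have hVp := abs_pos.2 h0
  refine ⟨ρ, hρ, D / (|V e₀| / 2), by positivity, fun τ B c c' H => ?_⟩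
  refine LL.of_hasDerivAt (F' := fun t => fderiv ℝ V (c t) (c' t)) fun t ht => ?_
  obtain ⟨hd, hn, hB⟩ := H t ht
  obtain ⟨g1, g2, g3⟩ := hb (c t) (by rwa [mem_ball, dist_eq_norm])
  refine ⟨by intro h; rw [h, abs_zero] at g2; linarith, g3.hasFDerivAt.comp_hasDerivAt t hd, ?_⟩
  have e1 : t * fderiv ℝ V (c t) (c' t) = fderiv ℝ V (c t) (t • c' t) := by simp
  rw [e1]
  have e2 := (fderiv ℝ V (c t)).le_opNorm (t • c' t)
  have hB0 : 0 ≤ B := (norm_nonneg _).trans hB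
  calc |fderiv ℝ V (c t) (t • c' t)| ≤ D * B :=
        e2.trans (mul_le_mul g1.le hB (norm_nonneg _) hDpos.le)
    _ = D / (|V e₀| / 2) * B * (|V e₀| / 2) := by field_simp
    _ ≤ _ := mul_le_mul_of_nonneg_left g2.le (by positivity)

lemma cells_nozero {ι : Type} [Fintype ι] {f : ι → ℝ × ℝ → ℝ} {a b : ℝ} (hab : a < b)
    (hf : ∀ i, ∀ z ∈ Icc a b, AnalyticAt ℝ (f i) (z, 0)) (hnz : ∀ i, ∀ z ∈ Icc a b, f i (z, 0) ≠ 0) :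
    ∃ τ > 0, HasCells f (fun _ => a) (fun _ => b) τ := by
  have key : ∀ᶠ t in 𝓝 (0:ℝ), ∀ z ∈ Icc a b, ∀ i, f i (z, t) ≠ 0 ∧ DifferentiableAt ℝ (f i) (z, t) ∧
      |t * fderiv ℝ (f i) (z, t) (0, 1)| ≤ |f i (z, t)| := by
    refine isCompact_Icc.eventually_forall_of_forall_eventually
      (P := fun t z => ∀ i, f i (z, t) ≠ 0 ∧ DifferentiableAt ℝ (f i) (z, t) ∧
      |t * fderiv ℝ (f i) (z, t) (0, 1)| ≤ |f i (z, t)|) fun z hz => ?_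
    have hsw : Tendsto (fun p : ℝ × ℝ => ((p.2, p.1) : ℝ × ℝ)) (𝓝 (0, z)) (𝓝 (z, 0)) := by
      have : Continuous (fun p : ℝ × ℝ => ((p.2, p.1) : ℝ × ℝ)) := by fun_prop
      exact this.tendsto ((0, z) : ℝ × ℝ)
    have h1 : ∀ i, ∀ᶠ p in 𝓝 ((z, 0) : ℝ × ℝ), f i p ≠ 0 ∧ DifferentiableAt ℝ (f i) p ∧
        |p.2 * fderiv ℝ (f i) p (0, 1)| ≤ |f i p| := by
      intro i
      have han := hf i z hz
      have h1 := han.continuousAt.eventually_ne (hnz i z hz)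
      have hfd : AnalyticAt ℝ (fun p => fderiv ℝ (f i) p (0, 1)) (z, 0) :=
        ((ContinuousLinearMap.apply ℝ ℝ ((0, 1) : ℝ × ℝ)).analyticAt _).comp han.fderiv
      have h2 : ContinuousAt (fun p : ℝ × ℝ => |p.2 * fderiv ℝ (f i) p (0, 1)| - |f i p|) (z, 0) :=
        ((continuous_snd.continuousAt.mul hfd.continuousAt).abs).sub han.continuousAt.abs
      have h3 := h2.eventually_lt_const (u := 0) (by simpa using hnz i z hz)
      filter_upwards [h1, h3, han.eventually_analyticAt] with p q1 q2 q3
      exact ⟨q1, q3.differentiableAt, by linarith⟩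
    exact hsw.eventually (eventually_all.2 h1)
  obtain ⟨τ, hτ, hb⟩ := Metric.eventually_nhds_iff_ball.1 key
  have hb' : ∀ t ∈ Ioo 0 τ, ∀ z ∈ Icc a b, ∀ i, f i (z, t) ≠ 0 ∧ DifferentiableAt ℝ (f i) (z, t) ∧
      |t * fderiv ℝ (f i) (z, t) (0, 1)| ≤ |f i (z, t)| := by
    intro t ht
    exact hb t (by rw [mem_ball_zero_iff, Real.norm_eq_abs, abs_of_pos ht.1]; exact ht.2)
  refine ⟨τ, hτ, HasCells.linear (C := 1) continuousOn_const continuousOn_const (fun _ _ => hab) ?_ ?_⟩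
  · exact (LL.const τ (sub_pos.2 hab).ne').mono le_rfl zero_le_one
  · intro u hu i
    refine LL.of_hasDerivAt
      (F' := fun t => fderiv ℝ (f i) (a + (b - a) * u, t) (0, 1)) fun t ht => ?_
    obtain ⟨g1, g2, g3⟩ := hb' t ht (a + (b - a) * u)
      ⟨by nlinarith [hu.1], by nlinarith [hu.2]⟩ i
    refine ⟨g1, ?_, by simpa using g3⟩
    have h2 : HasDerivAt (fun t : ℝ => ((a + (b - a) * u, t) : ℝ × ℝ)) (0, 1) t :=
      (hasDerivAt_const t _).prodMk (hasDerivAt_id t)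
    exact g2.hasFDerivAt.comp_hasDerivAt t h2

lemma cells_interval {ι : Type} [Fintype ι] {f : ι → ℝ × ℝ → ℝ} (Z : Finset ℝ)
    (hf : ∀ i z, AnalyticAt ℝ (f i) (z, 0)) (hnz : ∀ z ∉ Z, ∀ i, f i (z, 0) ≠ 0)
    (hloc : ∀ z ∈ Z, ∀ᶠ r in 𝓝[>] (0:ℝ), ∃ τ > 0, HasCells f (fun _ => z - r) (fun _ => z + r) τ) :
    ∀ (n : ℕ) (a b : ℝ), a < b → a ∉ Z → b ∉ Z → (Z.filter (fun z => z ∈ Ioo a b)).card ≤ n →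
      ∃ τ > 0, HasCells f (fun _ => a) (fun _ => b) τ := by
  classical
  intro n
  induction n with
  | zero =>
    intro a b hab ha hb hc
    refine cells_nozero hab (fun i z _ => hf i z) (fun i z hz => hnz z ?_ i)
    intro hzZ
    have h1 : a ≠ z := fun h => ha (h ▸ hzZ)
    have h2 : z ≠ b := fun h => hb (h ▸ hzZ)
    have : z ∈ Z.filter (fun z => z ∈ Ioo a b) :=
      Finset.mem_filter.2 ⟨hzZ, lt_of_le_of_ne hz.1 h1, lt_of_le_of_ne hz.2 h2⟩
    simp only [nonpos_iff_eq_zero, Finset.card_eq_zero] at hc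
    rw [hc] at this; simp at this
  | succ n ih =>
    intro a b hab ha hb hc
    by_cases hne : (Z.filter (fun z => z ∈ Ioo a b)).Nonempty
    · obtain ⟨z, hz⟩ := hne
      obtain ⟨hzZ, hza, hzb⟩ := Finset.mem_filter.1 hz
      have hsep : ∀ᶠ x in 𝓝[≠] z, x ∉ Z := by
        have : ((Z.erase z : Finset ℝ) : Set ℝ)ᶜ ∈ 𝓝 z :=
          (Finset.finite_toSet _).isClosed.isOpen_compl.mem_nhds (by simp)
        rw [eventually_nhdsWithin_iff]
        filter_upwards [this] with x hx hxz hxZ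
        exact hx (by simp [hxZ]; exact hxz)
      have hp : ∀ᶠ r in 𝓝[>] (0:ℝ), z + r ∉ Z := by
        have : Tendsto (fun r : ℝ => z + r) (𝓝[>] 0) (𝓝[≠] z) := by
          refine tendsto_nhdsWithin_iff.2 ⟨?_, ?_⟩
          · have : Tendsto (fun r : ℝ => z + r) (𝓝 0) (𝓝 (z + 0)) := by
              exact (continuous_const.add continuous_id).tendsto 0
            rw [add_zero] at this
            exact this.mono_left nhdsWithin_le_nhds
          · filter_upwards [self_mem_nhdsWithin] with r hr
            simp; exact (ne_of_gt hr)
        exact this.eventually hsep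
      have hm : ∀ᶠ r in 𝓝[>] (0:ℝ), z - r ∉ Z := by
        have : Tendsto (fun r : ℝ => z - r) (𝓝[>] 0) (𝓝[≠] z) := by
          refine tendsto_nhdsWithin_iff.2 ⟨?_, ?_⟩
          · have : Tendsto (fun r : ℝ => z - r) (𝓝 0) (𝓝 (z - 0)) := by
              exact (continuous_const.sub continuous_id).tendsto 0
            rw [sub_zero] at this
            exact this.mono_left nhdsWithin_le_nhds
          · filter_upwards [self_mem_nhdsWithin] with r hr
            simp; exact (ne_of_gt hr)
        exact this.eventually hsep
      have hsm : ∀ᶠ r in 𝓝[>] (0:ℝ), r < min (z - a) (b - z) :=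
        nhdsWithin_le_nhds (eventually_lt_nhds (by simp [hza, hzb]))
      obtain ⟨r, ⟨τ, hτ, hcells⟩, hrp, hrm, hrs, hr0⟩ :=
        ((hloc z hzZ).and (hp.and (hm.and (hsm.and self_mem_nhdsWithin)))).exists
      have hr0' : 0 < r := hr0
      have r1 : r < z - a := lt_of_lt_of_le hrs (min_le_left _ _)
      have r2 : r < b - z := lt_of_lt_of_le hrs (min_le_right _ _)
      have hcard : ∀ a' b', a ≤ a' → b' ≤ b → z ∉ Ioo a' b' →
          (Z.filter (fun z => z ∈ Ioo a' b')).card ≤ n := by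
        intro a' b' h1 h2 h3
        have : (Z.filter (fun z => z ∈ Ioo a' b')) ⊆ (Z.filter (fun z => z ∈ Ioo a b)).erase z := by
          intro x hx
          obtain ⟨hxZ, hx1, hx2⟩ := Finset.mem_filter.1 hx
          refine Finset.mem_erase.2 ⟨?_, Finset.mem_filter.2 ⟨hxZ, by linarith, by linarith⟩⟩
          rintro rfl; exact h3 ⟨hx1, hx2⟩
        have h4 := Finset.card_le_card this
        rw [Finset.card_erase_of_mem hz] at h4
        omega
      obtain ⟨τ1, hτ1, c1⟩ := ih a (z - r) (by linarith) ha hrm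
        (hcard a (z - r) le_rfl (by linarith) (fun h => by linarith [h.2]))
      obtain ⟨τ2, hτ2, c2⟩ := ih (z + r) b (by linarith) hrp hb
        (hcard (z + r) b (by linarith) le_rfl (fun h => by linarith [h.1]))
      refine ⟨min τ (min τ1 τ2), by positivity, ?_⟩
      have d1 := c1.mono (τ' := min τ (min τ1 τ2)) (by simp)
      have d2 := c2.mono (τ' := min τ (min τ1 τ2)) (by simp)
      have d3 := hcells.mono (τ' := min τ (min τ1 τ2)) (by simp)
      refine (d1.concat d3 (fun _ _ => by linarith) (fun _ _ => by linarith)).concat d2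
        (fun _ _ => by linarith) (fun _ _ => by linarith)
    · rw [Finset.not_nonempty_iff_eq_empty] at hne
      exact ih a b hab ha hb (by rw [hne]; simp)

lemma cells_outer {ι : Type} [Fintype ι] {G : ι → ℝ × ℝ → ℝ} {m : ι → ℕ} {p : ℕ} (hp : 1 ≤ p)
    {V : ι → ℝ × ℝ × ℝ → ℝ} (hV : ∀ i, AnalyticAt ℝ (V i) 0) (hV0 : ∀ i, V i 0 ≠ 0)
    {Q : ℝ → ℝ} (hQ : AnalyticAt ℝ Q 0) (hQ0 : Q 0 = 0) {ε ρ₀ : ℝ} (hε : 0 ≤ ε) (hρ₀ : 0 < ρ₀)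
    (hG : ∀ i, ∀ x ∈ Ioo 0 ρ₀, ∀ t ∈ Ioo 0 ρ₀, ε * t ^ p / x < ρ₀ →
      G i (x, t) = x ^ m i * V i (x, t, ε * t ^ p / x)) :
    ∃ ρ > 0, ∀ R ≥ 0, ε ≤ R * ρ → ∀ r, 0 < r → r < ρ → ∃ τ > 0,
      HasCells G (fun t => R * t ^ p) (fun t => r - Q t) τ := by
  choose ρ hρ K hK HL using fun i => LL_of_curve (hV i) (hV0 i)
  obtain ⟨ρ1, hρ1, hρ1'⟩ : ∃ ρ1 > 0, ∀ i, ρ1 ≤ ρ i := by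
    have : ∀ᶠ x in 𝓝[>] (0:ℝ), ∀ i, x ≤ ρ i :=
      eventually_all.2 fun i => nhdsWithin_le_nhds ((eventually_lt_nhds (hρ i)).mono fun _ h => h.le)
    obtain ⟨x, hx, hx0⟩ := (this.and self_mem_nhdsWithin).exists
    exact ⟨x, hx0, hx⟩
  set ρ2 := min ρ1 ρ₀ with hρ2
  have hρ2p : 0 < ρ2 := lt_min hρ1 hρ₀
  refine ⟨ρ2 / 2, by positivity, fun R hR hεR r hr hrρ => ?_⟩
  have hp' : (1:ℝ) ≤ p := by exact_mod_cast hp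
  have hev : ∀ᶠ t in 𝓝 (0:ℝ), DifferentiableAt ℝ Q t ∧ |Q t| < r / 4 ∧ |t * deriv Q t| < r / 4 ∧
      R * t ^ p < r / 4 ∧ t < ρ2 := by
    have e1 := hQ.eventually_analyticAt
    have e2 : ∀ᶠ t in 𝓝 (0:ℝ), |Q t| < r / 4 :=
      hQ.continuousAt.abs.eventually_lt_const (by simp [hQ0, hr])
    have e3 : ∀ᶠ t in 𝓝 (0:ℝ), |t * deriv Q t| < r / 4 := by
      have : ContinuousAt (fun t => |t * deriv Q t|) 0 :=
        (continuousAt_id.mul hQ.deriv.continuousAt).abs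
      exact this.eventually_lt_const (by simp [hr])
    have e4 : ∀ᶠ t in 𝓝 (0:ℝ), R * t ^ p < r / 4 := by
      have : ContinuousAt (fun t : ℝ => R * t ^ p) 0 := by fun_prop
      exact this.eventually_lt_const (by simp [show p ≠ 0 by omega, hr])
    filter_upwards [e1, e2, e3, e4, eventually_lt_nhds hρ2p] with t h1 h2 h3 h4 h5
    exact ⟨h1.differentiableAt, h2, h3, h4, h5⟩
  obtain ⟨τ, hτ, hb⟩ := Metric.eventually_nhds_iff_ball.1 hev
  have hb' : ∀ t ∈ Ioo 0 τ, DifferentiableAt ℝ Q t ∧ |Q t| < r / 4 ∧ |t * deriv Q t| < r / 4 ∧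
      R * t ^ p < r / 4 ∧ t < ρ2 := by
    intro t ht
    exact hb t (by rw [mem_ball_zero_iff, Real.norm_eq_abs, abs_of_pos ht.1]; exact ht.2)
  have hpw : ∀ t : ℝ, HasDerivAt (fun t : ℝ => R * t ^ p) (R * (p * t ^ (p-1))) t := fun t =>
    (hasDerivAt_pow p t).const_mul R
  have htp : ∀ t : ℝ, t * (p * t ^ (p-1)) = p * t ^ p := by
    intro t
    obtain ⟨k, rfl⟩ : ∃ k, p = k + 1 := ⟨p - 1, by omega⟩
    simp only [Nat.add_sub_cancel]; ring
  have hJ : ∀ t ∈ Ioo 0 τ, HasDerivAt (fun t => r - Q t - R * t ^ p)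
      (-deriv Q t - R * (p * t ^ (p-1))) t := by
    intro t ht
    have := (((hb' t ht).1.hasDerivAt).const_sub r).sub (hpw t)
    exact this
  set C0 : ℝ := (p : ℝ) + 1
  set B : ℝ := (2 * p + 1) * ρ2
  refine ⟨τ, hτ, HasCells.linear (C := C0 + ∑ i, ((m i : ℝ) * C0 + K i * B)) ?_ ?_ ?_ ?_ ?_⟩
  · fun_prop
  · intro t ht
    exact ((continuousAt_const).sub (hb' t ht).1.continuousAt).continuousWithinAt
  · intro t ht
    obtain ⟨g1, g2, g3, g4, g5⟩ := hb' t ht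
    have := (abs_lt.1 g2).2
    linarith
  · have : LL τ C0 (fun t => r - Q t - R * t ^ p) := by
      refine LL.of_hasDerivAt (F' := fun t => -deriv Q t - R * (p * t ^ (p-1))) fun t ht => ?_
      obtain ⟨g1, g2, g3, g4, g5⟩ := hb' t ht
      obtain ⟨a1, a2⟩ := abs_lt.1 g2
      have hpos : r / 2 < r - Q t - R * t ^ p := by linarith
      refine ⟨by linarith, hJ t ht, ?_⟩
      rw [abs_of_pos (by linarith : 0 < r - Q t - R * t ^ p)]
      have e : t * (-deriv Q t - R * (p * t ^ (p-1))) = -(t * deriv Q t) - R * (p * t ^ p) := by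
        rw [← htp t]; ring
      rw [e]
      obtain ⟨b1, b2⟩ := abs_lt.1 g3
      have hRt : 0 ≤ R * t ^ p := mul_nonneg hR (pow_nonneg ht.1.le _)
      rw [abs_le]; constructor <;> nlinarith
    refine this.mono le_rfl ?_
    have : 0 ≤ ∑ i, ((m i : ℝ) * C0 + K i * B) :=
      Finset.sum_nonneg fun i _ => by have := (hK i).le; positivity
    linarith
  · intro s hs i
    let ψ : ℝ → ℝ := fun t => R * t ^ p + (r - Q t - R * t ^ p) * s
    let ψ' : ℝ → ℝ := fun t => R * (p * t ^ (p-1)) + (-deriv Q t - R * (p * t ^ (p-1))) * s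
    have hψd : ∀ t ∈ Ioo 0 τ, HasDerivAt ψ (ψ' t) t := fun t ht =>
      (hpw t).add ((hJ t ht).mul_const s)
    have hψ : ∀ t ∈ Ioo 0 τ, R * t ^ p < ψ t ∧ 0 < ψ t ∧ ψ t < ρ2 ∧ |t * ψ' t| ≤ C0 * ψ t := by
      intro t ht
      obtain ⟨g1, g2, g3, g4, g5⟩ := hb' t ht
      obtain ⟨a1, a2⟩ := abs_lt.1 g2
      obtain ⟨b1, b2⟩ := abs_lt.1 g3
      have hRt : 0 ≤ R * t ^ p := mul_nonneg hR (pow_nonneg ht.1.le _)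
      have hs0 := hs.1
      have hs1 := hs.2
      have k1 : R * t ^ p < ψ t := by
        have : 0 < (r - Q t - R * t ^ p) * s := mul_pos (by linarith) hs0
        simp only [ψ]; linarith
      refine ⟨k1, by linarith, ?_, ?_⟩
      · have : (r - Q t - R * t ^ p) * s ≤ (r - Q t - R * t ^ p) * 1 :=
          mul_le_mul_of_nonneg_left hs1.le (by linarith)
        simp only [ψ]; linarith
      · have e : t * ψ' t = (1 - s) * (p * (R * t ^ p)) - s * (t * deriv Q t) := by
          simp only [ψ']
          have : t * (R * (p * t ^ (p-1))) = R * (p * t ^ p) := by rw [← htp t]; ring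
          linear_combination (1 - s) * this
        have e2 : ψ t = (1 - s) * (R * t ^ p) + s * (r - Q t) := by simp only [ψ]; ring
        rw [e]
        have k2 : 0 ≤ (1 - s) * (R * t ^ p) := mul_nonneg (by linarith) hRt
        have k3 : |s * (t * deriv Q t)| ≤ s * (r / 4) := by
          rw [abs_mul, abs_of_pos hs0]; exact mul_le_mul_of_nonneg_left g3.le hs0.le
        have k4 : s * (r / 4) ≤ s * (r - Q t) := mul_le_mul_of_nonneg_left (by linarith) hs0.le
        have k5 : 0 ≤ s * (r / 4) := by positivity
        obtain ⟨c1, c2⟩ := abs_le.1 k3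
        have k6 : s * (r - Q t) ≤ C0 * (s * (r - Q t)) :=
          le_mul_of_one_le_left (by linarith) (by simp only [C0]; linarith)
        have k7 : (1 - s) * (p * (R * t ^ p)) ≤ C0 * ((1 - s) * (R * t ^ p)) := by
          simp only [C0]; nlinarith
        have k8 : 0 ≤ (1 - s) * (p * (R * t ^ p)) := by
          have : (0:ℝ) ≤ p * ((1 - s) * (R * t ^ p)) := by positivity
          linarith
        rw [e2, mul_add, abs_le]
        constructor <;> linarith
    have hψLL : LL τ C0 ψ := LL.of_hasDerivAt (F' := ψ') fun t ht => by
      obtain ⟨g1, g2, g3, g4⟩ := hψ t ht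
      exact ⟨g2.ne', hψd t ht, by rwa [abs_of_pos g2]⟩
    let w : ℝ → ℝ := fun t => ε * t ^ p / ψ t
    let w' : ℝ → ℝ := fun t => (ε * (p * t ^ (p-1)) * ψ t - ε * t ^ p * ψ' t) / (ψ t) ^ 2
    have hwd : ∀ t ∈ Ioo 0 τ, HasDerivAt w (w' t) t := fun t ht =>
      ((hasDerivAt_pow p t).const_mul ε).div (hψd t ht) (hψ t ht).2.1.ne'
    have hw : ∀ t ∈ Ioo 0 τ, 0 ≤ w t ∧ w t < ρ2 ∧ |t * w' t| ≤ (2 * p + 1) * w t := by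
      intro t ht
      obtain ⟨g1, g2, g3, g4⟩ := hψ t ht
      have htp0 : 0 ≤ t ^ p := pow_nonneg ht.1.le _
      have w0 : 0 ≤ w t := div_nonneg (mul_nonneg hε htp0) g2.le
      refine ⟨w0, ?_, ?_⟩
      · simp only [w]
        rw [div_lt_iff₀ g2]
        have : ε * t ^ p ≤ R * (ρ2 / 2) * t ^ p := mul_le_mul_of_nonneg_right hεR htp0
        nlinarith
      · have e : t * w' t = w t * (p - t * ψ' t / ψ t) := by
          simp only [w, w']
          have : t * (ε * (p * t ^ (p-1)) * ψ t) = ε * (p * t ^ p) * ψ t := by rw [← htp t]; ring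
          field_simp
          linear_combination ε * ψ t * (htp t)
        rw [e, abs_mul, abs_of_nonneg w0, mul_comm]
        refine mul_le_mul_of_nonneg_right ?_ w0
        have h1 : |t * ψ' t / ψ t| ≤ C0 := by
          rw [abs_div, abs_of_pos g2, div_le_iff₀ g2]; exact g4
        calc |(p:ℝ) - t * ψ' t / ψ t| ≤ |(p:ℝ)| + |t * ψ' t / ψ t| := abs_sub _ _
          _ ≤ p + C0 := by rw [abs_of_nonneg (by positivity)]; linarith
          _ = _ := by simp only [C0]; ring
    have hVLL : LL τ (K i * B) (fun t => V i (ψ t, t, w t)) := by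
      refine HL i τ B (fun t => (ψ t, t, w t)) (fun t => (ψ' t, 1, w' t)) fun t ht => ?_
      obtain ⟨g1, g2, g3, g4⟩ := hψ t ht
      obtain ⟨k1, k2, k3⟩ := hw t ht
      have k5 := (hb' t ht).2.2.2.2
      refine ⟨(hψd t ht).prodMk ((hasDerivAt_id t).prodMk (hwd t ht)), ?_, ?_⟩
      · rw [sub_zero]
        have hmin : ρ2 ≤ ρ i := (min_le_left _ _).trans (hρ1' i)
        simp only [Prod.norm_def, Real.norm_eq_abs, abs_of_pos g2, abs_of_nonneg k1, abs_of_pos ht.1]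
        exact max_lt (by linarith) (max_lt (by linarith) (by linarith))
      · simp only [Prod.smul_mk, Prod.norm_def, Real.norm_eq_abs, smul_eq_mul, mul_one, abs_of_pos ht.1]
        refine max_le ?_ (max_le ?_ ?_)
        · refine g4.trans ?_
          have : C0 ≤ 2 * p + 1 := by simp only [C0]; linarith
          exact mul_le_mul this g3.le g2.le (by positivity)
        · simp only [B]; nlinarith
        · exact k3.trans (mul_le_mul_of_nonneg_left k2.le (by positivity))
    have := (hψLL.pow (m i)).mul hVLL
    refine LL.congr (this.mono le_rfl ?_) ?_
    · have h1 : (m i : ℝ) * C0 + K i * B ≤ ∑ i, ((m i : ℝ) * C0 + K i * B) :=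
        Finset.single_le_sum (f := fun i => (m i : ℝ) * C0 + K i * B)
          (fun i _ => by have := (hK i).le; positivity) (Finset.mem_univ i)
      have : 0 ≤ C0 := by positivity
      linarith
    · intro t ht
      obtain ⟨g1, g2, g3, g4⟩ := hψ t ht
      obtain ⟨k1, k2, k3⟩ := hw t ht
      have k5 := (hb' t ht).2.2.2.2
      have hmin : ρ2 ≤ ρ₀ := min_le_right _ _
      exact hG i (ψ t) ⟨g2, by linarith⟩ t ⟨ht.1, by linarith⟩ (by
        have : w t < ρ₀ := by linarith
        exact this)

lemma poly_mult {m : ℕ} {P : Polynomial ℝ} (hdeg : P.natDegree ≤ m) (hm : P.coeff m ≠ 0) {z : ℝ}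
    (h : m ≤ P.rootMultiplicity z) (k : ℕ) :
    P.coeff k = P.coeff m * ((-z) ^ (m - k) * (m.choose k : ℝ)) := by
  have hP : P ≠ 0 := by rintro rfl; simp at hm
  have hd : (Polynomial.X - Polynomial.C z) ^ m ∣ P := (Polynomial.le_rootMultiplicity_iff hP).1 h
  obtain ⟨Q, hQ⟩ := hd
  have hQ0 : Q ≠ 0 := by rintro rfl; simp at hQ; exact hP hQ
  have hmon : ((Polynomial.X - Polynomial.C z) ^ m).Monic := (Polynomial.monic_X_sub_C z).pow m
  have hnd : P.natDegree = m + Q.natDegree := by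
    rw [hQ, hmon.natDegree_mul' hQ0, Polynomial.natDegree_pow, Polynomial.natDegree_X_sub_C, mul_one]
  have hQd : Q.natDegree = 0 := by omega
  obtain ⟨c, rfl⟩ : ∃ c, Q = Polynomial.C c := ⟨_, Polynomial.eq_C_of_natDegree_eq_zero hQd⟩
  have hco : ∀ j, P.coeff j = c * ((-z) ^ (m - j) * (m.choose j : ℝ)) := by
    intro j
    rw [hQ, Polynomial.coeff_mul_C, sub_eq_add_neg, ← Polynomial.C_neg, Polynomial.coeff_X_add_C_pow]; ring
  rw [hco k, hco m]; simp

lemma poly_order {P : Polynomial ℝ} (hP : P ≠ 0) (z : ℝ) :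
    analyticOrderAt (fun x => P.eval (z + x)) 0 = (P.rootMultiplicity z : ℕ∞) := by
  have han : ∀ R : Polynomial ℝ, AnalyticAt ℝ (fun x => R.eval (z + x)) 0 := fun R => by
    have h1 : AnalyticAt ℝ (fun x : ℝ => z + x) 0 := by fun_prop
    have := AnalyticAt.aeval_polynomial h1 R
    simpa using this
  rw [(han P).analyticOrderAt_eq_natCast]
  obtain ⟨Q, hQ, hnd⟩ := Polynomial.exists_eq_pow_rootMultiplicity_mul_and_not_dvd P hP z
  refine ⟨fun x => Q.eval (z + x), han Q, ?_, ?_⟩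
  · rw [Polynomial.dvd_iff_isRoot] at hnd
    simpa [Polynomial.IsRoot] using hnd
  · refine Eventually.of_forall fun x => ?_
    conv_lhs => rw [hQ]
    simp

lemma newton {ι : Type} [Fintype ι] {m : ι → ℕ} {a : ι → ℕ → ℝ → ℝ}
    (ha : ∀ i, ∀ k < m i, AnalyticAt ℝ (a i k) 0) (ha0 : ∀ i, ∀ k < m i, a i k 0 = 0)
    {N : ℕ} (hN0 : 0 < N) (hN : ∀ i, ∀ k < m i, (m i - k) ∣ N)
    (hne : ∃ i, ∃ k < m i, ¬ ∀ᶠ t in 𝓝 (0:ℝ), a i k t = 0) :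
    ∃ p ≥ 1, ∃ A : ι → ℕ → ℝ → ℝ, (∀ i, ∀ k < m i, AnalyticAt ℝ (A i k) 0 ∧
      (∀ᶠ t in 𝓝 (0:ℝ), a i k (t ^ N) = t ^ (p * (m i - k)) * A i k t) ∧
      ((∀ᶠ t in 𝓝 (0:ℝ), a i k t = 0) → ∀ t, A i k t = 0)) ∧ ∃ i, ∃ k < m i, A i k 0 ≠ 0 := by
  classical
  have hc : ∀ i k, ∃ (n : ℕ) (b : ℝ → ℝ), k < m i → (¬ ∀ᶠ t in 𝓝 (0:ℝ), a i k t = 0) →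
      AnalyticAt ℝ b 0 ∧ b 0 ≠ 0 ∧ ∀ᶠ t in 𝓝 (0:ℝ), a i k t = t ^ n * b t := by
    intro i k
    by_cases h : k < m i ∧ ¬ ∀ᶠ t in 𝓝 (0:ℝ), a i k t = 0
    · rcases germ_cases (ha i k h.1) with h' | ⟨n, b, hb⟩
      · exact absurd h' h.2
      · exact ⟨n, b, fun _ _ => hb⟩
    · exact ⟨0, 0, fun h1 h2 => absurd ⟨h1, h2⟩ h⟩
  choose n b hnb using hc
  let S : Finset ((_ : ι) × ℕ) := (Finset.univ.sigma fun i => Finset.range (m i)).filter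
    fun x => ¬ ∀ᶠ t in 𝓝 (0:ℝ), a x.1 x.2 t = 0
  have hS : S.Nonempty := by
    obtain ⟨i, k, hk, h⟩ := hne
    exact ⟨⟨i, k⟩, by simp only [S, Finset.mem_filter, Finset.mem_sigma, Finset.mem_univ,
      Finset.mem_range, true_and]; exact ⟨hk, h⟩⟩
  have hSm : ∀ i k, k < m i → (¬ ∀ᶠ t in 𝓝 (0:ℝ), a i k t = 0) → (⟨i, k⟩ : (_ : ι) × ℕ) ∈ S := by
    intro i k hk h
    simp only [S, Finset.mem_filter, Finset.mem_sigma, Finset.mem_univ, Finset.mem_range, true_and]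
    exact ⟨hk, h⟩
  obtain ⟨⟨i₁, k₁⟩, h1, hmin⟩ := S.exists_min_image (fun x => N * n x.1 x.2 / (m x.1 - x.2)) hS
  have h1' : k₁ < m i₁ ∧ ¬ ∀ᶠ t in 𝓝 (0:ℝ), a i₁ k₁ t = 0 := by
    simpa only [S, Finset.mem_filter, Finset.mem_sigma, Finset.mem_univ, Finset.mem_range, true_and]
      using h1
  set p := N * n i₁ k₁ / (m i₁ - k₁) with hp
  have hdvd : ∀ i k, k < m i → N * n i k / (m i - k) * (m i - k) = N * n i k := fun i k hk =>
    Nat.div_mul_cancel ((hN i k hk).mul_right _)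
  have hn1 : 1 ≤ n i₁ k₁ := by
    obtain ⟨q1, q2, q3⟩ := hnb i₁ k₁ h1'.1 h1'.2
    have := q3.self_of_nhds
    rw [ha0 i₁ k₁ h1'.1] at this
    by_contra hcon
    have hz : n i₁ k₁ = 0 := by omega
    rw [hz, pow_zero, one_mul] at this
    exact q2 this.symm
  refine ⟨p, ?_, fun i k t => if ∀ᶠ t in 𝓝 (0:ℝ), a i k t = 0 then 0 else
    t ^ (N * n i k - p * (m i - k)) * b i k (t ^ N), ?_, ?_⟩
  · have e := hdvd i₁ k₁ h1'.1
    rw [← hp] at e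
    have : 0 < N * n i₁ k₁ := by positivity
    by_contra hcon
    have hpz : p = 0 := Nat.eq_zero_of_not_pos hcon
    rw [hpz, zero_mul] at e
    exact this.ne e
  · intro i k hk
    by_cases h : ∀ᶠ t in 𝓝 (0:ℝ), a i k t = 0
    · simp only [h, if_true]
      refine ⟨analyticAt_const, ?_, fun _ _ => trivial⟩
      have : Tendsto (fun t : ℝ => t ^ N) (𝓝 0) (𝓝 0) := by
        have := (continuous_pow N (M := ℝ)).tendsto 0
        simpa [hN0.ne'] using this
      filter_upwards [this.eventually h] with t ht
      rw [ht]; simp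
    · simp only [h, if_false]
      obtain ⟨q1, q2, q3⟩ := hnb i k hk h
      refine ⟨?_, ?_, fun h' => absurd h' (by simp)⟩
      · refine (analyticAt_id.pow _).mul ?_
        refine AnalyticAt.comp (f := fun t : ℝ => t ^ N) (g := b i k) ?_ (analyticAt_id.pow _)
        simpa [hN0.ne'] using q1
      · have : Tendsto (fun t : ℝ => t ^ N) (𝓝 0) (𝓝 0) := by
          have := (continuous_pow N (M := ℝ)).tendsto 0
          simpa [hN0.ne'] using this
        filter_upwards [this.eventually q3] with t ht
        rw [ht, ← mul_assoc, ← pow_add, ← pow_mul]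
        congr 2
        have e1 := hmin _ (hSm i k hk h)
        have e2 := Nat.mul_le_mul_right (m i - k) e1
        rw [hdvd i k hk] at e2
        have e3 : p * (m i - k) ≤ N * n i k := e2
        generalize p * (m i - k) = X at e3 ⊢
        omega
  · refine ⟨i₁, k₁, h1'.1, ?_⟩
    simp only [h1'.2, if_false]
    have e := hdvd i₁ k₁ h1'.1
    rw [← hp] at e
    obtain ⟨q1, q2, q3⟩ := hnb i₁ k₁ h1'.1 h1'.2
    rw [e]; simp [hN0.ne', q2]

lemma cells_sides {ι : Type} [Fintype ι] {G : ι → ℝ × ℝ → ℝ} {m : ι → ℕ} {p : ℕ} (hp : 1 ≤ p)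
    {V : ι → ℝ × ℝ × ℝ → ℝ} (hV : ∀ i, AnalyticAt ℝ (V i) 0) (hV0 : ∀ i, V i 0 ≠ 0)
    {Q : ℝ → ℝ} (hQ : AnalyticAt ℝ Q 0) (hQ0 : Q 0 = 0) {ε ρ₀ : ℝ} (hε : 0 ≤ ε) (hρ₀ : 0 < ρ₀)
    (hG : ∀ i, ∀ x, x ≠ 0 → |x| < ρ₀ → ∀ t ∈ Ioo 0 ρ₀, 
      G i (x, t) = x ^ m i * V i (x, t, ε * t ^ p / x)) :
    ∃ ρ > 0, ∀ R ≥ 0, ε ≤ R * ρ → ∀ r, 0 < r → r < ρ → ∃ τ > 0,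
      HasCells G (fun t => R * t ^ p) (fun t => r - Q t) τ ∧
      HasCells G (fun t => -r - Q t) (fun t => -(R * t ^ p)) τ ∧
      (∀ t ∈ Ioo 0 τ, R * t ^ p < r - Q t ∧ -r - Q t < -(R * t ^ p)) := by
  obtain ⟨ρ1, hρ1, H1⟩ := cells_outer (G := G) (m := m) hp hV hV0 hQ hQ0 hε hρ₀
    (fun i x hx t ht _ => hG i x hx.1.ne' (by rw [abs_of_pos hx.1]; exact hx.2) t ht)
  have hV' : ∀ i, AnalyticAt ℝ (fun e : ℝ × ℝ × ℝ => (-1) ^ m i * V i (-e.1, e.2.1, -e.2.2)) 0 := by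
    intro i
    refine analyticAt_const.mul ?_
    refine AnalyticAt.comp (f := fun e : ℝ × ℝ × ℝ => ((-e.1, e.2.1, -e.2.2) : ℝ × ℝ × ℝ))
      (g := V i) (x := (0 : ℝ × ℝ × ℝ)) ?_ ?_
    · have : ((-(0:ℝ×ℝ×ℝ).1, (0:ℝ×ℝ×ℝ).2.1, -(0:ℝ×ℝ×ℝ).2.2) : ℝ × ℝ × ℝ) = 0 := by simp
      rw [this]; exact hV i
    · have h1 : AnalyticAt ℝ (fun e : ℝ × ℝ × ℝ => e.1) 0 := analyticAt_fst
      have h2 : AnalyticAt ℝ (fun e : ℝ × ℝ × ℝ => e.2.1) 0 :=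
        ((ContinuousLinearMap.fst ℝ ℝ ℝ).comp (ContinuousLinearMap.snd ℝ ℝ (ℝ × ℝ))).analyticAt _
      have h3 : AnalyticAt ℝ (fun e : ℝ × ℝ × ℝ => e.2.2) 0 :=
        ((ContinuousLinearMap.snd ℝ ℝ ℝ).comp (ContinuousLinearMap.snd ℝ ℝ (ℝ × ℝ))).analyticAt _
      exact h1.neg.prod (h2.prod h3.neg)
  have hV0' : ∀ i, (fun e : ℝ × ℝ × ℝ => (-1) ^ m i * V i (-e.1, e.2.1, -e.2.2)) 0 ≠ 0 := by
    intro i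
    simp only [Prod.fst_zero, Prod.snd_zero, neg_zero]
    exact mul_ne_zero (pow_ne_zero _ (by norm_num)) (hV0 i)
  obtain ⟨ρ2, hρ2, H2⟩ := cells_outer (G := fun i p => G i (-p.1, p.2)) (m := m) hp hV' hV0' hQ.neg
    (by simp [hQ0]) hε hρ₀ (fun i x hx t ht _ => by
      simp only
      rw [hG i (-x) (by linarith [hx.1]) (by rw [abs_neg, abs_of_pos hx.1]; exact hx.2) t ht,
        div_neg, ← mul_assoc, neg_pow x, mul_comm (x ^ m i)])
  refine ⟨min ρ1 ρ2, lt_min hρ1 hρ2, fun R hR hRε r hr hrρ => ?_⟩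
  obtain ⟨τ1, hτ1, c1⟩ := H1 R hR (hRε.trans (mul_le_mul_of_nonneg_left (min_le_left _ _) hR)) r hr
    (hrρ.trans_le (min_le_left _ _))
  obtain ⟨τ2, hτ2, c2⟩ := H2 R hR (hRε.trans (mul_le_mul_of_nonneg_left (min_le_right _ _) hR)) r hr
    (hrρ.trans_le (min_le_right _ _))
  have c3 : HasCells G (fun t => -r - Q t) (fun t => -(R * t ^ p)) τ2 := by
    refine HasCells.affine (q := fun _ => 0) (s := fun _ => -1) (e := fun _ _ => 1) c2
      continuousOn_const (LL.const τ2 (by norm_num)) (fun i => LL.const τ2 one_ne_zero) ?_ ?_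
    · intro t ht
      rw [image_affine_neg _ _ _ _ (by norm_num)]
      congr 1 <;> simp <;> ring
    · intro i t ht z hz
      simp
  have hev : ∀ᶠ t in 𝓝 (0:ℝ), R * t ^ p < r - Q t ∧ -r - Q t < -(R * t ^ p) := by
    have h1 : ContinuousAt (fun t => R * t ^ p + Q t) 0 := by
      have := hQ.continuousAt; fun_prop
    have h2 : ContinuousAt (fun t => R * t ^ p - Q t) 0 := by
      have := hQ.continuousAt; fun_prop
    have hp0 : p ≠ 0 := by omega
    filter_upwards [h1.eventually_lt_const (u := r) (by simp [hQ0, hp0, hr]),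
      h2.eventually_lt_const (u := r) (by simp [hQ0, hp0, hr])] with t a1 a2
    constructor <;> linarith
  obtain ⟨τ3, hτ3, hb⟩ := Metric.eventually_nhds_iff_ball.1 hev
  refine ⟨min τ1 (min τ2 τ3), by positivity, c1.mono (by simp), c3.mono (by simp), fun t ht => ?_⟩
  refine hb t ?_
  rw [mem_ball_zero_iff, Real.norm_eq_abs, abs_of_pos ht.1]
  exact ht.2.trans_le (by simp)

lemma cells_assemble {ι : Type} [Fintype ι] {f : ι → ℝ × ℝ → ℝ} {N : ℕ} (hN : 0 < N) {Q : ℝ → ℝ}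
    (hQ : AnalyticAt ℝ Q 0) {r : ℝ}
    (h : ∃ τ > 0, HasCells (fun i p => f i (p.1 + Q p.2, p.2 ^ N)) (fun t => -r - Q t)
      (fun t => r - Q t) τ) :
    ∃ τ > 0, HasCells f (fun _ => -r) (fun _ => r) τ := by
  obtain ⟨τ, hτ, c⟩ := h
  obtain ⟨τ1, hτ1, hb⟩ := Metric.eventually_nhds_iff_ball.1 hQ.eventually_analyticAt
  have c' := c.mono (τ' := min τ τ1) (min_le_left _ _)
  refine ⟨(min τ τ1) ^ N, by positivity, HasCells.root hN (by positivity) ?_⟩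
  refine HasCells.affine (q := Q) (s := fun _ => 1) (e := fun _ _ => 1) c' ?_
    (LL.const _ one_ne_zero) (fun i => LL.const _ one_ne_zero) ?_ ?_
  · intro t ht
    refine (hb t ?_).continuousAt.continuousWithinAt
    rw [mem_ball_zero_iff, Real.norm_eq_abs, abs_of_pos ht.1]
    exact ht.2.trans_le (min_le_right _ _)
  · intro t ht
    rw [image_affine_pos _ _ _ _ one_pos]
    congr 1 <;> ring
  · intro i t ht z hz
    simp [add_comm]

lemma prep_shift {ι : Type} {f : ι → ℝ × ℝ → ℝ} {m : ι → ℕ} (hf : ∀ i, AnalyticAt ℝ (f i) 0)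
    (hm : ∀ i, (∀ k < m i, DD k (f i) 0 = 0) ∧ DD (m i) (f i) 0 ≠ 0) :
    ∃ q : ℝ → ℝ, AnalyticAt ℝ q 0 ∧ q 0 = 0 ∧ ((∃ i, 1 ≤ m i) → ∃ i, 1 ≤ m i ∧
      ∀ᶠ t in 𝓝 (0:ℝ), DD (m i - 1) (f i) (q t, t) = 0) := by
  by_cases h : ∃ i, 1 ≤ m i
  · obtain ⟨i, hi⟩ := h
    have h1 : DD 1 (DD (m i - 1) (f i)) 0 ≠ 0 := by
      have e := DD_succ (m i - 1) (f i) 0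
      rw [Nat.sub_add_cancel hi] at e
      have e2 := DD_succ 0 (DD (m i - 1) (f i)) 0
      simp only [DD, iteratedDeriv_zero] at e2
      have : DD 1 (DD (m i - 1) (f i)) 0 = DD (m i) (f i) 0 := by
        rw [e]; exact e2
      rw [this]; exact (hm i).2
    obtain ⟨q, q1, q2, q3⟩ := implicit_line (DD_analyticAt (hf i) (m i - 1))
      ((hm i).1 _ (by omega)) h1
    exact ⟨q, q1, q2, fun _ => ⟨i, hi, q3⟩⟩
  · exact ⟨fun _ => 0, analyticAt_const, rfl, fun h' => absurd h' h⟩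

lemma analyticAt_shift {f : ℝ × ℝ → ℝ} (hf : AnalyticAt ℝ f 0) {q : ℝ → ℝ} (hq : AnalyticAt ℝ q 0)
    (hq0 : q 0 = 0) : AnalyticAt ℝ (fun p : ℝ × ℝ => f (p.1 + q p.2, p.2)) 0 := by
  have h2 : AnalyticAt ℝ (fun p : ℝ × ℝ => q p.2) 0 :=
    AnalyticAt.comp (g := q) (f := fun p : ℝ × ℝ => p.2) (x := (0 : ℝ × ℝ)) hq analyticAt_snd
  refine AnalyticAt.comp (g := f) (f := fun p : ℝ × ℝ => ((p.1 + q p.2, p.2) : ℝ × ℝ))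
    (x := (0 : ℝ × ℝ)) ?_ ((analyticAt_fst.add h2).prod analyticAt_snd)
  simp only [Prod.fst_zero, Prod.snd_zero, hq0, add_zero]; exact hf

lemma prep {ι : Type} {f : ι → ℝ × ℝ → ℝ} {m : ι → ℕ} (hf : ∀ i, AnalyticAt ℝ (f i) 0)
    (hm : ∀ i, (∀ k < m i, DD k (f i) 0 = 0) ∧ DD (m i) (f i) 0 ≠ 0) :
    ∃ (q : ℝ → ℝ) (u : ι → ℝ × ℝ → ℝ) (a : ι → ℕ → ℝ → ℝ), AnalyticAt ℝ q 0 ∧ q 0 = 0 ∧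
      (∀ i, AnalyticAt ℝ (u i) 0) ∧ (∀ i, u i 0 ≠ 0) ∧ (∀ i k, AnalyticAt ℝ (a i k) 0) ∧
      (∀ i, ∀ k < m i, a i k 0 = 0) ∧
      (∀ i, ∀ᶠ p in 𝓝 (0 : ℝ × ℝ), f i (p.1 + q p.2, p.2) =
        ∑ k ∈ Finset.range (m i), a i k p.2 * p.1 ^ k + p.1 ^ m i * u i p) ∧
      ((∃ i, 1 ≤ m i) → ∃ i, 1 ≤ m i ∧ ∀ᶠ t in 𝓝 (0:ℝ), a i (m i - 1) t = 0) := by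
  obtain ⟨q, q1, q2, q3⟩ := prep_shift hf hm
  have hg := fun i => analyticAt_shift (hf i) q1 q2
  choose u' hu' hT using fun i => taylor2 (m i + 1) (hg i)
  have hDD : ∀ i k t, DD k (fun p : ℝ × ℝ => f i (p.1 + q p.2, p.2)) (0, t) = DD k (f i) (q t, t) := by
    intro i k t
    rw [DD_shift]; simp
  have hDa : ∀ i k, AnalyticAt ℝ (fun t => DD k (f i) (q t, t) / (k.factorial : ℝ)) 0 := by
    intro i k
    refine AnalyticAt.div ?_ analyticAt_const (by positivity)
    refine AnalyticAt.comp (g := DD k (f i)) (f := fun t : ℝ => ((q t, t) : ℝ × ℝ)) (x := (0:ℝ)) ?_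
      (q1.prod analyticAt_id)
    rw [q2]; exact DD_analyticAt (hf i) k
  refine ⟨q, fun i p => DD (m i) (f i) (q p.2, p.2) / ((m i).factorial : ℝ) + p.1 * u' i p,
    fun i k t => DD k (f i) (q t, t) / (k.factorial : ℝ), q1, q2, ?_, ?_, hDa, ?_, ?_, ?_⟩
  · intro i
    refine AnalyticAt.add ?_ (analyticAt_fst.mul (hu' i))
    exact AnalyticAt.comp (g := fun t => DD (m i) (f i) (q t, t) / ((m i).factorial : ℝ))
      (f := fun p : ℝ × ℝ => p.2) (x := (0 : ℝ × ℝ)) (hDa i (m i)) analyticAt_snd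
  · intro i
    simp only [Prod.fst_zero, Prod.snd_zero, q2, zero_mul, add_zero]
    exact div_ne_zero (hm i).2 (by positivity)
  · intro i k hk
    simp only [q2]
    rw [show ((0:ℝ), (0:ℝ)) = 0 from rfl, (hm i).1 k hk, zero_div]
  · intro i
    filter_upwards [hT i] with p hp
    rw [hp, Finset.sum_range_succ]
    simp only [hDD]
    ring
  · intro h
    obtain ⟨i, hi, h⟩ := q3 h
    refine ⟨i, hi, ?_⟩
    filter_upwards [h] with t ht
    rw [ht, zero_div]

lemma prod_nhds_box {P : ℝ × ℝ → Prop} (h : ∀ᶠ p in 𝓝 (0 : ℝ × ℝ), P p) :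
    ∃ ρ > 0, ∀ x t : ℝ, |x| < ρ → |t| < ρ → P (x, t) := by
  obtain ⟨ρ, hρ, hb⟩ := Metric.eventually_nhds_iff_ball.1 h
  refine ⟨ρ, hρ, fun x t hx ht => hb _ ?_⟩
  rw [mem_ball_zero_iff, Prod.norm_def]
  exact max_lt hx ht

lemma cells_pure {ι : Type} [Fintype ι] {f : ι → ℝ × ℝ → ℝ} {m : ι → ℕ} {q : ℝ → ℝ}
    {u : ι → ℝ × ℝ → ℝ} (hq : AnalyticAt ℝ q 0) (hq0 : q 0 = 0)
    (hu : ∀ i, AnalyticAt ℝ (u i) 0) (hu0 : ∀ i, u i 0 ≠ 0)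
    (hfe : ∀ i, ∀ᶠ p in 𝓝 (0 : ℝ × ℝ), f i (p.1 + q p.2, p.2) = p.1 ^ m i * u i p) :
    ∀ᶠ r in 𝓝[>] (0:ℝ), ∃ τ > 0, HasCells f (fun _ => -r) (fun _ => r) τ := by
  obtain ⟨ρ₀, hρ₀, hb⟩ := prod_nhds_box (Filter.eventually_all.2 hfe)
  have hV : ∀ i, AnalyticAt ℝ (fun e : ℝ × ℝ × ℝ => u i (e.1, e.2.1)) 0 := by
    intro i
    have h2 : AnalyticAt ℝ (fun e : ℝ × ℝ × ℝ => e.2.1) 0 :=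
        ((ContinuousLinearMap.fst ℝ ℝ ℝ).comp (ContinuousLinearMap.snd ℝ ℝ (ℝ × ℝ))).analyticAt _
    exact AnalyticAt.comp (g := u i) (f := fun e : ℝ × ℝ × ℝ => ((e.1, e.2.1) : ℝ × ℝ))
      (x := (0 : ℝ × ℝ × ℝ)) (hu i) (analyticAt_fst.prod h2)
  obtain ⟨ρ, hρ, H⟩ := cells_sides (G := fun i p => f i (p.1 + q p.2, p.2)) (m := m) le_rfl hV
    (fun i => hu0 i) hq hq0 (ε := 0) le_rfl hρ₀ (fun i x hx hx' t ht => by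
      exact hb x t hx' (by rw [abs_of_pos ht.1]; exact ht.2) i)
  filter_upwards [Ioo_mem_nhdsGT hρ] with r hr
  obtain ⟨τ, hτ, c1, c2, c3⟩ := H 0 le_rfl (by simp) r hr.1 hr.2
  refine cells_assemble one_pos hq ⟨τ, hτ, ?_⟩
  simp only [pow_one]
  simp only [zero_mul, neg_zero] at c1 c2 c3
  exact c2.concat c1 (fun t ht => (c3 t ht).2) (fun t ht => (c3 t ht).1)

def qpoly (m : ℕ) (A : ℕ → ℝ) (u : ℝ) : Polynomial ℝ :=
  ∑ k ∈ Finset.range m, Polynomial.monomial k (A k) + Polynomial.monomial m u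

lemma qpoly_coeff (m : ℕ) (A : ℕ → ℝ) (u : ℝ) (k : ℕ) :
    (qpoly m A u).coeff k = if k < m then A k else if k = m then u else 0 := by
  simp only [qpoly, Polynomial.coeff_add, Polynomial.finsetSum_coeff, Polynomial.coeff_monomial]
  rw [Finset.sum_ite_eq' (Finset.range m) k]
  simp only [Finset.mem_range]
  by_cases h : k < m
  · simp [h, h.ne']
  · by_cases h' : k = m
    · simp [h']
    · simp [h, h', Ne.symm h']

lemma qpoly_eval (m : ℕ) (A : ℕ → ℝ) (u z : ℝ) :
    (qpoly m A u).eval z = ∑ k ∈ Finset.range m, A k * z ^ k + z ^ m * u := by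
  simp only [qpoly, Polynomial.eval_add, Polynomial.eval_finsetSum, Polynomial.eval_monomial]
  ring

lemma qpoly_natDegree (m : ℕ) (A : ℕ → ℝ) (u : ℝ) : (qpoly m A u).natDegree ≤ m := by
  rw [Polynomial.natDegree_le_iff_coeff_eq_zero]
  intro k hk
  rw [qpoly_coeff, if_neg (by omega), if_neg (by omega)]

def ftil (m p N : ℕ) (A : ℕ → ℝ → ℝ) (u : ℝ × ℝ → ℝ) (e : ℝ × ℝ) : ℝ :=
  ∑ k ∈ Finset.range m, A k e.2 * e.1 ^ k + e.1 ^ m * u (e.2 ^ p * e.1, e.2 ^ N)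

lemma ftil_analytic {m p N : ℕ} (hp : 1 ≤ p) (hN : 0 < N) {A : ℕ → ℝ → ℝ} {u : ℝ × ℝ → ℝ}
    (hA : ∀ k < m, AnalyticAt ℝ (A k) 0) (hu : AnalyticAt ℝ u 0) (z : ℝ) :
    AnalyticAt ℝ (ftil m p N A u) (z, 0) := by
  have h1 : AnalyticAt ℝ (fun e : ℝ × ℝ => e.1) (z, 0) := analyticAt_fst
  have h2 : AnalyticAt ℝ (fun e : ℝ × ℝ => e.2) (z, 0) := analyticAt_snd
  unfold ftil
  refine AnalyticAt.add ?_ ((h1.pow m).mul ?_)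
  · refine Finset.analyticAt_fun_sum _ fun k hk => ?_
    refine AnalyticAt.mul ?_ (h1.pow k)
    exact AnalyticAt.comp (g := A k) (f := fun e : ℝ × ℝ => e.2) (x := ((z, 0) : ℝ × ℝ))
      (hA k (Finset.mem_range.1 hk)) h2
  · refine AnalyticAt.comp (g := u) (f := fun e : ℝ × ℝ => ((e.2 ^ p * e.1, e.2 ^ N) : ℝ × ℝ))
      (x := ((z, 0) : ℝ × ℝ)) ?_ (((h2.pow p).mul h1).prod (h2.pow N))
    have hp0 : p ≠ 0 := by omega
    simp only [zero_pow hp0, zero_pow hN.ne', zero_mul]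
    exact hu

lemma ftil_zero {m p N : ℕ} (hp : 1 ≤ p) (hN : 0 < N) {A : ℕ → ℝ → ℝ} {u : ℝ × ℝ → ℝ} (z : ℝ) :
    ftil m p N A u (z, 0) = (qpoly m (fun k => A k 0) (u 0)).eval z := by
  have hp0 : p ≠ 0 := by omega
  rw [qpoly_eval]
  simp only [ftil, zero_pow hp0, zero_pow hN.ne', zero_mul]
  rfl

lemma cells_middle {ι : Type} [Fintype ι] {m : ι → ℕ} {p N : ℕ} (hp : 1 ≤ p) (hN : 0 < N)
    {A : ι → ℕ → ℝ → ℝ} {u : ι → ℝ × ℝ → ℝ} (hA : ∀ i, ∀ k < m i, AnalyticAt ℝ (A i k) 0)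
    (hu : ∀ i, AnalyticAt ℝ (u i) 0) (hu0 : ∀ i, u i 0 ≠ 0)
    (hA0 : ∃ i, ∃ k < m i, A i k 0 ≠ 0) (hi0 : ∃ i, 1 ≤ m i ∧ A i (m i - 1) 0 = 0)
    (hIH : ∀ (f' : ι → ℝ × ℝ → ℝ) (m' : ι → ℕ), (∀ i, AnalyticAt ℝ (f' i) 0) →
      (∀ i, (∀ k < m' i, DD k (f' i) 0 = 0) ∧ DD (m' i) (f' i) 0 ≠ 0) → ∑ i, m' i < ∑ i, m i →
      ∀ᶠ r in 𝓝[>] (0:ℝ), ∃ τ > 0, HasCells f' (fun _ => -r) (fun _ => r) τ) :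
    ∃ B : ℝ, ∀ R > B, ∃ τ > 0,
      HasCells (fun i => ftil (m i) p N (A i) (u i)) (fun _ => -R) (fun _ => R) τ := by
  classical
  let P : ι → Polynomial ℝ := fun i => qpoly (m i) (fun k => A i k 0) (u i 0)
  have hPm : ∀ i, (P i).coeff (m i) ≠ 0 := by
    intro i
    rw [qpoly_coeff, if_neg (lt_irrefl _), if_pos rfl]; exact hu0 i
  have hP0 : ∀ i, P i ≠ 0 := by
    intro i h
    exact hPm i (by rw [h]; simp)
  have hPd : ∀ i, (P i).natDegree ≤ m i := fun i => qpoly_natDegree _ _ _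
  have hPe : ∀ i z, ftil (m i) p N (A i) (u i) (z, 0) = (P i).eval z := fun i z => ftil_zero hp hN z
  have han : ∀ i z, AnalyticAt ℝ (ftil (m i) p N (A i) (u i)) (z, 0) :=
    fun i z => ftil_analytic hp hN (hA i) (hu i) z
  let Z : Finset ℝ := Finset.univ.biUnion fun i => (P i).roots.toFinset
  have hnz : ∀ z ∉ Z, ∀ i, ftil (m i) p N (A i) (u i) (z, 0) ≠ 0 := by
    intro z hz i h
    apply hz
    rw [hPe] at h
    simp only [Z, Finset.mem_biUnion, Finset.mem_univ, true_and, Multiset.mem_toFinset]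
    exact ⟨i, (Polynomial.mem_roots (hP0 i)).2 h⟩
  have hle : ∀ i z, (P i).rootMultiplicity z ≤ m i := by
    intro i z
    rw [← Polynomial.count_roots]
    exact ((P i).roots.count_le_card z).trans ((P i).card_roots'.trans (hPd i))
  have hlt : ∀ z, ∑ i, (P i).rootMultiplicity z < ∑ i, m i := by
    intro z
    refine lt_of_le_of_ne (Finset.sum_le_sum fun i _ => hle i z) fun heq => ?_
    have hall := (Finset.sum_eq_sum_iff_of_le fun i _ => hle i z).1 heq
    have hco : ∀ i k, (P i).coeff k = (P i).coeff (m i) * ((-z) ^ (m i - k) * ((m i).choose k : ℝ)) :=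
      fun i k => poly_mult (hPd i) (hPm i) (hall i (Finset.mem_univ i)).ge k
    obtain ⟨i, hi, hi'⟩ := hi0
    have h1 := hco i (m i - 1)
    have hz : z = 0 := by
      rw [show (P i).coeff (m i - 1) = A i (m i - 1) 0 by
        rw [qpoly_coeff, if_pos (by omega)], hi'] at h1
      rw [show m i - (m i - 1) = 1 by omega, pow_one] at h1
      have h3 : ((m i).choose (m i - 1) : ℝ) ≠ 0 := by
        exact_mod_cast (Nat.choose_pos (by omega : m i - 1 ≤ m i)).ne'
      have h4 := mul_eq_zero.1 h1.symm
      rcases h4 with h4 | h4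
      · exact absurd h4 (hPm i)
      · rcases mul_eq_zero.1 h4 with h5 | h5
        · linarith
        · exact absurd h5 h3
    obtain ⟨j, k, hk, hj⟩ := hA0
    apply hj
    have h2 := hco j k
    rw [show (P j).coeff k = A j k 0 by rw [qpoly_coeff, if_pos hk]] at h2
    rw [h2, hz, neg_zero, zero_pow (by omega)]; simp
  have hloc : ∀ z ∈ Z, ∀ᶠ r in 𝓝[>] (0:ℝ), ∃ τ > 0,
      HasCells (fun i => ftil (m i) p N (A i) (u i)) (fun _ => z - r) (fun _ => z + r) τ := by
    intro z _
    have han' : ∀ i, AnalyticAt ℝ (fun e : ℝ × ℝ => ftil (m i) p N (A i) (u i) (z + e.1, e.2)) 0 := by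
      intro i
      refine AnalyticAt.comp (g := ftil (m i) p N (A i) (u i))
        (f := fun e : ℝ × ℝ => ((z + e.1, e.2) : ℝ × ℝ)) (x := (0 : ℝ × ℝ)) ?_
        ((analyticAt_const.add analyticAt_fst).prod analyticAt_snd)
      simp only [Prod.fst_zero, Prod.snd_zero, add_zero]
      exact han i z
    have h := hIH (fun i e => ftil (m i) p N (A i) (u i) (z + e.1, e.2))
      (fun i => (P i).rootMultiplicity z) han' ?_ (hlt z)
    · filter_upwards [h] with r hr
      obtain ⟨τ, hτ, c⟩ := hr
      refine ⟨τ, hτ, HasCells.affine (q := fun _ => z) (s := fun _ => 1) (e := fun _ _ => 1) c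
        continuousOn_const (LL.const τ one_ne_zero) (fun i => LL.const τ one_ne_zero) ?_ ?_⟩
      · intro t ht
        rw [image_affine_pos _ _ _ _ one_pos]
        congr 1 <;> ring
      · intro i t ht x hx
        simp
    · intro i
      have hs : ∀ x, ftil (m i) p N (A i) (u i) (z + x, 0) = (P i).eval (z + x) := fun x => hPe i _
      have ho := poly_order (hP0 i) z
      have hanp : AnalyticAt ℝ (fun x => (P i).eval (z + x)) 0 := by
        have := analyticAt_slice (x := 0) (t := 0) (han' i)
        simpa only [hs] using this
      have := (analyticOrderAt_eq_nat_iff_iteratedDeriv_eq_zero hanp).1 ho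
      simpa only [DD, Prod.fst_zero, Prod.snd_zero, hs] using this
  refine ⟨∑ z ∈ Z, |z|, fun R hR => ?_⟩
  have hZR : ∀ z ∈ Z, |z| < R := fun z hz =>
    (Finset.single_le_sum (f := fun z : ℝ => |z|) (fun _ _ => abs_nonneg _) hz).trans_lt hR
  have hR0 : 0 < R := (Finset.sum_nonneg fun _ _ => abs_nonneg _).trans_lt hR
  refine cells_interval Z han hnz hloc _ (-R) R (by linarith) ?_ ?_ le_rfl
  · intro h; have := hZR _ h; rw [abs_neg, abs_of_pos hR0] at this; exact lt_irrefl _ this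
  · intro h; have := hZR _ h; rw [abs_of_pos hR0] at this; exact lt_irrefl _ this

lemma cells_newton {ι : Type} [Fintype ι] {f : ι → ℝ × ℝ → ℝ} {m : ι → ℕ} {q : ℝ → ℝ}
    {u : ι → ℝ × ℝ → ℝ} {a : ι → ℕ → ℝ → ℝ} (hq : AnalyticAt ℝ q 0) (hq0 : q 0 = 0)
    (hu : ∀ i, AnalyticAt ℝ (u i) 0) (hu0 : ∀ i, u i 0 ≠ 0)
    (hfe : ∀ i, ∀ᶠ p in 𝓝 (0 : ℝ × ℝ), f i (p.1 + q p.2, p.2) =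
      ∑ k ∈ Finset.range (m i), a i k p.2 * p.1 ^ k + p.1 ^ m i * u i p)
    {p N : ℕ} (hp : 1 ≤ p) (hN : 0 < N) {A : ι → ℕ → ℝ → ℝ}
    (hA : ∀ i, ∀ k < m i, AnalyticAt ℝ (A i k) 0)
    (hAe : ∀ i, ∀ k < m i, ∀ᶠ t in 𝓝 (0:ℝ), a i k (t ^ N) = t ^ (p * (m i - k)) * A i k t)
    (hmid : ∃ B : ℝ, ∀ R > B, ∃ τ > 0,
      HasCells (fun i => ftil (m i) p N (A i) (u i)) (fun _ => -R) (fun _ => R) τ) :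
    ∀ᶠ r in 𝓝[>] (0:ℝ), ∃ τ > 0, HasCells f (fun _ => -r) (fun _ => r) τ := by
  have hQ : AnalyticAt ℝ (fun t => q (t ^ N)) 0 := by
    refine AnalyticAt.comp (g := q) (f := fun t : ℝ => t ^ N) (x := (0:ℝ)) ?_ (analyticAt_id.pow _)
    simpa [hN.ne'] using hq
  have hQ0 : q (0 ^ N) = 0 := by rw [zero_pow hN.ne', hq0]
  obtain ⟨ρ1, hρ1, hb1⟩ := prod_nhds_box (Filter.eventually_all.2 hfe)
  have hAe' : ∀ᶠ t in 𝓝 (0:ℝ), ∀ i, ∀ k ∈ Finset.range (m i), a i k (t ^ N)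
      = t ^ (p * (m i - k)) * A i k t := by
    refine Filter.eventually_all.2 fun i => ?_
    rw [Finset.eventually_all]
    exact fun k hk => hAe i k (Finset.mem_range.1 hk)
  obtain ⟨ρ2, hρ2, hb2⟩ := Metric.eventually_nhds_iff_ball.1 hAe'
  set ρ₀ := min 1 (min ρ1 ρ2) with hρ₀def
  have hρ₀ : 0 < ρ₀ := by positivity
  have key : ∀ i, ∀ x, |x| < ρ₀ → ∀ t ∈ Ioo 0 ρ₀, f i (x + q (t ^ N), t ^ N) =
      ∑ k ∈ Finset.range (m i), t ^ (p * (m i - k)) * A i k t * x ^ k + x ^ m i * u i (x, t ^ N) := by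
    intro i x hx t ht
    have ht1 : t ≤ 1 := ht.2.le.trans (min_le_left _ _)
    have htN : t ^ N ≤ t := by
      calc t ^ N ≤ t ^ 1 := pow_le_pow_of_le_one ht.1.le ht1 hN
        _ = t := pow_one t
    have hρ1' : ρ₀ ≤ ρ1 := (min_le_right _ _).trans (min_le_left _ _)
    have hρ2' : ρ₀ ≤ ρ2 := (min_le_right _ _).trans (min_le_right _ _)
    have h1 := hb1 x (t ^ N) (hx.trans_le hρ1')
      (by rw [abs_of_pos (pow_pos ht.1 N)]; exact (htN.trans_lt ht.2).trans_le hρ1') i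
    have h2 := hb2 t (by rw [mem_ball_zero_iff, Real.norm_eq_abs, abs_of_pos ht.1]
                         exact ht.2.trans_le hρ2') i
    simp only at h1
    rw [h1]
    congr 1
    exact Finset.sum_congr rfl fun k hk => by rw [h2 k hk]
  let V : ι → ℝ × ℝ × ℝ → ℝ := fun i e =>
    u i (e.1, e.2.1 ^ N) + ∑ k ∈ Finset.range (m i), A i k e.2.1 * e.2.2 ^ (m i - k)
  have e2 : AnalyticAt ℝ (fun e : ℝ × ℝ × ℝ => e.2.1) 0 :=
    ((ContinuousLinearMap.fst ℝ ℝ ℝ).comp (ContinuousLinearMap.snd ℝ ℝ (ℝ × ℝ))).analyticAt _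
  have e3 : AnalyticAt ℝ (fun e : ℝ × ℝ × ℝ => e.2.2) 0 :=
    ((ContinuousLinearMap.snd ℝ ℝ ℝ).comp (ContinuousLinearMap.snd ℝ ℝ (ℝ × ℝ))).analyticAt _
  have hV : ∀ i, AnalyticAt ℝ (V i) 0 := by
    intro i
    refine AnalyticAt.add ?_ ?_
    · refine AnalyticAt.comp (g := u i) (f := fun e : ℝ × ℝ × ℝ => ((e.1, e.2.1 ^ N) : ℝ × ℝ))
        (x := (0 : ℝ × ℝ × ℝ)) ?_ (analyticAt_fst.prod (e2.pow N))
      simp only [Prod.fst_zero, Prod.snd_zero, zero_pow hN.ne']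
      exact hu i
    · refine Finset.analyticAt_fun_sum _ fun k hk => ?_
      refine AnalyticAt.mul ?_ (e3.pow _)
      exact AnalyticAt.comp (g := A i k) (f := fun e : ℝ × ℝ × ℝ => e.2.1) (x := (0 : ℝ × ℝ × ℝ))
        (hA i k (Finset.mem_range.1 hk)) e2
  have hV0 : ∀ i, V i 0 ≠ 0 := by
    intro i
    have : V i 0 = u i 0 := by
      simp only [V, Prod.fst_zero, Prod.snd_zero, zero_pow hN.ne']
      rw [Finset.sum_eq_zero, add_zero]; · rfl
      intro k hk
      rw [zero_pow (by have := Finset.mem_range.1 hk; omega), mul_zero]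
    rw [this]; exact hu0 i
  obtain ⟨ρ, hρ, H⟩ := cells_sides (G := fun i e => f i (e.1 + q (e.2 ^ N), e.2 ^ N)) (m := m) hp hV
    hV0 hQ hQ0 (ε := 1) zero_le_one hρ₀ (fun i x hx hx' t ht => by
      simp only
      rw [key i x hx' t ht]
      simp only [V]
      rw [mul_add, add_comm, Finset.mul_sum]
      congr 1
      refine Finset.sum_congr rfl fun k hk => ?_
      have hk' := Finset.mem_range.1 hk
      rw [one_mul, div_pow, ← pow_mul, show x ^ m i = x ^ k * x ^ (m i - k) by
        rw [← pow_add]; congr 1; omega]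
      field_simp)
  obtain ⟨B, hB⟩ := hmid
  set R := max B (1 / ρ) + 1 with hR
  have hRB : B < R := by have := le_max_left B (1 / ρ); linarith
  have hRρ : 1 / ρ < R := by have := le_max_right B (1 / ρ); linarith
  have hR0 : 0 < R := lt_trans (by positivity) hRρ
  obtain ⟨τ1, hτ1, c1⟩ := hB R hRB
  filter_upwards [Ioo_mem_nhdsGT hρ] with r hr
  obtain ⟨τ2, hτ2, d1, d2, d3⟩ := H R hR0.le (by rw [div_lt_iff₀ hρ] at hRρ; exact hRρ.le) r hr.1 hr.2
  refine cells_assemble hN hQ ?_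
  set τ := min (min τ1 τ2) (min ρ₀ (ρ₀ / R)) with hτdef
  have hτ : 0 < τ := by positivity
  refine ⟨τ, hτ, ?_⟩
  have c2 : HasCells (fun i e => f i (e.1 + q (e.2 ^ N), e.2 ^ N)) (fun t => -(R * t ^ p))
      (fun t => R * t ^ p) τ := by
    refine HasCells.affine (q := fun _ => 0) (s := fun t => t ^ p) (e := fun i t => t ^ (p * m i))
      (c1.mono (τ' := τ) ((min_le_left _ _).trans (min_le_left _ _))) continuousOn_const
      ((LL.id τ).pow p) (fun i => (LL.id τ).pow (p * m i)) ?_ ?_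
    · intro t ht
      rw [image_affine_pos _ _ _ _ (pow_pos ht.1 p)]
      congr 1 <;> ring
    · intro i t ht z hz
      have htρ : t < ρ₀ := ht.2.trans_le ((min_le_right _ _).trans (min_le_left _ _))
      have htR : t < ρ₀ / R := ht.2.trans_le ((min_le_right _ _).trans (min_le_right _ _))
      have ht1 : t ≤ 1 := htρ.le.trans (min_le_left _ _)
      have htp : t ^ p ≤ t := by
        calc t ^ p ≤ t ^ 1 := pow_le_pow_of_le_one ht.1.le ht1 hp
          _ = t := pow_one t
      have hx : |t ^ p * z| < ρ₀ := by
        rw [abs_mul, abs_of_pos (pow_pos ht.1 p)]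
        have hz' : |z| ≤ R := (abs_lt.2 hz).le
        calc t ^ p * |z| ≤ t * R := mul_le_mul htp hz' (abs_nonneg _) ht.1.le
          _ < ρ₀ := by rwa [lt_div_iff₀ hR0] at htR
      simp only [zero_add]
      rw [key i _ hx t ⟨ht.1, htρ⟩]
      simp only [ftil]
      rw [mul_add, Finset.mul_sum]
      congr 1
      · refine Finset.sum_congr rfl fun k hk => ?_
        have hk' := Finset.mem_range.1 hk
        rw [mul_pow, ← pow_mul, show p * m i = p * (m i - k) + p * k by
          rw [← mul_add]; congr 1; omega, pow_add]
        ring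
      · rw [mul_pow, ← pow_mul]; ring
  have hτ2' : τ ≤ τ2 := (min_le_left _ _).trans (min_le_right _ _)
  have hpos : ∀ t ∈ Ioo 0 τ, 0 < R * t ^ p := fun t ht => mul_pos hR0 (pow_pos ht.1 p)
  have hI : ∀ t ∈ Ioo 0 τ, t ∈ Ioo 0 τ2 := fun t ht => ⟨ht.1, ht.2.trans_le hτ2'⟩
  refine ((d2.mono hτ2').concat c2 ?_ ?_).concat (d1.mono hτ2') ?_ ?_
  · exact fun t ht => (d3 t (hI t ht)).2
  · intro t ht; have := hpos t ht; linarith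
  · intro t ht; have := hpos t ht; have := (d3 t (hI t ht)).2; linarith
  · exact fun t ht => (d3 t (hI t ht)).1

theorem main_cells {ι : Type} [Fintype ι] (M : ℕ) : ∀ (f : ι → ℝ × ℝ → ℝ) (m : ι → ℕ),
    (∀ i, AnalyticAt ℝ (f i) 0) →
    (∀ i, (∀ k < m i, DD k (f i) 0 = 0) ∧ DD (m i) (f i) 0 ≠ 0) → ∑ i, m i = M →
    ∀ᶠ r in 𝓝[>] (0:ℝ), ∃ τ > 0, HasCells f (fun _ => -r) (fun _ => r) τ := by
  induction M using Nat.strong_induction_on with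
  | _ M ih =>
  intro f m hf hm hM
  obtain ⟨q, u, a, q1, q2, q3, q4, q5, q6, q7, q8⟩ := prep hf hm
  by_cases hpure : ∃ i, ∃ k < m i, ¬ ∀ᶠ t in 𝓝 (0:ℝ), a i k t = 0
  · have hdiv : ∀ i, ∀ k < m i, (m i - k) ∣ M.factorial := by
      intro i k hk
      refine Nat.dvd_factorial (by omega) ?_
      have := Finset.single_le_sum (f := m) (fun _ _ => Nat.zero_le _) (Finset.mem_univ i)
      omega
    obtain ⟨p, hp, A, hA, hA0⟩ := newton (fun i k _ => q5 i k) q6 (Nat.factorial_pos M) hdiv hpure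
    refine cells_newton q1 q2 q3 q4 q7 hp (Nat.factorial_pos M) (fun i k hk => (hA i k hk).1)
      (fun i k hk => (hA i k hk).2.1) ?_
    refine cells_middle hp (Nat.factorial_pos M) (fun i k hk => (hA i k hk).1) q3 q4 hA0 ?_ ?_
    · obtain ⟨i, k, hk, -⟩ := hpure
      obtain ⟨i, hi, h⟩ := q8 ⟨i, by omega⟩
      exact ⟨i, hi, (hA i (m i - 1) (by omega)).2.2 h 0⟩
    · intro f' m' h1 h2 h3
      exact ih _ (hM ▸ h3) f' m' h1 h2 rfl
  · push Not at hpure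
    refine cells_pure q1 q2 q3 q4 (m := m) fun i => ?_
    have h : ∀ᶠ t in 𝓝 (0:ℝ), ∀ k ∈ Finset.range (m i), a i k t = 0 := by
      rw [Finset.eventually_all]
      exact fun k hk => hpure i k (Finset.mem_range.1 hk)
    have h' : ∀ᶠ e in 𝓝 (0:ℝ × ℝ), ∀ k ∈ Finset.range (m i), a i k e.2 = 0 :=
      (continuous_snd.tendsto (0 : ℝ × ℝ)).eventually h
    filter_upwards [q7 i, h'] with e he he'
    rw [he, Finset.sum_eq_zero, zero_add]
    intro k hk; rw [he' k hk, zero_mul]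

def Lmap (v p : ℝ × ℝ) : ℝ × ℝ := (p.2 * v.1 + p.1 * v.2, p.2 * v.2 - p.1 * v.1)

lemma unit_sq {v : ℝ × ℝ} (hv : nrm2 v = 1) : v.1 ^ 2 + v.2 ^ 2 = 1 := by
  have h := Real.sq_sqrt (show (0:ℝ) ≤ v.1 ^ 2 + v.2 ^ 2 by positivity)
  unfold nrm2 at hv
  rw [hv] at h; linarith

lemma dot_Lmap {v : ℝ × ℝ} (hv : nrm2 v = 1) (p : ℝ × ℝ) : dot2 (Lmap v p) v = p.2 := by
  have := unit_sq hv
  simp only [dot2, Lmap]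
  linear_combination p.2 * this

lemma dot_perp_Lmap {v : ℝ × ℝ} (hv : nrm2 v = 1) (p : ℝ × ℝ) :
    dot2 (Lmap v p) (perp2 v) = p.1 := by
  have := unit_sq hv
  simp only [dot2, Lmap, perp2]
  linear_combination p.1 * this

lemma Lmap_sq {v : ℝ × ℝ} (hv : nrm2 v = 1) (p : ℝ × ℝ) :
    (Lmap v p).1 ^ 2 + (Lmap v p).2 ^ 2 = p.1 ^ 2 + p.2 ^ 2 := by
  have := unit_sq hv
  simp only [Lmap]
  linear_combination (p.1 ^ 2 + p.2 ^ 2) * this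

lemma unit_le {v : ℝ × ℝ} (hv : nrm2 v = 1) : |v.1| ≤ 1 ∧ |v.2| ≤ 1 := by
  have := unit_sq hv
  constructor <;> rw [← sq_le_one_iff_abs_le_one] <;> nlinarith [sq_nonneg v.1, sq_nonneg v.2]

lemma Lmap_norm {v : ℝ × ℝ} (hv : nrm2 v = 1) (p : ℝ × ℝ) : ‖Lmap v p‖ ≤ |p.1| + |p.2| := by
  obtain ⟨h1, h2⟩ := unit_le hv
  rw [Prod.norm_def]
  simp only [Lmap, Real.norm_eq_abs]
  refine max_le ?_ ?_
  · refine (abs_add_le _ _).trans ?_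
    rw [abs_mul, abs_mul]
    nlinarith [abs_nonneg p.1, abs_nonneg p.2]
  · refine (abs_sub _ _).trans ?_
    rw [abs_mul, abs_mul]
    nlinarith [abs_nonneg p.1, abs_nonneg p.2]

lemma curve1D {ξ η : ℝ → ℝ} (hξ : AnalyticAt ℝ ξ 0) (hη : AnalyticAt ℝ η 0) (hξ0 : ξ 0 = 0)
    (hη0 : η 0 = 0) : ∃ k > 0, ∃ c : ℝ → ℝ, AnalyticAt ℝ c 0 ∧ c 0 = 0 ∧ ∃ ρ > 0,
      ∀ T, 0 ≤ T → T < ρ → ∀ y ∈ Ioo 0 ρ, η T = y ^ k → ξ T = c y := by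
  rcases germ_cases hη with h | ⟨k, e, he, he0, h⟩
  · refine ⟨1, one_pos, fun _ => 0, analyticAt_const, rfl, ?_⟩
    obtain ⟨ρ, hρ, hb⟩ := Metric.eventually_nhds_iff_ball.1 h
    refine ⟨ρ, hρ, fun T hT hTρ y hy hyT => ?_⟩
    rw [hb T (by rw [mem_ball_zero_iff, Real.norm_eq_abs, abs_of_nonneg hT]; exact hTρ)] at hyT
    have := pow_pos hy.1 1; linarith
  · have hk : k ≠ 0 := by
      rintro rfl
      have := h.self_of_nhds
      rw [hη0, pow_zero, one_mul] at this
      exact he0 this.symm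
    rcases lt_or_gt_of_ne he0 with hneg | hpos
    · refine ⟨1, one_pos, fun _ => 0, analyticAt_const, rfl, ?_⟩
      obtain ⟨ρ, hρ, hb⟩ := Metric.eventually_nhds_iff_ball.1
        (h.and (he.continuousAt.eventually_lt_const hneg))
      refine ⟨ρ, hρ, fun T hT hTρ y hy hyT => ?_⟩
      obtain ⟨h1, h2⟩ := hb T (by rw [mem_ball_zero_iff, Real.norm_eq_abs, abs_of_nonneg hT]; exact hTρ)
      rw [h1] at hyT
      have := pow_pos hy.1 1
      have := mul_nonpos_of_nonneg_of_nonpos (pow_nonneg hT k) h2.le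
      linarith
    · set E : ℝ → ℝ := fun T => Real.exp (Real.log (e T) / k) with hE
      have hEa : AnalyticAt ℝ E 0 := by
        refine AnalyticAt.rexp ?_
        exact (he.log hpos).div analyticAt_const (by exact_mod_cast hk)
      have hEpos : ∀ T, 0 < E T := fun T => Real.exp_pos _
      have hEk : ∀ T, 0 < e T → E T ^ k = e T := by
        intro T hT
        rw [hE, ← Real.exp_nat_mul, mul_div_cancel₀ _ (by exact_mod_cast hk), Real.exp_log hT]
      have hWa : AnalyticAt ℝ (fun T => T * E T) 0 := analyticAt_id.mul hEa
      have hWd : HasDerivAt (fun T => T * E T) (E 0) 0 := by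
        have := (hasDerivAt_id' (0:ℝ)).fun_mul hEa.differentiableAt.hasDerivAt
        simpa using this
      have hWs : HasStrictDerivAt (fun T => T * E T) (E 0) 0 := by
        have := hWa.hasStrictDerivAt
        rwa [hWd.deriv] at this
      have hlin : ∀ᶠ T in 𝓝 (0:ℝ), hWs.localInverse _ _ _ (hEpos 0).ne' (T * E T) = T :=
        HasStrictFDerivAt.eventually_left_inverse _
      set g := hWs.localInverse _ _ _ (hEpos 0).ne' with hg
      have hFa : AnalyticAt ℝ (fun p : ℝ × ℝ => p.1 * E p.1 - p.2) 0 := by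
        refine AnalyticAt.sub ?_ analyticAt_snd
        exact AnalyticAt.comp (g := fun T => T * E T) (f := fun p : ℝ × ℝ => p.1) (x := (0 : ℝ × ℝ))
          hWa analyticAt_fst
      obtain ⟨s, s1, s2, s3⟩ := implicit_line hFa (by simp) (by
        rw [DD_succ]
        simp only [DD, iteratedDeriv_zero, Prod.fst_zero, Prod.snd_zero, sub_zero]
        rw [hWd.deriv]; exact (hEpos 0).ne')
      refine ⟨k, Nat.pos_of_ne_zero hk, fun y => ξ (s y), ?_, by simp [s2, hξ0], ?_⟩
      · exact AnalyticAt.comp (g := ξ) (f := s) (x := (0:ℝ)) (by rw [s2]; exact hξ) s1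
      have hts : Tendsto s (𝓝 0) (𝓝 0) := by
        have := s1.continuousAt.tendsto; rwa [s2] at this
      obtain ⟨ρ, hρ, hb⟩ := Metric.eventually_nhds_iff_ball.1
        ((h.and (he.continuousAt.eventually_const_lt hpos)).and (hlin.and (s3.and (hts.eventually hlin))))
      refine ⟨ρ, hρ, fun T hT hTρ y hy hyT => ?_⟩
      obtain ⟨⟨h1, h2⟩, h3, -, -⟩ := hb T (by
        rw [mem_ball_zero_iff, Real.norm_eq_abs, abs_of_nonneg hT]; exact hTρ)
      obtain ⟨-, -, h4, h5⟩ := hb y (by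
        rw [mem_ball_zero_iff, Real.norm_eq_abs, abs_of_pos hy.1]; exact hy.2)
      have hTy : T * E T = y := by
        rw [h1, ← hEk T h2, ← mul_pow] at hyT
        exact (pow_left_inj₀ (mul_nonneg hT (hEpos T).le) hy.1.le hk).1 hyT
      rw [hTy] at h3
      have h6 : s y * E (s y) = y := by linarith
      rw [h6] at h5
      rw [← h3, h5]

lemma puiseux_param {r₀ : ℝ} (hr₀ : 0 < r₀) {C : Set (ℝ × ℝ)} (hC : IsPuiseuxBdryCurve r₀ C) :
    ∃ (N : ℕ) (γ₁ γ₂ : ℝ → ℝ), 0 < N ∧ AnalyticAt ℝ γ₁ 0 ∧ AnalyticAt ℝ γ₂ 0 ∧ γ₁ 0 = 0 ∧ γ₂ 0 = 0 ∧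
      ∀ p ∈ C, ∃ T, 0 ≤ T ∧ T ^ N ≤ ‖p‖ ∧ p = (γ₁ T, γ₂ T) := by
  obtain ⟨N, h, I, σ, hN, hσ, hI, hsub, han, h0, hCe, -, -⟩ := hC
  have hN' : (0:ℝ) < N := by exact_mod_cast hN
  have hh : AnalyticAt ℝ h 0 := han 0 (hsub ⟨le_rfl, (rpow_pos_of_pos hr₀ _).le⟩)
  have hpow : AnalyticAt ℝ (fun T : ℝ => σ * T ^ N) 0 := analyticAt_const.mul (analyticAt_id.pow N)
  have hroot : ∀ x : ℝ, (|x| ^ ((N:ℝ)⁻¹)) ^ N = |x| := fun x =>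
    Real.rpow_inv_natCast_pow (abs_nonneg x) hN.ne'
  have hsx : ∀ x : ℝ, 0 ≤ σ * x → σ * |x| = x := by
    intro x hx
    rcases hσ with rfl | rfl
    · rw [one_mul] at hx ⊢; exact abs_of_nonneg hx
    · have : x ≤ 0 := by linarith
      rw [abs_of_nonpos this]; ring
  rcases hCe with rfl | rfl
  · refine ⟨N, fun T => σ * T ^ N, h, hN, hpow, hh, by simp [hN.ne'], h0, ?_⟩
    rintro p ⟨-, h1, h2⟩
    refine ⟨|p.1| ^ ((N:ℝ)⁻¹), rpow_nonneg (abs_nonneg _) _, ?_, ?_⟩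
    · rw [hroot]; exact norm_fst_le p
    · ext
      · simp only [hroot, hsx _ h1]
      · exact h2
  · refine ⟨N, h, fun T => σ * T ^ N, hN, hh, hpow, h0, by simp [hN.ne'], ?_⟩
    rintro p ⟨-, h1, h2⟩
    refine ⟨|p.2| ^ ((N:ℝ)⁻¹), rpow_nonneg (abs_nonneg _) _, ?_, ?_⟩
    · rw [hroot]; exact norm_snd_le p
    · ext
      · exact h2
      · simp only [hroot, hsx _ h1]

lemma curve_graph {v : ℝ × ℝ} (hv : nrm2 v = 1) {r₀ : ℝ} (hr₀ : 0 < r₀) {C : Set (ℝ × ℝ)}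
    (hC : IsPuiseuxBdryCurve r₀ C) :
    ∃ k > 0, ∃ c : ℝ → ℝ, AnalyticAt ℝ c 0 ∧ c 0 = 0 ∧ ∃ ρ > 0,
      ∀ x, |x| < ρ → ∀ y ∈ Ioo 0 ρ, Lmap v (x, y ^ k) ∈ C → x = c y := by
  obtain ⟨N, γ₁, γ₂, hN, a1, a2, z1, z2, hp⟩ := puiseux_param hr₀ hC
  obtain ⟨k, hk, c, hc, hc0, ρ, hρ, H⟩ := curve1D
    (ξ := fun T => γ₁ T * v.2 + γ₂ T * (-v.1)) (η := fun T => γ₁ T * v.1 + γ₂ T * v.2)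
    ((a1.mul analyticAt_const).add (a2.mul analyticAt_const))
    ((a1.mul analyticAt_const).add (a2.mul analyticAt_const)) (by simp [z1, z2]) (by simp [z1, z2])
  refine ⟨k, hk, c, hc, hc0, min (min 1 ρ) (ρ ^ N / 2), by positivity, fun x hx y hy hL => ?_⟩
  obtain ⟨T, hT, hTN, hTe⟩ := hp _ hL
  have hy1 : y ≤ 1 := hy.2.le.trans ((min_le_left _ _).trans (min_le_left _ _))
  have hyk : y ^ k ≤ y := by
    calc y ^ k ≤ y ^ 1 := pow_le_pow_of_le_one hy.1.le hy1 hk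
      _ = y := pow_one y
  have h1 := Lmap_norm hv (x, y ^ k)
  simp only [abs_of_pos (pow_pos hy.1 k)] at h1
  have h2 : |x| < ρ ^ N / 2 := hx.trans_le (min_le_right _ _)
  have h3 : y < ρ ^ N / 2 := hy.2.trans_le (min_le_right _ _)
  have hTρ : T < ρ := lt_of_pow_lt_pow_left₀ N hρ.le (by linarith)
  have e1 := dot_Lmap hv (x, y ^ k)
  have e2 := dot_perp_Lmap hv (x, y ^ k)
  rw [hTe] at e1 e2
  simp only [dot2, perp2] at e1 e2
  rw [← e2]
  exact H T hT hTρ y ⟨hy.1, hy.2.trans_le ((min_le_left _ _).trans (min_le_right _ _))⟩ e1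

lemma std_frontier {E : Set (ℝ × ℝ)} (hE : IsStdDomain E) :
    IsOpen E ∧ ∃ r₀ > (0:ℝ), ∃ (m : ℕ) (C : Fin m × Fin 2 → Set (ℝ × ℝ)),
      (∀ j, IsPuiseuxBdryCurve r₀ (C j)) ∧ frontier E ⊆ (⋃ j, C j) ∪ circle2 r₀ := by
  rcases hE with ⟨r₀, hr₀, rfl⟩ | ⟨r₀, hr₀, m, Es, Cs, rfl, -, h1, h2, -⟩
  · have hc : Continuous fun p : ℝ × ℝ => p.1 ^ 2 + p.2 ^ 2 := by fun_prop
    refine ⟨isOpen_lt hc continuous_const, r₀, hr₀, 0, fun _ => ∅, fun j => j.1.elim0, ?_⟩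
    exact (frontier_lt_subset_eq hc continuous_const).trans subset_union_right
  · refine ⟨isOpen_iUnion fun i => (h1 i).1, r₀, hr₀, m, fun j => Cs j.1 j.2, fun j => h2 _ _, ?_⟩
    intro p hp
    rw [frontier, (isOpen_iUnion fun i => (h1 i).1).interior_eq, closure_iUnion_of_finite] at hp
    obtain ⟨hp1, hp2⟩ := hp
    obtain ⟨i, hi⟩ := mem_iUnion.1 hp1
    have : p ∈ frontier (Es i) := by
      rw [frontier, (h1 i).1.interior_eq]
      exact ⟨hi, fun h => hp2 (mem_iUnion.2 ⟨i, h⟩)⟩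
    rcases (h1 i).2.2.2 this with (h | h) | h
    · exact Or.inl (mem_iUnion.2 ⟨(i, 0), h⟩)
    · exact Or.inl (mem_iUnion.2 ⟨(i, 1), h⟩)
    · exact Or.inr h

lemma exists_order {F : ℝ × ℝ → ℝ} (hF : AnalyticAt ℝ F 0) (h : ¬ ∀ᶠ x in 𝓝 (0:ℝ), F (x, 0) = 0) :
    ∃ m : ℕ, (∀ k < m, DD k F 0 = 0) ∧ DD m F 0 ≠ 0 := by
  have hs : AnalyticAt ℝ (fun x => F (x, 0)) 0 := analyticAt_slice (x := 0) (t := 0) hF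
  have hne : analyticOrderAt (fun x => F (x, 0)) 0 ≠ ⊤ := by
    rw [Ne, analyticOrderAt_eq_top]; exact h
  obtain ⟨m, hm⟩ := ENat.ne_top_iff_exists.1 hne
  refine ⟨m, ?_⟩
  have := (analyticOrderAt_eq_nat_iff_iteratedDeriv_eq_zero hs).1 hm.symm
  simpa only [DD, Prod.fst_zero, Prod.snd_zero] using this

lemma main_cells' {ι : Type} [Fintype ι] (f : ι → ℝ × ℝ → ℝ) (hf : ∀ i, AnalyticAt ℝ (f i) 0)
    (h : ∀ i, ¬ ∀ᶠ x in 𝓝 (0:ℝ), f i (x, 0) = 0) :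
    ∀ᶠ r in 𝓝[>] (0:ℝ), ∃ τ > 0, HasCells f (fun _ => -r) (fun _ => r) τ := by
  choose m hm using fun i => exists_order (hf i) (h i)
  exact main_cells _ f m hf hm rfl

def baseF {n : ℕ} (v : ℝ × ℝ) (f : Fin n → ℝ × ℝ → ℝ) : Option (Fin n) → ℝ × ℝ → ℝ
  | none => fun p => p.1
  | some i => fun p => f i (Lmap v p)

lemma Lmap_inv {v : ℝ × ℝ} (hv : nrm2 v = 1) (p : ℝ × ℝ) :
    Lmap v (dot2 p (perp2 v), dot2 p v) = p := by
  have := unit_sq hv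
  ext
  · simp only [Lmap, dot2, perp2]; linear_combination p.1 * this
  · simp only [Lmap, dot2, perp2]; linear_combination p.2 * this

lemma Lmap_analytic (v p : ℝ × ℝ) : AnalyticAt ℝ (Lmap v) p := by
  unfold Lmap
  exact ((analyticAt_snd.mul analyticAt_const).add (analyticAt_fst.mul analyticAt_const)).prod
    ((analyticAt_snd.mul analyticAt_const).sub (analyticAt_fst.mul analyticAt_const))

lemma Lmap_zero (v : ℝ × ℝ) : Lmap v 0 = 0 := by
  ext <;> simp [Lmap]

theorem half_cells {n : ℕ} {f : Fin n → ℝ × ℝ → ℝ} {γ : Fin n → ℝ} {E : Set (ℝ × ℝ)}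
    (hsf : StandardForm n f γ E) {v : ℝ × ℝ} (hv : nrm2 v = 1) {R : ℝ} (hR : 0 < R) :
    ∃ r > 0, ∃ τ > 0, r ≤ R ∧ τ ≤ R ∧ ∃ (ι : Type) (F : ι → ℝ × ℝ → ℝ),
      HasCells (Sum.elim (baseF v f) F) (fun _ => -r) (fun _ => r) τ ∧
      ∀ x ∈ Ioo (-r) r, ∀ t ∈ Ioo 0 τ, (∀ j, F j (x, t) ≠ 0) → Lmap v (x, t) ∉ frontier E := by
  obtain ⟨U, hU, hfU⟩ := hsf.analytic
  obtain ⟨hEo, r₀, hr₀, m, C, hC, hfr⟩ := std_frontier hsf.domain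
  have hfa : ∀ i, AnalyticAt ℝ (fun p => f i (Lmap v p)) 0 := by
    intro i
    refine AnalyticAt.comp (g := f i) (f := Lmap v) (x := (0 : ℝ × ℝ)) ?_ (Lmap_analytic v 0)
    rw [Lmap_zero]
    exact hfU i 0 (mem_of_mem_nhds hU)
  have hfn : ∀ i, ¬ ∀ᶠ p in 𝓝 (0 : ℝ × ℝ), f i (Lmap v p) = 0 := by
    intro i h
    apply hsf.nontriv i
    have ht : Tendsto (fun p : ℝ × ℝ => ((dot2 p (perp2 v), dot2 p v) : ℝ × ℝ)) (𝓝 0) (𝓝 0) := by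
      have hc : Continuous (fun p : ℝ × ℝ => ((dot2 p (perp2 v), dot2 p v) : ℝ × ℝ)) := by
        unfold dot2; fun_prop
      have := hc.tendsto 0
      rwa [show ((dot2 0 (perp2 v), dot2 0 v) : ℝ × ℝ) = 0 by ext <;> simp [dot2]] at this
    filter_upwards [ht.eventually h] with p hp
    rwa [Lmap_inv hv] at hp
  choose k f' hf'a hf'e hf'n using fun i => factor_snd (hfa i) (hfn i)
  choose kk hkk c hc hc0 ρ hρ hcurve using fun j => curve_graph hv hr₀ (hC j)
  let N : ℕ := ∏ j, kk j
  have hN : 0 < N := Finset.prod_pos fun j _ => hkk j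
  let l : Fin m × Fin 2 → ℕ := fun j => N / kk j
  have hl : ∀ j, l j * kk j = N := fun j =>
    Nat.div_mul_cancel (Finset.dvd_prod_of_mem kk (Finset.mem_univ j))
  have hl0 : ∀ j, 0 < l j := by
    intro j
    rcases Nat.eq_zero_or_pos (l j) with h | h
    · have := hl j; rw [h, zero_mul] at this; omega
    · exact h
  let G : Option (Fin n) ⊕ (Fin m × Fin 2) → ℝ × ℝ → ℝ :=
    Sum.elim (fun o => Option.elim o (fun p => p.1) (fun i p => f' i (p.1, p.2 ^ N)))
      (fun j p => p.1 - c j (p.2 ^ l j))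
  have hid : ¬ ∀ᶠ x in 𝓝 (0:ℝ), x = 0 := by
    intro h
    obtain ⟨ε, hε, hb⟩ := Metric.eventually_nhds_iff_ball.1 h
    have := hb (ε / 2) (by rw [mem_ball_zero_iff, Real.norm_eq_abs, abs_of_pos (by positivity)]; linarith)
    linarith
  have hG : ∀ i, AnalyticAt ℝ (G i) 0 := by
    rintro ((_ | i) | j)
    · exact analyticAt_fst
    · refine AnalyticAt.comp (g := f' i) (f := fun p : ℝ × ℝ => ((p.1, p.2 ^ N) : ℝ × ℝ))
        (x := (0 : ℝ × ℝ)) ?_ (analyticAt_fst.prod (analyticAt_snd.pow N))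
      simp only [Prod.fst_zero, Prod.snd_zero, zero_pow hN.ne']
      exact hf'a i
    · refine AnalyticAt.sub analyticAt_fst ?_
      refine AnalyticAt.comp (g := c j) (f := fun p : ℝ × ℝ => p.2 ^ l j)
        (x := (0 : ℝ × ℝ)) ?_ (analyticAt_snd.pow _)
      simp only [Prod.snd_zero, zero_pow (hl0 j).ne']
      exact hc j
  have hGn : ∀ i, ¬ ∀ᶠ x in 𝓝 (0:ℝ), G i (x, 0) = 0 := by
    rintro ((_ | i) | j)
    · exact hid
    · simp only [G, Sum.elim_inl, Option.elim_some, zero_pow hN.ne']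
      exact hf'n i
    · simp only [G, Sum.elim_inr, zero_pow (hl0 j).ne', hc0, sub_zero]
      exact hid
  have hcells := main_cells' G hG hGn
  obtain ⟨ρ1, hρ1, hb1⟩ := prod_nhds_box (Filter.eventually_all.2 hf'e)
  obtain ⟨ρ2, hρ2, hb2⟩ : ∃ ρ2 > 0, ∀ j, ρ2 ≤ ρ j := by
    have : ∀ᶠ s in 𝓝[>] (0:ℝ), ∀ j, s ≤ ρ j := by
      refine Filter.eventually_all.2 fun j => ?_
      filter_upwards [Ioo_mem_nhdsGT (hρ j)] with s hs using hs.2.le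
    obtain ⟨s, h1, h2⟩ := (this.and self_mem_nhdsWithin).exists
    exact ⟨s, h2, h1⟩
  set ρ₀ := min (min 1 (r₀ / 2)) (min ρ1 (min ρ2 R)) with hρ₀
  have hρ₀p : 0 < ρ₀ := by positivity
  have b1 : ρ₀ ≤ 1 := (min_le_left _ _).trans (min_le_left _ _)
  have b2 : ρ₀ ≤ r₀ / 2 := (min_le_left _ _).trans (min_le_right _ _)
  have b3 : ρ₀ ≤ ρ1 := (min_le_right _ _).trans (min_le_left _ _)
  have b4 : ρ₀ ≤ ρ2 := (min_le_right _ _).trans ((min_le_right _ _).trans (min_le_left _ _))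
  have b5 : ρ₀ ≤ R := (min_le_right _ _).trans ((min_le_right _ _).trans (min_le_right _ _))
  obtain ⟨r, ⟨τ0, hτ0, cG⟩, hr⟩ := (hcells.and (Ioo_mem_nhdsGT hρ₀p)).exists
  set τ := min τ0 ρ₀ with hτdef
  have hτ : 0 < τ := by positivity
  have hτρ : τ ≤ ρ₀ := min_le_right _ _
  have hroot : ∀ y : ℝ, 0 < y → (y ^ N) ^ ((N:ℝ)⁻¹) = y := fun y hy =>
    pow_rpow_inv_natCast hy.le hN.ne'
  have hτN : τ ^ N ≤ τ := by
    calc τ ^ N ≤ τ ^ 1 := pow_le_pow_of_le_one hτ.le (hτρ.trans b1) hN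
      _ = τ := pow_one τ
  refine ⟨r, hr.1, τ ^ N, by positivity, hr.2.le.trans b5, hτN.trans (hτρ.trans b5), Fin m × Fin 2,
    fun j p => p.1 - c j ((p.2 ^ ((N:ℝ)⁻¹)) ^ l j), ?_, ?_⟩
  · refine HasCells.root hN hτ ?_
    refine HasCells.affine (q := fun _ => 0) (s := fun _ => 1)
      (e := Sum.elim (fun o => Option.elim o (fun _ => 1) (fun i t => t ^ (N * k i))) (fun j _ => 1))
      (Ce := Sum.elim (fun o => Option.elim o 0 (fun i => ((N * k i : ℕ) : ℝ) * 1)) (fun j => 0))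
      (cG.mono (min_le_left _ _)) continuousOn_const (LL.const τ one_ne_zero) ?_ ?_ ?_
    · rintro ((_ | i) | j)
      · exact LL.const τ one_ne_zero
      · exact (LL.id τ).pow (N * k i)
      · exact LL.const τ one_ne_zero
    · intro t ht; simp
    · rintro ((_ | i) | j) t ht z hz
      · simp [baseF, G]
      · simp only [zero_add, one_mul, Sum.elim_inl, Option.elim_some, baseF, G]
        have ht1 : t ≤ 1 := ht.2.le.trans (hτρ.trans b1)
        have htN : t ^ N ≤ t := by
          calc t ^ N ≤ t ^ 1 := pow_le_pow_of_le_one ht.1.le ht1 hN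
            _ = t := pow_one t
        rw [hb1 z (t ^ N) ((abs_lt.2 hz).trans (hr.2.trans_le b3))
          (by rw [abs_of_pos (pow_pos ht.1 N)]
              exact htN.trans_lt (ht.2.trans_le (hτρ.trans b3))) i, pow_mul]
      · simp only [zero_add, one_mul, Sum.elim_inr, G]
        rw [hroot t ht.1]
  · intro x hx t ht hF hL
    have hxr : |x| < ρ₀ := (abs_lt.2 hx).trans hr.2
    set y := t ^ ((N:ℝ)⁻¹) with hy
    have hy0 : 0 < y := rpow_pos_of_pos ht.1 _
    have hyN : y ^ N = t := Real.rpow_inv_natCast_pow ht.1.le hN.ne'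
    have hyτ : y < τ := by
      refine lt_of_pow_lt_pow_left₀ N hτ.le ?_
      rw [hyN]; exact ht.2
    have hy1 : y ≤ 1 := hyτ.le.trans (hτρ.trans b1)
    have hpw : ∀ a : ℕ, 0 < a → y ^ a ≤ y := fun a ha => by
      calc y ^ a ≤ y ^ 1 := pow_le_pow_of_le_one hy0.le hy1 ha
        _ = y := pow_one y
    rcases hfr hL with h | h
    · obtain ⟨j, hj⟩ := mem_iUnion.1 h
      apply hF j
      simp only
      rw [sub_eq_zero]
      refine hcurve j x (hxr.trans_le (b4.trans (hb2 j))) _ ⟨pow_pos hy0 _, ?_⟩ ?_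
      · exact (hpw _ (hl0 j)).trans_lt (hyτ.trans_le (hτρ.trans (b4.trans (hb2 j))))
      · rw [← pow_mul, hl, hyN]; exact hj
    · have h1 : (Lmap v (x, t)).1 ^ 2 + (Lmap v (x, t)).2 ^ 2 = r₀ ^ 2 := h
      rw [Lmap_sq hv] at h1
      simp only at h1
      have h2 : x ^ 2 < (r₀ / 2) ^ 2 := by
        rw [← sq_abs]; exact pow_lt_pow_left₀ (hxr.trans_le b2) (abs_nonneg _) two_ne_zero
      have h3 : t < r₀ / 2 := by
        have := hpw N hN; rw [hyN] at this
        linarith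
      have h4 : t ^ 2 < (r₀ / 2) ^ 2 := pow_lt_pow_left₀ h3 ht.1.le two_ne_zero
      nlinarith

lemma norm_exp_I (s t : ℝ) : ‖Complex.exp (Complex.I * ((s:ℂ) * (t:ℂ)))‖ = 1 := by
  rw [mul_comm, ← Complex.ofReal_mul]; exact Complex.norm_exp_ofReal_mul_I _

lemma hasDerivAt_exp_I (s t : ℝ) : HasDerivAt (fun t : ℝ => Complex.exp (Complex.I * ((s:ℂ) * (t:ℂ))))
    (Complex.exp (Complex.I * ((s:ℂ) * (t:ℂ))) * (Complex.I * s)) t := by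
  have h := ((Complex.ofRealCLM.hasDerivAt (x := t)).const_mul (s:ℂ)).const_mul Complex.I
  have := h.cexp
  simpa using this

lemma osc_ibp {b τ' s : ℝ} (hb : 0 < b) (hbτ : b < τ') (hs : s ≠ 0) {D D' : ℝ → ℂ} {K : ℝ → ℝ}
    (hD : ∀ t ∈ Icc b τ', HasDerivAt D (D' t) t) (h0 : D b = 0) (h1 : D τ' = 0)
    (hK : IntegrableOn K (Ioo b τ')) (hDK : ∀ t ∈ Ioo b τ', ‖D' t‖ ≤ K t) :
    ‖∫ t in Ioo b τ', D t * Complex.exp (Complex.I * ((s:ℂ) * (t:ℂ)))‖ ≤ |s|⁻¹ * ∫ t in Ioo b τ', K t := by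
  set e : ℝ → ℂ := fun t => Complex.exp (Complex.I * ((s:ℂ) * (t:ℂ))) with he
  have hec : Continuous e := by rw [he]; fun_prop
  have hDc : ContinuousOn D (Icc b τ') := fun t ht => (hD t ht).continuousAt.continuousWithinAt
  have hmeasD' : AEStronglyMeasurable D' (volume.restrict (Ioo b τ')) := by
    have h := (stronglyMeasurable_deriv D).aestronglyMeasurable (μ := volume.restrict (Ioo b τ'))
    refine h.congr ?_
    filter_upwards [ae_restrict_mem measurableSet_Ioo] with t ht
    exact (hD t (Ioo_subset_Icc_self ht)).deriv
  have hD'i : IntegrableOn D' (Ioo b τ') := by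
    refine Integrable.mono' hK hmeasD' ?_
    filter_upwards [ae_restrict_mem measurableSet_Ioo] with t ht using hDK t ht
  have hD'e : IntegrableOn (fun t => D' t * e t) (Ioo b τ') := by
    refine Integrable.mono' hK (hmeasD'.mul hec.aestronglyMeasurable) ?_
    filter_upwards [ae_restrict_mem measurableSet_Ioo] with t ht
    rw [norm_mul, he, norm_exp_I, mul_one]; exact hDK t ht
  have hDe : IntegrableOn (fun t => D t * e t) (Ioo b τ') := by
    have : ContinuousOn (fun t => D t * e t) (Icc b τ') := hDc.mul hec.continuousOn
    exact (this.integrableOn_Icc).mono_set Ioo_subset_Icc_self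
  have hF : ∀ t ∈ Set.uIcc b τ', HasDerivAt (fun t => D t * e t)
      (D' t * e t + Complex.I * s * (D t * e t)) t := by
    intro t ht
    rw [Set.uIcc_of_le hbτ.le] at ht
    have := (hD t ht).fun_mul (hasDerivAt_exp_I s t)
    exact this.congr_deriv (by simp only [he]; ring)
  have hsum : IntegrableOn (fun t => D' t * e t + Complex.I * s * (D t * e t)) (Ioo b τ') :=
    hD'e.add (hDe.const_mul _)
  have hFTC := intervalIntegral.integral_eq_sub_of_hasDerivAt hF (by
    rw [intervalIntegrable_iff_integrableOn_Ioo_of_le hbτ.le]; exact hsum)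
  rw [intervalIntegral.integral_of_le hbτ.le, ← integral_Ioc_eq_integral_Ioo.symm] at hFTC
  rw [h0, h1, zero_mul, zero_mul, sub_zero] at hFTC
  have h2 : (∫ t in Ioo b τ', D' t * e t) + Complex.I * s * ∫ t in Ioo b τ', D t * e t = 0 := by
    rw [← MeasureTheory.integral_const_mul, ← integral_add hD'e (hDe.const_mul _), ← hFTC]
  have h3 : ‖Complex.I * s * ∫ t in Ioo b τ', D t * e t‖ ≤ ∫ t in Ioo b τ', K t := by
    rw [← neg_eq_of_add_eq_zero_right h2, norm_neg]
    refine norm_integral_le_of_norm_le hK ?_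
    filter_upwards [ae_restrict_mem measurableSet_Ioo] with t ht
    rw [norm_mul, he, norm_exp_I, mul_one]; exact hDK t ht
  rw [norm_mul, norm_mul, Complex.norm_I, one_mul, Complex.norm_real, Real.norm_eq_abs] at h3
  rw [inv_mul_eq_div, le_div_iff₀ (abs_pos.2 hs), mul_comm]
  exact h3

lemma osc1D {τ s C1 : ℝ} (hs : s ≠ 0) (hC1 : 0 ≤ C1) {A : ℝ → ℂ} {B : ℝ → ℝ}
    (hB0 : ∀ t ∈ Ioo 0 τ, 0 ≤ B t) (hBi : IntegrableOn B (Ioo 0 τ))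
    (hA : ∀ t ∈ Ioo 0 τ, DifferentiableAt ℝ A t ∧ ‖A t‖ ≤ C1 * B t ∧ ‖t • deriv A t‖ ≤ C1 * B t)
    {τ' : ℝ} (hτ'0 : 0 < τ') (hτ' : τ' < τ) (hsupp : ∀ t ∈ Ioo 0 τ, τ' ≤ t → A t = 0) :
    ‖∫ t in Ioo 0 τ, A t * Complex.exp (Complex.I * ((s:ℂ) * (t:ℂ)))‖
      ≤ 3 * C1 * ∫ t in Ioo 0 τ, B t * min 1 (1 / (|s| * t)) := by
  have hs0 : 0 < |s| := abs_pos.2 hs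
  set e : ℝ → ℂ := fun t => Complex.exp (Complex.I * ((s:ℂ) * (t:ℂ))) with he
  have hec : Continuous e := by rw [he]; fun_prop
  have hAc : ContinuousOn A (Ioo 0 τ) := fun t ht => (hA t ht).1.continuousAt.continuousWithinAt
  have hmin : ∀ t ∈ Ioo 0 τ, 0 ≤ min 1 (1 / (|s| * t)) := fun t ht =>
    le_min zero_le_one (by have := ht.1; positivity)
  have hBm : IntegrableOn (fun t => B t * min 1 (1 / (|s| * t))) (Ioo 0 τ) := by
    refine Integrable.mono' hBi (hBi.aestronglyMeasurable.mul ?_) ?_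
    · exact (Measurable.aestronglyMeasurable (by fun_prop))
    · filter_upwards [ae_restrict_mem measurableSet_Ioo] with t ht
      rw [Real.norm_eq_abs, abs_of_nonneg (mul_nonneg (hB0 t ht) (hmin t ht))]
      exact mul_le_of_le_one_right (hB0 t ht) (min_le_left _ _)
  have hI0 : 0 ≤ ∫ t in Ioo 0 τ, B t * min 1 (1 / (|s| * t)) :=
    setIntegral_nonneg measurableSet_Ioo fun t ht => mul_nonneg (hB0 t ht) (hmin t ht)
  have hne : ∀ t, ‖e t‖ = 1 := fun t => norm_exp_I s t
  by_cases hb : τ' ≤ 1 / |s|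
  · have : ‖∫ t in Ioo 0 τ, A t * e t‖ ≤ ∫ t in Ioo 0 τ, C1 * (B t * min 1 (1 / (|s| * t))) := by
      refine norm_integral_le_of_norm_le (hBm.const_mul C1) ?_
      filter_upwards [ae_restrict_mem measurableSet_Ioo] with t ht
      rw [norm_mul, hne, mul_one]
      by_cases h : τ' ≤ t
      · rw [hsupp t ht h, norm_zero]
        exact mul_nonneg hC1 (mul_nonneg (hB0 t ht) (hmin t ht))
      · rw [min_eq_left, mul_one]
        · exact (hA t ht).2.1
        · rw [le_div_iff₀ (mul_pos hs0 ht.1), one_mul]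
          have : t < 1 / |s| := by linarith
          rw [lt_div_iff₀ hs0] at this
          nlinarith
    rw [MeasureTheory.integral_const_mul] at this
    nlinarith [mul_nonneg hC1 hI0]
  · push Not at hb
    set b := 1 / |s| with hbdef
    have hb0 : 0 < b := by positivity
    have hbs : ∀ t, 1 / (|s| * t) = b / t := fun t => by rw [hbdef, div_div]
    have hsub : Ioo b τ' ⊆ Ioo 0 τ := Ioo_subset_Ioo hb0.le hτ'.le
    have hsubc : Icc b τ' ⊆ Ioo 0 τ := fun t ht => ⟨hb0.trans_le ht.1, ht.2.trans_lt hτ'⟩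
    set D : ℝ → ℂ := fun t => ((1 - b / t : ℝ) : ℂ) * A t with hD
    set D' : ℝ → ℂ := fun t => ((b / t ^ 2 : ℝ) : ℂ) * A t + ((1 - b / t : ℝ) : ℂ) * deriv A t with hD'
    have hDd : ∀ t ∈ Ioo 0 τ, HasDerivAt D (D' t) t := by
      intro t ht
      have h1 : HasDerivAt (fun t : ℝ => 1 - b / t) (b / t ^ 2) t := by
        have := ((hasDerivAt_inv ht.1.ne').const_mul b).const_sub 1
        have e1 : (fun t : ℝ => 1 - b / t) = fun x => 1 - b * x⁻¹ := by
          funext x; rw [div_eq_mul_inv]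
        rw [e1]
        exact this.congr_deriv (by rw [div_eq_mul_inv]; ring)
      exact h1.ofReal_comp.fun_mul (hA t ht).1.hasDerivAt
    have hDb : ∀ t ∈ Ioo b τ', ‖D' t‖ ≤ 2 * C1 * (B t / t) := by
      intro t ht
      have ht' := hsub ht
      obtain ⟨-, a1, a2⟩ := hA t ht'
      have ht0 : 0 < t := ht'.1
      have hbt : b / t ≤ 1 := by rw [div_le_one ht0]; exact ht.1.le
      have hbt0 : 0 ≤ b / t := by positivity
      rw [norm_smul, Real.norm_eq_abs, abs_of_pos ht0] at a2
      have a3 : ‖deriv A t‖ ≤ C1 * B t / t := by rw [le_div_iff₀ ht0]; linarith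
      calc ‖D' t‖ ≤ ‖((b / t ^ 2 : ℝ) : ℂ) * A t‖ + ‖((1 - b / t : ℝ) : ℂ) * deriv A t‖ := norm_add_le _ _
        _ = b / t * ‖A t‖ / t + (1 - b / t) * ‖deriv A t‖ := by
          rw [norm_mul, norm_mul, Complex.norm_real, Complex.norm_real, Real.norm_eq_abs,
            Real.norm_eq_abs, abs_of_nonneg (by positivity), abs_of_nonneg (by linarith)]
          field_simp
        _ ≤ 1 * (C1 * B t) / t + 1 * (C1 * B t / t) := by
          gcongr
          linarith
        _ = 2 * C1 * (B t / t) := by ring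
    have hKi : IntegrableOn (fun t => 2 * C1 * (B t / t)) (Ioo b τ') := by
      refine Integrable.const_mul ?_ _
      refine Integrable.mono' ((hBi.mono_set hsub).const_mul b⁻¹) ?_ ?_
      · exact (hBi.mono_set hsub).aestronglyMeasurable.mul
          (Measurable.aestronglyMeasurable (f := fun t : ℝ => t⁻¹) (by fun_prop))
      · filter_upwards [ae_restrict_mem measurableSet_Ioo] with t ht
        have ht0 : 0 < t := (hsub ht).1
        rw [Real.norm_eq_abs, abs_of_nonneg (div_nonneg (hB0 t (hsub ht)) ht0.le), div_eq_inv_mul]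
        exact mul_le_mul_of_nonneg_right (inv_anti₀ hb0 ht.1.le) (hB0 t (hsub ht))
    have hibp := osc_ibp hb0 hb hs (fun t ht => hDd t (hsubc ht))
      (by simp [hD, hb0.ne']) (by simp [hD, hsupp τ' ⟨hτ'0, hτ'⟩ le_rfl]) hKi hDb
    have h2 : |s|⁻¹ * ∫ t in Ioo b τ', 2 * C1 * (B t / t)
        ≤ 2 * C1 * ∫ t in Ioo 0 τ, B t * min 1 (1 / (|s| * t)) := by
      rw [MeasureTheory.integral_const_mul, mul_left_comm, ← MeasureTheory.integral_const_mul]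
      refine mul_le_mul_of_nonneg_left ?_ (by positivity)
      calc ∫ t in Ioo b τ', |s|⁻¹ * (B t / t) = ∫ t in Ioo b τ', B t * min 1 (1 / (|s| * t)) := by
            refine setIntegral_congr_fun measurableSet_Ioo fun t ht => ?_
            have ht0 : 0 < t := (hsub ht).1
            rw [hbs, min_eq_right (by rw [div_le_one ht0]; exact ht.1.le), hbdef]
            field_simp
        _ ≤ _ := by
            refine setIntegral_mono_set hBm ?_ hsub.eventuallyLE
            filter_upwards [ae_restrict_mem measurableSet_Ioo] with t ht
            exact mul_nonneg (hB0 t ht) (hmin t ht)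
    -- splitting
    have hAe : IntegrableOn (fun t => A t * e t) (Ioo 0 τ) := by
      refine Integrable.mono' (hBi.const_mul C1)
        ((hAc.aestronglyMeasurable measurableSet_Ioo).mul hec.aestronglyMeasurable) ?_
      filter_upwards [ae_restrict_mem measurableSet_Ioo] with t ht
      rw [norm_mul, hne, mul_one]; exact (hA t ht).2.1
    have hDe : IntegrableOn (fun t => D t * e t) (Ioo b τ') := by
      have : ContinuousOn (fun t => D t * e t) (Icc b τ') := ContinuousOn.mul
        (fun t ht => (hDd t (hsubc ht)).continuousAt.continuousWithinAt) hec.continuousOn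
      exact (this.integrableOn_Icc).mono_set Ioo_subset_Icc_self
    have hDe' : IntegrableOn ((Ioo b τ').indicator (fun t => D t * e t)) (Ioo 0 τ) :=
      (hDe.integrable_indicator measurableSet_Ioo).integrableOn
    have hsplit : ∫ t in Ioo 0 τ, A t * e t =
        (∫ t in Ioo 0 τ, (A t * e t - (Ioo b τ').indicator (fun t => D t * e t) t))
          + ∫ t in Ioo b τ', D t * e t := by
      rw [integral_sub hAe hDe', setIntegral_indicator measurableSet_Ioo,
        inter_eq_right.2 hsub]
      ring
    have h1 : ‖∫ t in Ioo 0 τ, (A t * e t - (Ioo b τ').indicator (fun t => D t * e t) t)‖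
        ≤ ∫ t in Ioo 0 τ, C1 * (B t * min 1 (1 / (|s| * t))) := by
      refine norm_integral_le_of_norm_le (hBm.const_mul C1) ?_
      filter_upwards [ae_restrict_mem measurableSet_Ioo] with t ht
      have ht0 := ht.1
      by_cases hm : t ∈ Ioo b τ'
      · rw [indicator_of_mem hm, ← sub_mul, norm_mul, hne, mul_one]
        have : A t - D t = ((b / t : ℝ) : ℂ) * A t := by simp only [hD]; push_cast; ring
        rw [this, norm_mul, Complex.norm_real, Real.norm_eq_abs, abs_of_nonneg (by positivity), hbs,
          min_eq_right (by rw [div_le_one ht0]; exact hm.1.le)]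
        calc b / t * ‖A t‖ ≤ b / t * (C1 * B t) := by gcongr; exact (hA t ht).2.1
          _ = _ := by ring
      · rw [indicator_of_notMem hm, sub_zero, norm_mul, hne, mul_one]
        by_cases h : τ' ≤ t
        · rw [hsupp t ht h, norm_zero]
          exact mul_nonneg hC1 (mul_nonneg (hB0 t ht) (hmin t ht))
        · rw [hbs, min_eq_left, mul_one]
          · exact (hA t ht).2.1
          · rw [one_le_div ht0]
            by_contra hcon
            exact hm ⟨by linarith, by linarith⟩
    rw [MeasureTheory.integral_const_mul] at h1
    rw [hsplit]
    refine (norm_add_le _ _).trans ?_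
    linarith [hibp.trans h2]

lemma cov_measure {κ : Type} [Fintype κ] {ψ J : κ → ℝ → ℝ → ℝ} {r τ : ℝ}
    (h1 : ∀ k, ContinuousOn (fun p : ℝ × ℝ => ψ k p.1 p.2) (Ioo 0 1 ×ˢ Ioo 0 τ))
    (h2 : ∀ k, ContinuousOn (fun p : ℝ × ℝ => J k p.1 p.2) (Ioo 0 1 ×ˢ Ioo 0 τ))
    (h6 : ∀ t ∈ Ioo (0:ℝ) τ, ∀ F : ℝ → ℝ≥0∞, Measurable F →
      ∫⁻ x in Ioo (-r) r, F x
        = ∑ k, ∫⁻ u in Ioo (0:ℝ) 1, F (ψ k u t) * ENNReal.ofReal (J k u t)) :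
    (∀ k, AEMeasurable (fun q : ℝ × ℝ => (ψ k q.1 q.2, q.2))
        (volume.restrict (Ioo (0:ℝ) 1 ×ˢ Ioo 0 τ))) ∧
    (volume.restrict (Ioo (-r) r ×ˢ Ioo 0 τ) : Measure (ℝ × ℝ)) =
      ∑ k, ((volume.restrict (Ioo (0:ℝ) 1 ×ˢ Ioo 0 τ)).withDensity
        (fun q => ENNReal.ofReal (J k q.1 q.2))).map (fun q => (ψ k q.1 q.2, q.2)) := by
  have hQ : MeasurableSet (Ioo (0:ℝ) 1 ×ˢ Ioo (0:ℝ) τ) := measurableSet_Ioo.prod measurableSet_Ioo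
  have hΨ : ∀ k, AEMeasurable (fun q : ℝ × ℝ => (ψ k q.1 q.2, q.2))
        (volume.restrict (Ioo (0:ℝ) 1 ×ˢ Ioo 0 τ)) := fun k =>
    ((h1 k).aemeasurable hQ).prodMk measurable_snd.aemeasurable
  have hJ : ∀ k, AEMeasurable (fun q : ℝ × ℝ => ENNReal.ofReal (J k q.1 q.2))
        (volume.restrict (Ioo (0:ℝ) 1 ×ˢ Ioo 0 τ)) := fun k =>
    ((h2 k).aemeasurable hQ).ennreal_ofReal
  refine ⟨hΨ, ?_⟩
  refine Measure.ext_of_lintegral _ fun F hF => ?_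
  have hm : ∀ k, AEMeasurable (fun q : ℝ × ℝ => F (ψ k q.1 q.2, q.2) * ENNReal.ofReal (J k q.1 q.2))
      ((volume.restrict (Ioo (0:ℝ) 1)).prod (volume.restrict (Ioo (0:ℝ) τ))) := by
    intro k
    rw [Measure.prod_restrict]
    exact (hF.comp_aemeasurable (hΨ k)).mul (hJ k)
  rw [lintegral_finsetSum_measure]
  have hk : ∀ k, ∫⁻ a, F a ∂(((volume.restrict (Ioo (0:ℝ) 1 ×ˢ Ioo 0 τ)).withDensity
        (fun q => ENNReal.ofReal (J k q.1 q.2))).map (fun q => (ψ k q.1 q.2, q.2)))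
      = ∫⁻ t in Ioo 0 τ, ∫⁻ u in Ioo 0 1, F (ψ k u t, t) * ENNReal.ofReal (J k u t) := by
    intro k
    rw [lintegral_map' hF.aemeasurable ((hΨ k).mono_ac (withDensity_absolutelyContinuous _ _)),
      lintegral_withDensity_eq_lintegral_mul₀ (hJ k) (g := fun q : ℝ × ℝ => F (ψ k q.1 q.2, q.2))
        (hF.comp_aemeasurable (hΨ k)),
      ← lintegral_prod_symm _ (hm k), Measure.prod_restrict]
    refine lintegral_congr fun q => ?_
    simp only [Pi.mul_apply, mul_comm]
  simp_rw [hk]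
  rw [← lintegral_finsetSum' _ fun k _ => (hm k).lintegral_prod_left']
  rw [Measure.volume_eq_prod, ← Measure.prod_restrict, lintegral_prod_symm' _ hF]
  refine setLIntegral_congr_fun measurableSet_Ioo fun t ht => ?_
  exact h6 t ht (fun x => F (x, t)) (by fun_prop)

lemma cov_int {κ : Type} [Fintype κ] {ψ J : κ → ℝ → ℝ → ℝ} {r τ : ℝ}
    (h1 : ∀ k, ContinuousOn (fun p : ℝ × ℝ => ψ k p.1 p.2) (Ioo 0 1 ×ˢ Ioo 0 τ))
    (h2 : ∀ k, ContinuousOn (fun p : ℝ × ℝ => J k p.1 p.2) (Ioo 0 1 ×ˢ Ioo 0 τ))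
    (h3 : ∀ k, ∀ u ∈ Ioo (0:ℝ) 1, ∀ t ∈ Ioo (0:ℝ) τ, 0 < J k u t)
    (h6 : ∀ t ∈ Ioo (0:ℝ) τ, ∀ F : ℝ → ℝ≥0∞, Measurable F →
      ∫⁻ x in Ioo (-r) r, F x
        = ∑ k, ∫⁻ u in Ioo (0:ℝ) 1, F (ψ k u t) * ENNReal.ofReal (J k u t))
    {V : Type*} [NormedAddCommGroup V] [NormedSpace ℝ V] {G : ℝ × ℝ → V}
    (hG : IntegrableOn G (Ioo (-r) r ×ˢ Ioo 0 τ)) :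
    (∀ k, IntegrableOn (fun q : ℝ × ℝ => J k q.1 q.2 • G (ψ k q.1 q.2, q.2)) (Ioo 0 1 ×ˢ Ioo 0 τ)) ∧
    ∫ p in Ioo (-r) r ×ˢ Ioo 0 τ, G p
      = ∑ k, ∫ q in Ioo (0:ℝ) 1 ×ˢ Ioo 0 τ, J k q.1 q.2 • G (ψ k q.1 q.2, q.2) := by
  obtain ⟨hΨ, hcov⟩ := cov_measure h1 h2 h6
  have hQ : MeasurableSet (Ioo (0:ℝ) 1 ×ˢ Ioo (0:ℝ) τ) := measurableSet_Ioo.prod measurableSet_Ioo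
  have hJ : ∀ k, AEMeasurable (fun q : ℝ × ℝ => ENNReal.ofReal (J k q.1 q.2))
        (volume.restrict (Ioo (0:ℝ) 1 ×ˢ Ioo 0 τ)) := fun k =>
    ((h2 k).aemeasurable hQ).ennreal_ofReal
  have hΨ' := fun k => (hΨ k).mono_ac (withDensity_absolutelyContinuous _
    (fun q : ℝ × ℝ => ENNReal.ofReal (J k q.1 q.2)))
  have hlt : ∀ k, ∀ᵐ q ∂(volume.restrict (Ioo (0:ℝ) 1 ×ˢ Ioo (0:ℝ) τ) : Measure (ℝ × ℝ)),
    ENNReal.ofReal (J k q.1 q.2) < ⊤ := fun k => ae_of_all _ fun q => ENNReal.ofReal_lt_top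
  have hto : ∀ k, (fun q : ℝ × ℝ => (ENNReal.ofReal (J k q.1 q.2)).toReal • G (ψ k q.1 q.2, q.2))
      =ᵐ[volume.restrict (Ioo (0:ℝ) 1 ×ˢ Ioo (0:ℝ) τ)]
      fun q => J k q.1 q.2 • G (ψ k q.1 q.2, q.2) := by
    intro k
    filter_upwards [ae_restrict_mem hQ] with q hq
    rw [ENNReal.toReal_ofReal (h3 k _ hq.1 _ hq.2).le]
  have hG' := hG
  unfold IntegrableOn at hG'
  rw [hcov, integrable_finsetSum_measure] at hG'
  have hGk := fun k => hG' k (Finset.mem_univ k)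
  refine ⟨fun k => ?_, ?_⟩
  · have := (hGk k).comp_aemeasurable (hΨ' k)
    rw [integrable_withDensity_iff_integrable_smul₀' (hJ k) (hlt k)] at this
    exact this.congr (hto k)
  · rw [hcov, integral_finsetSum_measure fun k _ => hGk k]
    refine Finset.sum_congr rfl fun k _ => ?_
    rw [integral_map (hΨ' k) (hGk k).aestronglyMeasurable,
      integral_withDensity_eq_integral_toReal_smul₀ (hJ k) (hlt k)]
    exact integral_congr_ae (hto k)

lemma leaf_std {n : ℕ} {f : Fin n → ℝ × ℝ → ℝ} {γ : Fin n → ℝ} {E : Set (ℝ × ℝ)} {v : ℝ × ℝ}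
    {x : ℝ → ℝ} {τ C : ℝ} (hx : ContinuousOn x (Ioo 0 τ))
    (hf : ∀ i, LL τ C (fun t => f i (Lmap v (x t, t)))) (hE : IsOpen E)
    (hfr : ∀ t ∈ Ioo 0 τ, Lmap v (x t, t) ∉ frontier E) :
    (∀ t ∈ Ioo 0 τ, stdFun n f γ E (Lmap v (x t, t)) = 0) ∨
      LL τ (∑ i, |γ i| * C) (fun t => stdFun n f γ E (Lmap v (x t, t))) := by
  have hc : ContinuousOn (fun t => Lmap v (x t, t)) (Ioo 0 τ) := by
    have h0 : Continuous (Lmap v) := by unfold Lmap; fun_prop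
    exact h0.comp_continuousOn (hx.prodMk continuousOn_id)
  have hpre : IsPreconnected ((fun t => Lmap v (x t, t)) '' Ioo 0 τ) := isPreconnected_Ioo.image _ hc
  have hsub : ((fun t => Lmap v (x t, t)) '' Ioo 0 τ) ⊆ E ∪ (closure E)ᶜ := by
    rintro _ ⟨t, ht, rfl⟩
    by_cases h : Lmap v (x t, t) ∈ E
    · exact Or.inl h
    · right
      intro hcl
      apply hfr t ht
      rw [hE.frontier_eq]
      exact ⟨hcl, h⟩
  have hdis : Disjoint E (closure E)ᶜ := disjoint_compl_right.mono_left subset_closure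
  rcases hpre.subset_or_subset hE isClosed_closure.isOpen_compl hdis hsub with h | h
  · right
    have := LL.prod Finset.univ (fun i _ => (hf i).abs_rpow (γ i))
    refine this.congr fun t ht => ?_
    rw [stdFun, indicator_of_mem (h ⟨t, ht, rfl⟩)]
  · left
    intro t ht
    rw [stdFun, indicator_of_notMem]
    intro h'
    exact h ⟨t, ht, rfl⟩ (subset_closure h')

lemma stdFun_nonneg (n : ℕ) (f : Fin n → ℝ × ℝ → ℝ) (γ : Fin n → ℝ) (E : Set (ℝ × ℝ)) (p : ℝ × ℝ) :
    0 ≤ stdFun n f γ E p :=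
  indicator_nonneg (fun _ _ => Finset.prod_nonneg fun _ _ => rpow_nonneg (abs_nonneg _) _) _

lemma leaf_theta {v : ℝ × ℝ} (hv : nrm2 v = 1) {x : ℝ → ℝ} {τ C M : ℝ} (hC : 0 ≤ C) (hM : 0 ≤ M)
    (hx : LL τ C x) {Θ : ℝ × ℝ → ℝ} (hΘd : ∀ p, p ≠ 0 → DifferentiableAt ℝ Θ p)
    (hΘ' : ∀ p, p ≠ 0 → ‖fderiv ℝ Θ p‖ ≤ M * (nrm2 p)⁻¹) :
    ∀ t ∈ Ioo 0 τ, DifferentiableAt ℝ (fun t => Θ (Lmap v (x t, t))) t ∧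
      |t * deriv (fun t => Θ (Lmap v (x t, t))) t| ≤ M * (C + 1) := by
  intro t ht
  obtain ⟨-, hxd, hxb⟩ := hx t ht
  have hL : HasDerivAt (fun t => Lmap v (x t, t)) (Lmap v (deriv x t, 1)) t := by
    have a1 := ((hasDerivAt_id t).mul_const v.1).fun_add (hxd.hasDerivAt.mul_const v.2)
    have a2 := ((hasDerivAt_id t).mul_const v.2).fun_sub (hxd.hasDerivAt.mul_const v.1)
    exact a1.prodMk a2
  have hn : nrm2 (Lmap v (x t, t)) = nrm2 (x t, t) := by unfold nrm2; rw [Lmap_sq hv]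
  have h2 : t ≤ nrm2 (x t, t) := Real.le_sqrt_of_sq_le (by nlinarith [sq_nonneg (x t)])
  have h1 : |x t| ≤ nrm2 (x t, t) := Real.le_sqrt_of_sq_le (by rw [sq_abs]; nlinarith [sq_nonneg t])
  have hpos : 0 < nrm2 (x t, t) := ht.1.trans_le h2
  have hne : Lmap v (x t, t) ≠ 0 := by
    intro h
    rw [h] at hn
    simp [nrm2] at hn
    rw [nrm2] at hpos
    simp only at hpos
    linarith
  have hD := (hΘd _ hne).hasFDerivAt.comp_hasDerivAt t hL
  have hD' : HasDerivAt (fun t => Θ (Lmap v (x t, t))) _ t := hD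
  refine ⟨hD'.differentiableAt, ?_⟩
  rw [hD'.deriv, abs_mul, abs_of_pos ht.1, ← Real.norm_eq_abs]
  have hb := hΘ' _ hne
  rw [hn] at hb
  have hLn := Lmap_norm hv (deriv x t, 1)
  simp only [abs_one] at hLn
  rw [abs_mul, abs_of_pos ht.1] at hxb
  calc t * ‖(fderiv ℝ Θ (Lmap v (x t, t))) (Lmap v (deriv x t, 1))‖
      ≤ t * (‖fderiv ℝ Θ (Lmap v (x t, t))‖ * ‖Lmap v (deriv x t, 1)‖) :=
        mul_le_mul_of_nonneg_left (ContinuousLinearMap.le_opNorm _ _) ht.1.le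
    _ ≤ t * ((M * (nrm2 (x t, t))⁻¹) * (|deriv x t| + 1)) := by
        have := ht.1.le
        gcongr
    _ = M * (t * |deriv x t| + t) * (nrm2 (x t, t))⁻¹ := by ring
    _ ≤ M * (C * nrm2 (x t, t) + nrm2 (x t, t)) * (nrm2 (x t, t))⁻¹ := by
        have hh : t * |deriv x t| + t ≤ C * nrm2 (x t, t) + nrm2 (x t, t) := by
          linarith [hxb.trans (mul_le_mul_of_nonneg_left h1 hC)]
        exact mul_le_mul_of_nonneg_right (mul_le_mul_of_nonneg_left hh hM) (by positivity)
    _ = M * (C + 1) := by field_simp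

lemma leaf_amp {P D x : ℝ → ℝ} {τ CP C M M' r H w C1 : ℝ} (hCP : 0 ≤ CP) (hC : 0 ≤ C) (hM : 0 ≤ M)
    (hM' : 0 ≤ M') (hP : LL τ CP P) (hP0 : ∀ t ∈ Ioo 0 τ, 0 ≤ P t)
    (hD : ∀ t ∈ Ioo 0 τ, DifferentiableAt ℝ D t ∧ |D t| ≤ M ∧ |t * deriv D t| ≤ M')
    (hx : LL τ C x) (hxr : ∀ t ∈ Ioo 0 τ, |x t| ≤ r) (hr : 0 ≤ r) (hw : |w| ≤ H)
    (hC1 : M + CP * M + M' + M * (H * (C * r)) ≤ C1) :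
    ∀ t ∈ Ioo 0 τ, DifferentiableAt ℝ (fun t => ((P t * D t : ℝ) : ℂ) *
        Complex.exp (Complex.I * ((w:ℂ) * (x t : ℂ)))) t ∧
      ‖((P t * D t : ℝ) : ℂ) * Complex.exp (Complex.I * ((w:ℂ) * (x t : ℂ)))‖ ≤ C1 * P t ∧
      ‖t • deriv (fun t => ((P t * D t : ℝ) : ℂ) *
        Complex.exp (Complex.I * ((w:ℂ) * (x t : ℂ)))) t‖ ≤ C1 * P t := by
  intro t ht
  have ht0 := ht.1
  obtain ⟨-, p2, p3⟩ := hP t ht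
  obtain ⟨-, x2, x3⟩ := hx t ht
  obtain ⟨d1, d2, d3⟩ := hD t ht
  have hp := hP0 t ht
  have hH : 0 ≤ H := (abs_nonneg w).trans hw
  rw [abs_of_nonneg hp] at p3
  have hnn : 0 ≤ M * (H * (C * r)) := by positivity
  have hcm : 0 ≤ CP * M := by positivity
  have he : HasDerivAt (fun t => Complex.exp (Complex.I * ((w:ℂ) * (x t : ℂ))))
      (deriv x t • (Complex.exp (Complex.I * ((w:ℂ) * (x t:ℂ))) * (Complex.I * w))) t :=
    HasDerivAt.scomp t (hasDerivAt_exp_I w (x t)) x2.hasDerivAt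
  have hPD := ((p2.hasDerivAt.fun_mul d1.hasDerivAt).ofReal_comp).fun_mul he
  refine ⟨hPD.differentiableAt, ?_, ?_⟩
  · rw [norm_mul, norm_exp_I, mul_one, Complex.norm_real, Real.norm_eq_abs, abs_mul, abs_of_nonneg hp]
    calc P t * |D t| ≤ P t * M := by gcongr
      _ ≤ P t * C1 := by gcongr; linarith
      _ = _ := mul_comm _ _
  · rw [hPD.deriv]
    have e1 : t • (((deriv P t * D t + P t * deriv D t : ℝ) : ℂ) *
          Complex.exp (Complex.I * ((w:ℂ) * (x t:ℂ))) + ((P t * D t : ℝ) : ℂ) *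
          (deriv x t • (Complex.exp (Complex.I * ((w:ℂ) * (x t:ℂ))) * (Complex.I * w))))
        = (((t * deriv P t) * D t + P t * (t * deriv D t) : ℝ) : ℂ) *
          Complex.exp (Complex.I * ((w:ℂ) * (x t:ℂ))) + ((P t * D t * (w * (t * deriv x t)) : ℝ) : ℂ) *
          (Complex.exp (Complex.I * ((w:ℂ) * (x t:ℂ))) * Complex.I) := by
      simp only [Complex.real_smul]; push_cast; ring
    rw [e1]
    refine (norm_add_le _ _).trans ?_
    rw [norm_mul, norm_mul, norm_mul, norm_exp_I, Complex.norm_I, Complex.norm_real, Complex.norm_real,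
      Real.norm_eq_abs, Real.norm_eq_abs, mul_one, mul_one, mul_one]
    have a1 : |t * deriv P t * D t + P t * (t * deriv D t)| ≤ CP * P t * M + P t * M' := by
      refine (abs_add_le _ _).trans ?_
      rw [abs_mul, abs_mul (P t), abs_of_nonneg hp]
      gcongr
    have a2 : |P t * D t * (w * (t * deriv x t))| ≤ P t * M * (H * (C * r)) := by
      rw [abs_mul, abs_mul (P t), abs_mul w, abs_of_nonneg hp]
      have := x3.trans (mul_le_mul_of_nonneg_left (hxr t ht) hC)
      gcongr
    calc _ ≤ CP * P t * M + P t * M' + P t * M * (H * (C * r)) := add_le_add a1 a2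
      _ = P t * (CP * M + M' + M * (H * (C * r))) := by ring
      _ ≤ P t * C1 := by gcongr; linarith
      _ = _ := mul_comm _ _

theorem half_osc {n : ℕ} {f : Fin n → ℝ × ℝ → ℝ} {γ : Fin n → ℝ} {E : Set (ℝ × ℝ)}
    (hsf : StandardForm n f γ E) {v : ℝ × ℝ} (hv : nrm2 v = 1) {R : ℝ} (hR : 0 < R) (H : ℝ) :
    ∃ r > 0, ∃ τ > 0, r ≤ R ∧ τ ≤ R ∧
      (IntegrableOn (fun p => stdFun n f γ E (Lmap v p)) (Ioo (-r) r ×ˢ Ioo 0 τ) →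
      ∀ M, 0 ≤ M → ∃ K, 0 ≤ K ∧ ∀ Θ : ℝ × ℝ → ℝ, (∀ p, p ≠ 0 → DifferentiableAt ℝ Θ p) →
        (∀ p, p ≠ 0 → ‖fderiv ℝ Θ p‖ ≤ M * (nrm2 p)⁻¹) → (∀ p, |Θ p| ≤ M) →
        ∀ τ', 0 < τ' → τ' < τ → (∀ p, τ' ≤ nrm2 p → Θ p = 0) → ∀ s w : ℝ, s ≠ 0 → |w| ≤ H →
        ‖∫ p in Ioo (-r) r ×ˢ Ioo 0 τ, ((Θ (Lmap v p) * stdFun n f γ E (Lmap v p) : ℝ) : ℂ) *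
            Complex.exp (Complex.I * ((s:ℂ) * (p.2:ℂ) + (w:ℂ) * (p.1:ℂ)))‖
          ≤ K * ∫ p in Ioo (-r) r ×ˢ Ioo 0 τ, stdFun n f γ E (Lmap v p) * min 1 (1 / (|s| * p.2))) := by
  obtain ⟨r, hr, τ, hτ, hrR, hτR, ι, F, ⟨κ, _, ψ, J, C₀, h1, h2, h3, h4, h5, h6⟩, hfr⟩ :=
    half_cells hsf hv hR
  refine ⟨r, hr, τ, hτ, hrR, hτR, fun hint M hM => ?_⟩
  have hEo := (std_frontier hsf.domain).1
  set C := max C₀ 0 with hCdef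
  have hC : 0 ≤ C := le_max_right _ _
  have hCP : 0 ≤ C + ∑ i, |γ i| * C := add_nonneg hC (Finset.sum_nonneg fun i _ => by positivity)
  set g := stdFun n f γ E with hg
  have hg0 : ∀ p, 0 ≤ g p := stdFun_nonneg n f γ E
  set C1 := M + (C + ∑ i, |γ i| * C) * M + M * (C + 1) + M * (|H| * (C * r)) with hC1
  have hC10 : 0 ≤ C1 := by positivity
  refine ⟨3 * C1, by positivity, fun Θ hΘd hΘ' hΘb τ' hτ'0 hτ' hsupp s w hs hw => ?_⟩
  have hQ : MeasurableSet (Ioo (-r) r ×ˢ Ioo (0:ℝ) τ) := measurableSet_Ioo.prod measurableSet_Ioo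
  have hLc : Continuous (Lmap v) := by unfold Lmap; fun_prop
  have hLne : ∀ p : ℝ × ℝ, 0 < p.2 → Lmap v p ≠ 0 := by
    intro p hp h
    have := dot_Lmap hv p
    rw [h] at this
    simp [dot2] at this
    linarith
  have hLn : ∀ p : ℝ × ℝ, 0 < p.2 → p.2 ≤ nrm2 (Lmap v p) := by
    intro p hp
    unfold nrm2; rw [Lmap_sq hv]
    exact Real.le_sqrt_of_sq_le (by nlinarith [sq_nonneg p.1])
  have hΘc : ContinuousOn (fun p => Θ (Lmap v p)) (Ioo (-r) r ×ˢ Ioo (0:ℝ) τ) := fun p hp =>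
    ((hΘd _ (hLne p hp.2.1)).continuousAt.comp hLc.continuousAt).continuousWithinAt
  set G : ℝ × ℝ → ℂ := fun p => ((Θ (Lmap v p) * g (Lmap v p) : ℝ) : ℂ) *
            Complex.exp (Complex.I * ((s:ℂ) * (p.2:ℂ) + (w:ℂ) * (p.1:ℂ))) with hGdef
  have hGi : IntegrableOn G (Ioo (-r) r ×ˢ Ioo (0:ℝ) τ) := by
    refine Integrable.mono' (hint.const_mul M) ?_ ?_
    · refine AEStronglyMeasurable.mul ?_ ?_
      · exact Complex.continuous_ofReal.comp_aestronglyMeasurable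
          ((hΘc.aestronglyMeasurable hQ).mul hint.aestronglyMeasurable)
      · exact Continuous.aestronglyMeasurable (by fun_prop)
    · refine ae_of_all _ fun p => ?_
      have : (Complex.I * ((s:ℂ) * (p.2:ℂ) + (w:ℂ) * (p.1:ℂ))) =
        ((s * p.2 + w * p.1 : ℝ) : ℂ) * Complex.I := by push_cast; ring
      simp only [hGdef]
      rw [this, norm_mul, Complex.norm_exp_ofReal_mul_I, mul_one, Complex.norm_real, Real.norm_eq_abs,
        abs_mul, abs_of_nonneg (hg0 _)]
      exact mul_le_mul_of_nonneg_right (hΘb _) (hg0 _)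
  have hBi : IntegrableOn (fun p : ℝ × ℝ => g (Lmap v p) * min 1 (1 / (|s| * p.2)))
      (Ioo (-r) r ×ˢ Ioo (0:ℝ) τ) := by
    refine Integrable.mono' hint (hint.aestronglyMeasurable.mul
      (Measurable.aestronglyMeasurable (by fun_prop))) ?_
    filter_upwards [ae_restrict_mem hQ] with p hp
    have h0 : 0 ≤ min 1 (1 / (|s| * p.2)) := le_min zero_le_one (by have := hp.2.1; positivity)
    rw [Real.norm_eq_abs, abs_of_nonneg (mul_nonneg (hg0 _) h0)]
    exact mul_le_of_le_one_right (hg0 _) (min_le_left _ _)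
  have h3' : ∀ k, ∀ u ∈ Ioo (0:ℝ) 1, ∀ t ∈ Ioo (0:ℝ) τ, 0 < J k u t :=
    fun k u hu t ht => (h3 k u hu t ht).1
  obtain ⟨i1, e1⟩ := cov_int h1 h2 h3' h6 hGi
  obtain ⟨i2, e2⟩ := cov_int h1 h2 h3' h6 hBi
  obtain ⟨i3, -⟩ := cov_int h1 h2 h3' h6 hint
  rw [e1, e2, Finset.mul_sum]
  refine (norm_sum_le _ _).trans (Finset.sum_le_sum fun k _ => ?_)
  have j1 := i1 k
  have j2 := i2 k
  have j3 := i3 k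
  unfold IntegrableOn at j1 j2 j3
  rw [Measure.volume_eq_prod, ← Measure.prod_restrict] at j1 j2 j3 ⊢
  rw [integral_prod _ j1, integral_prod _ j2, ← MeasureTheory.integral_const_mul]
  refine norm_integral_le_of_norm_le (j2.integral_prod_left.const_mul _) ?_
  filter_upwards [ae_restrict_mem measurableSet_Ioo, j3.prod_right_ae] with u hu j3u
  simp only [smul_eq_mul] at j3u ⊢
  have hx : LL τ C (ψ k u) := (h5 k u hu (Sum.inl none)).mono le_rfl (le_max_left _ _)
  have hxc : ContinuousOn (ψ k u) (Ioo 0 τ) := fun t ht =>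
    (hx t ht).2.1.continuousAt.continuousWithinAt
  have hJ : LL τ C (J k u) := (h4 k u hu).mono le_rfl (le_max_left _ _)
  have hfl : ∀ i, LL τ C (fun t => f i (Lmap v (ψ k u t, t))) := fun i =>
    (h5 k u hu (Sum.inl (some i))).mono le_rfl (le_max_left _ _)
  have hfrl : ∀ t ∈ Ioo 0 τ, Lmap v (ψ k u t, t) ∉ frontier E := fun t ht =>
    hfr _ (h3 k u hu t ht).2 t ht fun j => (h5 k u hu (Sum.inr j) t ht).1
  have hmul : ∀ t, J k u t • G (ψ k u t, t) = (((J k u t * g (Lmap v (ψ k u t, t))) *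
      Θ (Lmap v (ψ k u t, t)) : ℝ) : ℂ) * Complex.exp (Complex.I * ((w:ℂ) * (ψ k u t : ℂ))) *
      Complex.exp (Complex.I * ((s:ℂ) * (t:ℂ))) := by
    intro t
    rw [mul_assoc, ← Complex.exp_add, Complex.real_smul]
    simp only [hGdef]
    rw [← mul_assoc]
    congr 1
    · push_cast; ring
    · congr 1; ring
  have hmul2 : ∀ t, J k u t * (g (Lmap v (ψ k u t, t)) * min 1 (1 / (|s| * t))) =
      J k u t * g (Lmap v (ψ k u t, t)) * min 1 (1 / (|s| * t)) := fun t => (mul_assoc _ _ _).symm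
  simp only [hmul, hmul2]
  rcases leaf_std (γ := γ) hxc hfl hEo hfrl with hz | hll
  · rw [setIntegral_congr_fun (g := fun _ => (0:ℂ)) measurableSet_Ioo]
    · simp only [integral_zero, norm_zero]
      refine mul_nonneg (by positivity) (setIntegral_nonneg measurableSet_Ioo fun t ht => ?_)
      rw [hg, hz t ht]; simp
    · intro t ht
      simp only [hg, hz t ht]; simp
  · have hP := hJ.mul hll
    have hP0 : ∀ t ∈ Ioo 0 τ, 0 ≤ J k u t * g (Lmap v (ψ k u t, t)) := fun t ht =>
      mul_nonneg (h3' k u hu t ht).le (hg0 _)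
    have hΘl := leaf_theta hv hC hM hx hΘd hΘ'
    have hamp := leaf_amp (w := w) (C1 := C1) (H := |H|) hCP hC hM (by positivity) hP hP0
      (fun t ht => ⟨(hΘl t ht).1, hΘb _, (hΘl t ht).2⟩) hx
      (fun t ht => (abs_lt.2 (h3 k u hu t ht).2).le) hr.le (hw.trans (le_abs_self H)) le_rfl
    refine osc1D hs hC10 hP0 j3u hamp hτ'0 hτ' fun t ht htt => ?_
    have : Θ (Lmap v (ψ k u t, t)) = 0 := hsupp _ (htt.trans (hLn (ψ k u t, t) ht.1))
    rw [this]; simp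

lemma Lmap_mp {v : ℝ × ℝ} (hv : nrm2 v = 1) : MeasurePreserving (Lmap v) volume volume := by
  have hm : Measurable (Lmap v) := by unfold Lmap; fun_prop
  refine ⟨hm, ?_⟩
  set A : Matrix (Fin 2) (Fin 2) ℝ := !![v.2, v.1; -v.1, v.2] with hA
  have hdet : LinearMap.det (Matrix.toLin (Module.Basis.finTwoProd ℝ) (Module.Basis.finTwoProd ℝ) A) = 1 := by
    rw [LinearMap.det_toLin, hA, Matrix.det_fin_two_of]
    linarith [unit_sq hv]
  have heq : Lmap v = Matrix.toLin (Module.Basis.finTwoProd ℝ) (Module.Basis.finTwoProd ℝ) A := by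
    funext p
    rw [hA, Matrix.toLin_finTwoProd_apply]
    ext <;> simp [Lmap] <;> ring
  rw [heq, Measure.map_linearMap_addHaar_eq_smul_addHaar volume (by rw [hdet]; exact one_ne_zero), hdet]
  simp

lemma Lmap_me {v : ℝ × ℝ} (hv : nrm2 v = 1) : MeasurableEmbedding (Lmap v) := by
  have hc : Continuous (Lmap v) := by unfold Lmap; fun_prop
  refine hc.measurableEmbedding fun p q h => ?_
  ext
  · rw [← dot_perp_Lmap hv p, ← dot_perp_Lmap hv q, h]
  · rw [← dot_Lmap hv p, ← dot_Lmap hv q, h]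

lemma Lmap_strip {v : ℝ × ℝ} (hv : nrm2 v = 1) (r c : ℝ) :
    Lmap v ⁻¹' strip2 v r c = Ioo (-c) c ×ˢ Ioo (-r) r := by
  ext p
  simp only [strip2, mem_preimage, mem_setOf_eq, dot_Lmap hv, dot_perp_Lmap hv, mem_prod, abs_lt, mem_Ioo]
  tauto

lemma dyadic_min {s : ℝ} (hs : 0 < s) (N : ℕ) : ∀ y, 0 < y → y < 2 ^ N / s →
    min 1 (1 / (s * y)) ≤ ∑ l ∈ Finset.range (N + 1), 2 * (2⁻¹ : ℝ) ^ l * (if y < 2 ^ l / s then 1 else 0) := by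
  induction N with
  | zero =>
    intro y hy h
    rw [Finset.sum_range_one, if_pos h]
    refine (min_le_left _ _).trans ?_
    norm_num
  | succ N ih =>
    intro y hy h
    rw [Finset.sum_range_succ, if_pos h]
    by_cases h' : y < 2 ^ N / s
    · have := ih y hy h'
      have h0 : (0:ℝ) ≤ 2 * 2⁻¹ ^ (N + 1) * 1 := by positivity
      linarith
    · push Not at h'
      have h0 : (0:ℝ) ≤ ∑ l ∈ Finset.range (N + 1), 2 * (2⁻¹ : ℝ) ^ l * (if y < 2 ^ l / s then 1 else 0) :=
        Finset.sum_nonneg fun l _ => by split_ifs <;> positivity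
      have h1 : min 1 (1 / (s * y)) ≤ 2 * 2⁻¹ ^ (N + 1) * 1 := by
        refine (min_le_right _ _).trans ?_
        rw [div_le_iff₀ hs] at h'
        rw [div_le_iff₀ (by positivity), pow_succ, inv_pow]
        have h2 : (0:ℝ) < 2 ^ N := by positivity
        have : 2 * (((2:ℝ) ^ N)⁻¹ * 2⁻¹) * 1 * (s * y) = (s * y) / 2 ^ N := by field_simp
        rw [this, le_div_iff₀ h2]; linarith
      linarith

lemma strip_sum {G : ℝ × ℝ → ℝ} (hG : ∀ p, 0 ≤ G p) {c b δ κ : ℝ} {e : ℕ} (hc : 0 < c) (hc1 : c < 1)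
    (hb : 0 ≤ b) (hκ : κ ≤ δ) (hκ1 : κ < 1)
    (hbd : ∀ r, 0 < r → r < c → ∫ p in Ioo (-c) c ×ˢ Ioo (-r) r, G p ≤ b * r ^ δ * |Real.log r| ^ e)
    (hint : IntegrableOn G (Ioo (-c) c ×ˢ Ioo (-c) c)) :
    ∃ K, 0 ≤ K ∧ ∀ r₀ τ, r₀ ≤ c → τ ≤ c / 4 → ∀ s : ℝ, 2 / c ≤ |s| →
      ∫ p in Ioo (-r₀) r₀ ×ˢ Ioo 0 τ, G p * min 1 (1 / (|s| * p.2)) ≤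
        K * (|s| ^ (-κ) * (Real.log |s|) ^ e) := by
  set q : ℝ := 2 ^ (κ - 1) with hq
  have hq0 : 0 < q := by positivity
  have hq1 : q < 1 := Real.rpow_lt_one_of_one_lt_of_neg (by norm_num) (by linarith)
  refine ⟨2 * b * (1 - q)⁻¹, mul_nonneg (by positivity) (inv_nonneg.2 (by linarith)), ?_⟩
  intro r₀ τ hr₀ hτ s hs
  set S := |s| with hS
  have hS2 : 2 ≤ S * c := by rwa [div_le_iff₀ hc] at hs
  have hS0 : 0 < S := lt_of_lt_of_le (by positivity) hs
  have hS1 : 1 ≤ S := by nlinarith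
  obtain ⟨N, hN1, hN2⟩ := exists_nat_pow_near (x := S * c / 2) (y := 2) (by linarith) (by norm_num)
  have hr : ∀ l ∈ Finset.range (N + 1), 0 < 2 ^ l / S ∧ 2 ^ l / S < c ∧ 1 / S ≤ 2 ^ l / S := by
    intro l hl
    have h1 : (1:ℝ) ≤ 2 ^ l := one_le_pow₀ (by norm_num)
    refine ⟨by positivity, ?_, by gcongr⟩
    rw [div_lt_iff₀ hS0]
    have : (2:ℝ) ^ l ≤ 2 ^ N := pow_le_pow_right₀ (by norm_num) (Nat.lt_succ_iff.1 (Finset.mem_range.1 hl))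
    nlinarith
  have hW : MeasurableSet (Ioo (-r₀) r₀ ×ˢ Ioo (0:ℝ) τ) := measurableSet_Ioo.prod measurableSet_Ioo
  have hWsub : Ioo (-r₀) r₀ ×ˢ Ioo (0:ℝ) τ ⊆ Ioo (-c) c ×ˢ Ioo (-c) c :=
    prod_mono (Ioo_subset_Ioo (by linarith) hr₀) (Ioo_subset_Ioo (by linarith) (by linarith))
  have hT : ∀ l, MeasurableSet {p : ℝ × ℝ | p.2 < 2 ^ l / S} := fun l =>
    measurableSet_lt measurable_snd measurable_const
  have hGW := hint.mono_set hWsub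
  have hterm : ∀ l, IntegrableOn (fun p : ℝ × ℝ => 2 * (2⁻¹ : ℝ) ^ l *
      ({p : ℝ × ℝ | p.2 < 2 ^ l / S}.indicator G p)) (Ioo (-r₀) r₀ ×ˢ Ioo (0:ℝ) τ) := fun l =>
    (hGW.indicator (hT l)).const_mul _
  have hsum := integrable_finsetSum (Finset.range (N + 1)) fun l _ => hterm l
  have h1 : ∫ p in Ioo (-r₀) r₀ ×ˢ Ioo 0 τ, G p * min 1 (1 / (S * p.2)) ≤
      ∫ p in Ioo (-r₀) r₀ ×ˢ Ioo 0 τ, ∑ l ∈ Finset.range (N + 1), 2 * (2⁻¹ : ℝ) ^ l *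
      ({p : ℝ × ℝ | p.2 < 2 ^ l / S}.indicator G p) := by
    refine integral_mono_of_nonneg ?_ hsum ?_
    · filter_upwards [ae_restrict_mem hW] with p hp
      exact mul_nonneg (hG p) (le_min zero_le_one (by have := hp.2.1; positivity))
    · filter_upwards [ae_restrict_mem hW] with p hp
      have hlt : p.2 < 2 ^ N / S := by
        rw [lt_div_iff₀ hS0]
        have h2 : p.2 < c / 4 := hp.2.2.trans_le hτ
        rw [pow_succ] at hN2
        nlinarith
      have := mul_le_mul_of_nonneg_left (dyadic_min hS0 N p.2 hp.2.1 hlt) (hG p)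
      refine this.trans (le_of_eq ?_)
      rw [Finset.mul_sum]
      refine Finset.sum_congr rfl fun l _ => ?_
      simp only [indicator_apply, mem_setOf_eq]
      split_ifs <;> ring
  refine h1.trans ?_
  rw [integral_finsetSum _ fun l _ => hterm l]
  have h2 : ∀ l ∈ Finset.range (N + 1), ∫ p in Ioo (-r₀) r₀ ×ˢ Ioo 0 τ, 2 * (2⁻¹ : ℝ) ^ l *
      ({p : ℝ × ℝ | p.2 < 2 ^ l / S}.indicator G p) ≤ 2 * b * (S ^ (-κ) * (Real.log S) ^ e) * q ^ l := by
    intro l hl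
    obtain ⟨a1, a2, a3⟩ := hr l hl
    rw [MeasureTheory.integral_const_mul, setIntegral_indicator (hT l)]
    have h3 : ∫ p in Ioo (-r₀) r₀ ×ˢ Ioo 0 τ ∩ {p : ℝ × ℝ | p.2 < 2 ^ l / S}, G p ≤
        ∫ p in Ioo (-c) c ×ˢ Ioo (-(2 ^ l / S)) (2 ^ l / S), G p := by
      refine setIntegral_mono_set (hint.mono_set ?_) (ae_of_all _ hG) (HasSubset.Subset.eventuallyLE ?_)
      · exact prod_mono le_rfl (Ioo_subset_Ioo (by linarith) (by linarith))
      · rintro p ⟨⟨hp1, hp2⟩, hp3⟩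
        exact ⟨⟨by linarith [hp1.1], by linarith [hp1.2]⟩, ⟨by linarith [hp2.1], hp3⟩⟩
    have h4 := h3.trans (hbd _ a1 a2)
    have h5 : |Real.log (2 ^ l / S)| ≤ Real.log S := by
      rw [abs_of_nonpos (Real.log_nonpos a1.le (by linarith)), ← Real.log_inv]
      refine Real.log_le_log (by positivity) ?_
      rw [inv_le_comm₀ a1 hS0, ← one_div]
      exact a3
    have h6 : (2 ^ l / S : ℝ) ^ δ ≤ (2:ℝ) ^ (κ * l) * S ^ (-κ) := by
      refine (Real.rpow_le_rpow_of_exponent_ge a1 (by linarith) hκ).trans (le_of_eq ?_)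
      rw [Real.div_rpow (by positivity) hS0.le, Real.rpow_neg hS0.le, div_eq_mul_inv, ← Real.rpow_natCast,
        ← Real.rpow_mul (by norm_num), mul_comm κ]
    have h7 : q ^ l = 2⁻¹ ^ l * (2:ℝ) ^ (κ * l) := by
      rw [hq, ← Real.rpow_natCast, ← Real.rpow_mul (by norm_num), ← Real.rpow_natCast (2⁻¹) l,
        Real.inv_rpow (by norm_num), ← Real.rpow_neg (by norm_num), ← Real.rpow_add (by norm_num)]
      congr 1; ring
    calc _ ≤ 2 * (2⁻¹ : ℝ) ^ l * (b * (2 ^ l / S) ^ δ * |Real.log (2 ^ l / S)| ^ e) := by gcongr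
      _ ≤ 2 * (2⁻¹ : ℝ) ^ l * (b * ((2:ℝ) ^ (κ * l) * S ^ (-κ)) * (Real.log S) ^ e) := by gcongr
      _ = _ := by rw [h7]; ring
  refine (Finset.sum_le_sum h2).trans ?_
  rw [← Finset.mul_sum]
  have hgeo : ∑ i ∈ Finset.range (N + 1), q ^ i ≤ (1 - q)⁻¹ := by
    rw [← tsum_geometric_of_lt_one hq0.le hq1]
    exact (summable_geometric_of_lt_one hq0.le hq1).sum_le_tsum _ fun i _ => by positivity
  have hl : 0 ≤ Real.log S := Real.log_nonneg hS1
  calc _ ≤ 2 * b * (S ^ (-κ) * (Real.log S) ^ e) * (1 - q)⁻¹ := by gcongr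
    _ = _ := by ring

lemma Lmap_nrm {v : ℝ × ℝ} (hv : nrm2 v = 1) (p : ℝ × ℝ) : nrm2 (Lmap v p) = nrm2 p := by
  unfold nrm2; rw [Lmap_sq hv]

lemma half_final {n : ℕ} {f : Fin n → ℝ × ℝ → ℝ} {γ : Fin n → ℝ} {E : Set (ℝ × ℝ)}
    (hsf : StandardForm n f γ E) {v : ℝ × ℝ} (hv : nrm2 v = 1) {δ κ : ℝ} {e : ℕ}
    (hst : StripBound (stdFun n f γ E) v δ e) (hκ : κ ≤ δ) (hκ1 : κ < 1) (H : ℝ) :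
    ∃ ρ > 0, ∃ s₀, 1 ≤ s₀ ∧ ∀ M, 0 ≤ M → ∃ K, 0 ≤ K ∧ ∀ Θ : ℝ × ℝ → ℝ,
        (∀ p, p ≠ 0 → DifferentiableAt ℝ Θ p) →
        (∀ p, p ≠ 0 → ‖fderiv ℝ Θ p‖ ≤ M * (nrm2 p)⁻¹) → (∀ p, |Θ p| ≤ M) →
        (∀ p, ρ ≤ nrm2 p → Θ p = 0) → ∀ s w : ℝ, s₀ ≤ |s| → |w| ≤ H →
        ‖∫ p in {p : ℝ × ℝ | 0 < p.2}, ((Θ (Lmap v p) * stdFun n f γ E (Lmap v p) : ℝ) : ℂ) *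
            Complex.exp (Complex.I * ((s:ℂ) * (p.2:ℂ) + (w:ℂ) * (p.1:ℂ)))‖
          ≤ K * (|s| ^ (-κ) * (Real.log |s|) ^ e) := by
  obtain ⟨hδ, he, cv, hcv, hst⟩ := hst
  obtain ⟨U, hU, hUi⟩ := hsf.integ
  obtain ⟨ρ₀, hρ₀, hball⟩ := Metric.mem_nhds_iff.1 hU
  obtain ⟨c, hc, hclt⟩ : ∃ c : ℝ, 0 < c ∧ c < min (min cv 1) (ρ₀ / 2) :=
    exists_between (lt_min (lt_min hcv one_pos) (by positivity))
  have hc1 : c < cv := hclt.trans_le ((min_le_left _ _).trans (min_le_left _ _))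
  have hc2 : c < 1 := hclt.trans_le ((min_le_left _ _).trans (min_le_right _ _))
  have hc3 : c < ρ₀ / 2 := hclt.trans_le (min_le_right _ _)
  obtain ⟨a, ha, b, hb, hab⟩ := hst c hc hc1
  have hint : IntegrableOn (fun p => stdFun n f γ E (Lmap v p)) (Ioo (-c) c ×ˢ Ioo (-c) c) := by
    rw [← Lmap_strip hv]
    refine ((Lmap_mp hv).integrableOn_comp_preimage (Lmap_me hv)).2 (hUi.mono_set ?_)
    intro p hp
    apply hball
    rw [mem_ball_zero_iff, ← Lmap_inv hv p]
    exact (Lmap_norm hv _).trans_lt (by linarith [hp.1, hp.2])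
  have hbd : ∀ r, 0 < r → r < c → ∫ p in Ioo (-c) c ×ˢ Ioo (-r) r, stdFun n f γ E (Lmap v p)
      ≤ b * r ^ δ * |Real.log r| ^ e := by
    intro r hr hrc
    rw [← Lmap_strip hv, (Lmap_mp hv).setIntegral_preimage_emb (Lmap_me hv)]
    exact (hab r hr hrc).2
  obtain ⟨K₁, hK₁, hsum⟩ := strip_sum (fun p => stdFun_nonneg n f γ E (Lmap v p)) hc hc2 hb.le hκ hκ1
    hbd hint
  obtain ⟨r, hr, τ, hτ, hrc, hτc, hosc⟩ := half_osc hsf hv (R := c / 4) (by positivity) H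
  have hWsub : Ioo (-r) r ×ˢ Ioo (0:ℝ) τ ⊆ Ioo (-c) c ×ˢ Ioo (-c) c :=
    prod_mono (Ioo_subset_Ioo (by linarith) (by linarith)) (Ioo_subset_Ioo (by linarith) (by linarith))
  have hosc' := hosc (hint.mono_set hWsub)
  have hρ1 : min r τ / 2 < r := by have := min_le_left r τ; linarith
  have hρ2 : min r τ / 2 < τ := by have := min_le_right r τ; linarith
  have hρ0 : 0 < min r τ / 2 := half_pos (lt_min hr hτ)
  refine ⟨min r τ / 2, hρ0, 2 / c, ?_, ?_⟩
  · rw [le_div_iff₀ hc]; linarith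
  intro M hM
  obtain ⟨K, hK, hKb⟩ := hosc' M hM
  refine ⟨K * K₁, by positivity, fun Θ t1 t2 t3 t4 s w hs hw => ?_⟩
  have hs0 : s ≠ 0 := abs_pos.1 (lt_of_lt_of_le (by positivity) hs)
  have h1 := hKb Θ t1 t2 t3 _ hρ0 hρ2 t4 s w hs0 hw
  have h2 := hsum r τ (by linarith) hτc s hs
  have hset : ∫ p in {p : ℝ × ℝ | 0 < p.2}, ((Θ (Lmap v p) * stdFun n f γ E (Lmap v p) : ℝ) : ℂ) *
            Complex.exp (Complex.I * ((s:ℂ) * (p.2:ℂ) + (w:ℂ) * (p.1:ℂ))) =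
      ∫ p in Ioo (-r) r ×ˢ Ioo 0 τ, ((Θ (Lmap v p) * stdFun n f γ E (Lmap v p) : ℝ) : ℂ) *
            Complex.exp (Complex.I * ((s:ℂ) * (p.2:ℂ) + (w:ℂ) * (p.1:ℂ))) := by
    refine setIntegral_eq_of_subset_of_forall_diff_eq_zero
      (measurableSet_lt measurable_const measurable_snd) (fun p hp => hp.2.1) ?_
    rintro p ⟨hp1, hp2⟩
    have hp1' : 0 < p.2 := hp1
    have : Θ (Lmap v p) = 0 := by
      apply t4
      rw [Lmap_nrm hv]
      by_contra hcon
      push Not at hcon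
      apply hp2
      have b1 : |p.1| ≤ nrm2 p := Real.le_sqrt_of_sq_le (by rw [sq_abs]; nlinarith [sq_nonneg p.2])
      have b2 : p.2 ≤ nrm2 p := Real.le_sqrt_of_sq_le (by nlinarith [sq_nonneg p.1])
      exact ⟨abs_lt.1 (by linarith), hp1', by linarith⟩
    rw [this]; simp
  rw [hset]
  calc _ ≤ _ := h1
    _ ≤ K * (K₁ * (|s| ^ (-κ) * (Real.log |s|) ^ e)) := mul_le_mul_of_nonneg_left h2 hK
    _ = _ := by ring

lemma nrm2_neg (v : ℝ × ℝ) : nrm2 (-v) = nrm2 v := by simp [nrm2]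

lemma StripBound.neg {g : ℝ × ℝ → ℝ} {v : ℝ × ℝ} {δ : ℝ} {e : ℕ} (h : StripBound g v δ e) :
    StripBound g (-v) δ e := by
  have : ∀ r c, strip2 (-v) r c = strip2 v r c := by
    intro r c
    ext p
    simp only [strip2, mem_setOf_eq]
    have e1 : dot2 p (-v) = -dot2 p v := by simp [dot2]; ring
    have e2 : dot2 p (perp2 (-v)) = -dot2 p (perp2 v) := by simp [dot2, perp2]; ring
    rw [e1, e2, abs_neg, abs_neg]
  unfold StripBound
  simp only [this]
  exact h

lemma Lmap_neg_v (v p : ℝ × ℝ) : Lmap (-v) p = Lmap v (-p) := by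
  simp [Lmap]

lemma split_int {v : ℝ × ℝ} (hv : nrm2 v = 1) {F : ℝ × ℝ → ℂ} (hF : Integrable F) :
    ∫ p, F p = (∫ p in {p : ℝ × ℝ | 0 < p.2}, F (Lmap v p)) +
      ∫ p in {p : ℝ × ℝ | 0 < p.2}, F (Lmap (-v) p) := by
  have hm : MeasurableSet {p : ℝ × ℝ | 0 < p.2} := measurableSet_lt measurable_const measurable_snd
  have hFL : Integrable (fun p => F (Lmap v p)) :=
    ((Lmap_mp hv).integrable_comp_emb (Lmap_me hv)).2 hF
  rw [← (Lmap_mp hv).integral_comp (Lmap_me hv), ← integral_add_compl hm hFL]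
  congr 1
  simp_rw [Lmap_neg_v]
  have hnull : ({p : ℝ × ℝ | 0 < p.2}ᶜ : Set (ℝ × ℝ)) =ᵐ[volume] {p : ℝ × ℝ | p.2 < 0} := by
    have h0 : volume ((univ : Set ℝ) ×ˢ ({0} : Set ℝ)) = 0 := by
      rw [Measure.volume_eq_prod, Measure.prod_prod]; simp
    have h1 : ∀ᵐ p : ℝ × ℝ, p ∉ (univ : Set ℝ) ×ˢ ({0} : Set ℝ) := measure_eq_zero_iff_ae_notMem.1 h0
    filter_upwards [h1] with p hp
    have hp' : p.2 ≠ 0 := fun h => hp ⟨mem_univ _, h⟩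
    apply propext
    show ¬ (0 < p.2) ↔ p.2 < 0
    constructor
    · intro h; exact lt_of_le_of_ne (not_lt.1 h) hp'
    · intro h; linarith
  rw [setIntegral_congr_set hnull]
  have hneg := (Measure.measurePreserving_neg (volume : Measure (ℝ × ℝ))).setIntegral_preimage_emb
    (MeasurableEquiv.neg (ℝ × ℝ)).measurableEmbedding (fun p => F (Lmap v (p))) {p : ℝ × ℝ | p.2 < 0}
  rw [← hneg]
  congr 2
  ext p
  simp

lemma nrm2_nonneg (p : ℝ × ℝ) : 0 ≤ nrm2 p := Real.sqrt_nonneg _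

lemma nrm2_sq (p : ℝ × ℝ) : nrm2 p ^ 2 = p.1 ^ 2 + p.2 ^ 2 := Real.sq_sqrt (by positivity)

lemma norm_le_nrm2 (p : ℝ × ℝ) : ‖p‖ ≤ nrm2 p := by
  rw [Prod.norm_def]
  refine max_le ?_ ?_ <;> rw [Real.norm_eq_abs] <;> refine Real.le_sqrt_of_sq_le ?_ <;> rw [sq_abs]
  · nlinarith [sq_nonneg p.2]
  · nlinarith [sq_nonneg p.1]

lemma theta_props {φ α : ℝ × ℝ → ℝ} {x₀ y₀ A ρ : ℝ} (hA : 0 < A) (hα : AlphaBound α A)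
    (hρ0 : 0 < ρ) (hρ : ρ ≤ 1) (hφ : IsBump φ x₀ y₀ ρ) :
    ∃ M, 0 ≤ M ∧ (∀ p, p ≠ 0 → DifferentiableAt ℝ (fun p => φ ((x₀, y₀) + p) * α p) p) ∧
      (∀ p, p ≠ 0 → ‖fderiv ℝ (fun p => φ ((x₀, y₀) + p) * α p) p‖ ≤ M * (nrm2 p)⁻¹) ∧
      (∀ p, |φ ((x₀, y₀) + p) * α p| ≤ M) ∧ (∀ p, ρ ≤ nrm2 p → φ ((x₀, y₀) + p) = 0) := by
  obtain ⟨hφs, hφc, -, hsupp⟩ := hφ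
  obtain ⟨hα1, hα2, hα3⟩ := hα
  have hφd : Differentiable ℝ φ := hφs.differentiable (by simp)
  have hφd' : Continuous (fderiv ℝ φ) := hφs.continuous_fderiv (by simp)
  obtain ⟨M₁, hM₁⟩ := hφc.exists_bound_of_continuous hφs.continuous
  obtain ⟨M₂, hM₂⟩ := (hφc.fderiv ℝ).exists_bound_of_continuous hφd'
  have hM₁0 : 0 ≤ M₁ := (norm_nonneg _).trans (hM₁ 0)
  have hM₂0 : 0 ≤ M₂ := (norm_nonneg _).trans (hM₂ 0)
  have hout : ∀ p, ρ ≤ nrm2 p → (x₀, y₀) + p ∉ tsupport φ := by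
    intro p hp h
    have := hsupp h
    simp only [mem_setOf_eq, Prod.fst_add, Prod.snd_add, add_sub_cancel_left] at this
    rw [← nrm2_sq] at this
    nlinarith
  have hαd : ∀ p : ℝ × ℝ, p ≠ 0 → DifferentiableAt ℝ α p := fun p hp =>
    (hα1.contDiffAt (isOpen_compl_singleton.mem_nhds hp)).differentiableAt (by simp)
  have hsh : ∀ p : ℝ × ℝ, HasFDerivAt (fun p => φ ((x₀, y₀) + p)) (fderiv ℝ φ ((x₀, y₀) + p)) p := by
    intro p
    have := (hφd ((x₀, y₀) + p)).hasFDerivAt.comp p ((hasFDerivAt_id p).const_add (x₀, y₀))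
    rw [ContinuousLinearMap.comp_id] at this
    exact this
  refine ⟨M₁ * A + M₂ * A, by positivity, ?_, ?_, ?_, ?_⟩
  · intro p hp
    exact (hsh p).differentiableAt.mul (hαd p hp)
  · intro p hp
    have hnp : 0 < nrm2 p := (norm_pos_iff.2 hp).trans_le (norm_le_nrm2 p)
    have := ((hsh p).mul (hαd p hp).hasFDerivAt).fderiv
    have e : (fun p => φ ((x₀, y₀) + p) * α p) = (fun p => φ ((x₀, y₀) + p)) * α := rfl
    rw [e, this]
    refine (norm_add_le _ _).trans ?_
    rw [norm_smul, norm_smul, add_mul]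
    refine add_le_add ?_ ?_
    · rw [mul_assoc]
      exact mul_le_mul (hM₁ _) (hα3 p hp) (norm_nonneg _) hM₁0
    · by_cases h : ρ ≤ nrm2 p
      · have h0 : fderiv ℝ φ ((x₀, y₀) + p) = 0 := by
          by_contra hne
          exact hout p h (support_fderiv_subset ℝ hne)
        rw [h0]; simp; positivity
      · push Not at h
        have h1 : 1 ≤ (nrm2 p)⁻¹ := (one_le_inv₀ hnp).2 (by linarith)
        calc ‖α p‖ * ‖fderiv ℝ φ ((x₀, y₀) + p)‖ ≤ A * M₂ :=
              mul_le_mul (hα2 p) (hM₂ _) (norm_nonneg _) hA.le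
          _ = M₂ * A * 1 := by ring
          _ ≤ _ := by gcongr
  · intro p
    rw [abs_mul]
    have : |φ ((x₀, y₀) + p)| * |α p| ≤ M₁ * A := mul_le_mul (hM₁ _) (hα2 p) (abs_nonneg _) hM₁0
    have h2 : 0 ≤ M₂ * A := by positivity
    linarith
  · intro p hp
    exact image_eq_zero_of_notMem_tsupport (hout p hp)

lemma Kphi_eq {φ m α g : ℝ × ℝ → ℝ} {x₀ y₀ : ℝ} 
    (h : ∀ p, φ ((x₀, y₀) + p) * m ((x₀, y₀) + p) = φ ((x₀, y₀) + p) * α p * g p) (t u : ℝ) :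
    ‖Kphi φ m t u‖ = ‖∫ p : ℝ × ℝ, ((φ ((x₀, y₀) + p) * α p * g p : ℝ) : ℂ) *
      Complex.exp (Complex.I * ((t : ℂ) * (p.1 : ℂ) + (u : ℂ) * (p.2 : ℂ)))‖ := by
  unfold Kphi oscInt
  rw [Measure.restrict_univ, ← integral_add_left_eq_self _ ((x₀, y₀) : ℝ × ℝ)]
  have : ∀ p : ℝ × ℝ, ((φ ((x₀, y₀) + p) * m ((x₀, y₀) + p) : ℝ) : ℂ) *
      Complex.exp (Complex.I * ((t : ℂ) * ((((x₀, y₀) + p).1 : ℝ) : ℂ) + (u : ℂ) * ((((x₀, y₀) + p).2 : ℝ) : ℂ)))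
      = Complex.exp (((t * x₀ + u * y₀ : ℝ) : ℂ) * Complex.I) * (((φ ((x₀, y₀) + p) * α p * g p : ℝ) : ℂ) *
      Complex.exp (Complex.I * ((t : ℂ) * (p.1 : ℂ) + (u : ℂ) * (p.2 : ℂ)))) := by
    intro p
    rw [h, mul_left_comm, ← Complex.exp_add]
    congr 2
    simp only [Prod.fst_add, Prod.snd_add]
    push_cast; ring
  simp_rw [this]
  rw [MeasureTheory.integral_const_mul, norm_mul, Complex.norm_exp_ofReal_mul_I, one_mul]

lemma kernel_core {n : ℕ} (f : Fin n → ℝ × ℝ → ℝ)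
    (γ : Fin n → ℝ) (E : Set (ℝ × ℝ)) (hsf : StandardForm n f γ E)
    (x₀ y₀ A : ℝ) (hA : 0 < A) (α m : ℝ × ℝ → ℝ) (hα : AlphaBound α A)
    (U : Set (ℝ × ℝ)) (hU : U ∈ 𝓝 (0:ℝ×ℝ))
    (hm : ∀ p ∈ U, m ((x₀, y₀) + p) = α p * stdFun n f γ E p)
    (v : ℝ × ℝ) (hv : nrm2 v = 1) (δv : ℝ) (ev : ℕ)
    (hstrip : StripBound (stdFun n f γ E) v δv ev)
    (κ : ℝ) (hκ0 : 0 ≤ κ) (hκ : κ ≤ δv) (hκ1 : κ < 1)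
    (H : ℝ) (hH : 0 < H) :
    ∃ r₁ > (0:ℝ), ∀ φ : ℝ × ℝ → ℝ, IsBump φ x₀ y₀ r₁ →
      ∃ C > (0:ℝ), ∀ t u : ℝ, |dot2 (t, u) (perp2 v)| ≤ H →
          ‖Kphi φ m t u‖ ≤ C * (2 + nrm2 (t, u)) ^ (-κ) *
            (Real.log (2 + nrm2 (t, u))) ^ ev := by
  have hv' : nrm2 (-v) = 1 := by rw [nrm2_neg, hv]
  obtain ⟨ρ₁, hρ₁, s₁, hs₁, hp⟩ := half_final hsf hv hstrip hκ hκ1 H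
  obtain ⟨ρ₂, hρ₂, s₂, hs₂, hn⟩ := half_final hsf hv' hstrip.neg hκ hκ1 H
  obtain ⟨V, hV, hVi⟩ := hsf.integ
  obtain ⟨ρ₃, hρ₃, hball⟩ := Metric.mem_nhds_iff.1 (inter_mem hU hV)
  set r₁ := min (min ρ₁ ρ₂) (min ρ₃ 1) with hr₁
  have a1 : r₁ ≤ ρ₁ := (min_le_left _ _).trans (min_le_left _ _)
  have a2 : r₁ ≤ ρ₂ := (min_le_left _ _).trans (min_le_right _ _)
  have a3 : r₁ ≤ ρ₃ := (min_le_right _ _).trans (min_le_left _ _)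
  have a4 : r₁ ≤ 1 := (min_le_right _ _).trans (min_le_right _ _)
  have hr₁0 : 0 < r₁ := lt_min (lt_min hρ₁ hρ₂) (lt_min hρ₃ one_pos)
  refine ⟨r₁, hr₁0, fun φ hφ => ?_⟩
  obtain ⟨M, hM, t1, t2, t3, t4⟩ := theta_props hA hα hr₁0 a4 hφ
  obtain ⟨K₁, hK₁, hp⟩ := hp M hM
  obtain ⟨K₂, hK₂, hn⟩ := hn M hM
  set Θ : ℝ × ℝ → ℝ := fun p => φ ((x₀, y₀) + p) * α p with hΘ
  set g := stdFun n f γ E with hg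
  have hg0 : ∀ p, 0 ≤ g p := stdFun_nonneg n f γ E
  have t5 : ∀ p, r₁ ≤ nrm2 p → Θ p = 0 := fun p hp => by simp only [hΘ]; rw [t4 p hp, zero_mul]
  have hin : ∀ p, p ∉ ball (0:ℝ×ℝ) ρ₃ → φ ((x₀, y₀) + p) = 0 := by
    intro p hp
    apply t4
    by_contra hcon
    push Not at hcon
    exact hp (mem_ball_zero_iff.2 ((norm_le_nrm2 p).trans_lt (hcon.trans_le a3)))
  have heq : ∀ p, φ ((x₀, y₀) + p) * m ((x₀, y₀) + p) = φ ((x₀, y₀) + p) * α p * g p := by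
    intro p
    by_cases hp : p ∈ ball (0:ℝ×ℝ) ρ₃
    · rw [hm p (hball hp).1, mul_assoc]
    · rw [hin p hp]; simp
  have hgi : IntegrableOn g (ball 0 ρ₃) := hVi.mono_set fun p hp => (hball hp).2
  have hgi' : Integrable ((ball (0:ℝ×ℝ) ρ₃).indicator g) := hgi.integrable_indicator measurableSet_ball
  have hΘm : AEStronglyMeasurable Θ volume := by
    have hc : ContinuousOn Θ {(0:ℝ×ℝ)}ᶜ := fun p hp => (t1 p hp).continuousAt.continuousWithinAt
    have := hc.aestronglyMeasurable (μ := volume) isOpen_compl_singleton.measurableSet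
    rwa [Measure.restrict_eq_self_of_ae_mem] at this
    exact measure_eq_zero_iff_ae_notMem.1 (measure_singleton (0:ℝ×ℝ))
  have hΘg : ∀ p, Θ p * g p = Θ p * (ball (0:ℝ×ℝ) ρ₃).indicator g p := by
    intro p
    by_cases hp : p ∈ ball (0:ℝ×ℝ) ρ₃
    · rw [indicator_of_mem hp]
    · simp only [hΘ]; rw [hin p hp]; simp
  have hnb : ∀ (t u : ℝ) (p : ℝ × ℝ), ‖((Θ p * g p : ℝ) : ℂ) *
      Complex.exp (Complex.I * ((t : ℂ) * (p.1 : ℂ) + (u : ℂ) * (p.2 : ℂ)))‖ ≤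
      M * (ball (0:ℝ×ℝ) ρ₃).indicator g p := by
    intro t u p
    have : (Complex.I * ((t:ℂ) * (p.1:ℂ) + (u:ℂ) * (p.2:ℂ))) =
        ((t * p.1 + u * p.2 : ℝ) : ℂ) * Complex.I := by push_cast; ring
    have h0 : 0 ≤ (ball (0:ℝ×ℝ) ρ₃).indicator g p := indicator_nonneg (fun p _ => hg0 p) p
    rw [this, norm_mul, Complex.norm_exp_ofReal_mul_I, mul_one, Complex.norm_real, Real.norm_eq_abs,
      hΘg, abs_mul, abs_of_nonneg h0]
    exact mul_le_mul_of_nonneg_right (t3 p) h0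
  have hFi : ∀ t u : ℝ, Integrable (fun p : ℝ × ℝ => ((Θ p * g p : ℝ) : ℂ) *
      Complex.exp (Complex.I * ((t : ℂ) * (p.1 : ℂ) + (u : ℂ) * (p.2 : ℂ)))) := by
    intro t u
    refine Integrable.mono' (hgi'.const_mul M) ?_ (ae_of_all _ (hnb t u))
    refine AEStronglyMeasurable.mul ?_ (Continuous.aestronglyMeasurable (by fun_prop))
    refine Complex.continuous_ofReal.comp_aestronglyMeasurable ?_
    simp_rw [hΘg]
    exact hΘm.mul hgi'.aestronglyMeasurable
  set K₀ := ∫ p, M * (ball (0:ℝ×ℝ) ρ₃).indicator g p with hK₀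
  have hK₀0 : 0 ≤ K₀ := integral_nonneg fun p => mul_nonneg hM (indicator_nonneg (fun p _ => hg0 p) p)
  have htriv : ∀ t u, ‖Kphi φ m t u‖ ≤ K₀ := by
    intro t u
    rw [Kphi_eq heq t u]
    exact norm_integral_le_of_norm_le (hgi'.const_mul M) (ae_of_all _ (hnb t u))
  set s₀ := max s₁ s₂ with hs₀
  have hs₀1 : 1 ≤ s₀ := hs₁.trans (le_max_left _ _)
  have hmain : ∀ t u, |dot2 (t, u) (perp2 v)| ≤ H → s₀ ≤ |dot2 (t, u) v| →
      ‖Kphi φ m t u‖ ≤ (K₁ + K₂) * (|dot2 (t, u) v| ^ (-κ) * (Real.log |dot2 (t, u) v|) ^ ev) := by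
    intro t u hw hs
    rw [Kphi_eq heq t u, split_int hv (hFi t u), add_mul]
    refine (norm_add_le _ _).trans (add_le_add ?_ ?_)
    · have := hp Θ t1 t2 t3 (fun p h => t5 p (a1.trans h)) (dot2 (t, u) v) (dot2 (t, u) (perp2 v))
        ((le_max_left _ _).trans hs) hw
      have hph : ∀ p : ℝ × ℝ, (t:ℂ) * ((Lmap v p).1 : ℂ) + (u:ℂ) * ((Lmap v p).2 : ℂ) =
          ((dot2 (t, u) v : ℝ) : ℂ) * (p.2 : ℂ) + ((dot2 (t, u) (perp2 v) : ℝ) : ℂ) * (p.1 : ℂ) := by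
        intro p; simp only [Lmap, dot2, perp2]; push_cast; ring
      simp only [hph]
      exact this
    · have := hn Θ t1 t2 t3 (fun p h => t5 p (a2.trans h)) (-dot2 (t, u) v) (-dot2 (t, u) (perp2 v))
        (by rw [abs_neg]; exact (le_max_right _ _).trans hs) (by rw [abs_neg]; exact hw)
      rw [abs_neg] at this
      have hph : ∀ p : ℝ × ℝ, (t:ℂ) * ((Lmap (-v) p).1 : ℂ) + (u:ℂ) * ((Lmap (-v) p).2 : ℂ) =
          ((-dot2 (t, u) v : ℝ) : ℂ) * (p.2 : ℂ) + ((-dot2 (t, u) (perp2 v) : ℝ) : ℂ) * (p.1 : ℂ) := by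
        intro p; simp only [Lmap, dot2, perp2, Prod.fst_neg, Prod.snd_neg]; push_cast; ring
      simp only [hph]
      exact this
  have hl2 : 0 < Real.log 2 := Real.log_pos (by norm_num)
  set Ca := (K₁ + K₂) * (3 + H) ^ κ with hCa
  set Cb := K₀ * (2 + s₀ + H) ^ κ / (Real.log 2) ^ ev with hCb
  have hCa0 : 0 ≤ Ca := by positivity
  have hCb0 : 0 ≤ Cb := by positivity
  refine ⟨Ca + Cb + 1, by positivity, fun t u hw => ?_⟩
  set N := nrm2 (t, u) with hN
  set s := dot2 (t, u) v with hs
  set w := dot2 (t, u) (perp2 v) with hwdef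
  have hN0 : 0 ≤ N := nrm2_nonneg _
  have hNsq : N ^ 2 = s ^ 2 + w ^ 2 := by
    rw [hN, nrm2_sq, hs, hwdef]
    simp only [dot2, perp2]
    linear_combination (-(t ^ 2 + u ^ 2)) * unit_sq hv
  have hsN : |s| ≤ N := abs_le_of_sq_le_sq (by nlinarith [sq_nonneg w]) hN0
  have hNs : N ≤ |s| + H := by
    refine abs_le_of_sq_le_sq' ?_ (by positivity) |>.2
    have : w ^ 2 ≤ H ^ 2 := by rw [← sq_abs w]; gcongr
    nlinarith [sq_abs s, abs_nonneg s, mul_nonneg (abs_nonneg s) hH.le]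
  have hlog : Real.log 2 ≤ Real.log (2 + N) := Real.log_le_log (by norm_num) (by linarith)
  have hB0 : 0 ≤ (2 + N) ^ (-κ) * (Real.log (2 + N)) ^ ev :=
    mul_nonneg (by positivity) (pow_nonneg (hl2.le.trans hlog) _)
  rw [mul_assoc]
  by_cases hcase : s₀ ≤ |s|
  · have hs1 : 1 ≤ |s| := hs₀1.trans hcase
    have h1 := hmain t u hw hcase
    have h2 : |s| ^ (-κ) ≤ (3 + H) ^ κ * (2 + N) ^ (-κ) := by
      have h3 : (2 + N) / (3 + H) ≤ |s| := by
        rw [div_le_iff₀ (by positivity)]; nlinarith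
      calc |s| ^ (-κ) ≤ ((2 + N) / (3 + H)) ^ (-κ) :=
            Real.rpow_le_rpow_of_nonpos (by positivity) h3 (by linarith)
        _ = _ := by
            rw [Real.div_rpow (by positivity) (by positivity), Real.rpow_neg (by positivity : (0:ℝ) ≤ 3 + H),
              div_inv_eq_mul, mul_comm]
    have h4 : Real.log |s| ≤ Real.log (2 + N) := Real.log_le_log (by linarith) (by linarith)
    have h5 : 0 ≤ Real.log |s| := Real.log_nonneg hs1
    calc _ ≤ _ := h1
      _ ≤ (K₁ + K₂) * (((3 + H) ^ κ * (2 + N) ^ (-κ)) * (Real.log (2 + N)) ^ ev) := by gcongr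
      _ = Ca * ((2 + N) ^ (-κ) * (Real.log (2 + N)) ^ ev) := by rw [hCa]; ring
      _ ≤ _ := mul_le_mul_of_nonneg_right (by linarith) hB0
  · push Not at hcase
    have h1 := htriv t u
    have h2 : (2 + s₀ + H) ^ (-κ) ≤ (2 + N) ^ (-κ) :=
      Real.rpow_le_rpow_of_nonpos (by positivity) (by linarith) (by linarith)
    have h3 : (Real.log 2) ^ ev ≤ (Real.log (2 + N)) ^ ev := by gcongr
    calc _ ≤ _ := h1
      _ = Cb * ((2 + s₀ + H) ^ (-κ) * (Real.log 2) ^ ev) := by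
          rw [hCb, Real.rpow_neg (by positivity)]; field_simp
      _ ≤ Cb * ((2 + N) ^ (-κ) * (Real.log (2 + N)) ^ ev) := by gcongr
      _ ≤ _ := mul_le_mul_of_nonneg_right (by linarith) hB0

/-- **Theorem 1.4 a), second part.** In the local multiplier setup with ball exponent
`ε ≥ 1/2` and at least one direction of strip exponent `< 1/2`: for a unit direction `v`
with strip exponents `δ_v, e_v` and bump functions `φ` with sufficiently small support,
on the strip `l_H` one has `|K_φ(t,u)| ≤ C (2+|(t,u)|)^{−δ_v} (ln(2+|(t,u)|))^{e_v}` when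
`δ_v < 1/2`, and `|K_φ(t,u)| ≤ C (2+|(t,u)|)^{−1/2} (ln(2+|(t,u)|))^{2}` when
`δ_v ≥ 1/2`. -/
theorem kernel_bound_directions_eps_ge_half {n : ℕ} (f : Fin n → ℝ × ℝ → ℝ)
    (γ : Fin n → ℝ) (E : Set (ℝ × ℝ)) (hsf : StandardForm n f γ E)
    (x₀ y₀ A : ℝ) (hA : 0 < A) (α m : ℝ × ℝ → ℝ) (hα : AlphaBound α A)
    (U : Set (ℝ × ℝ)) (hU : U ∈ 𝓝 (0:ℝ×ℝ))
    (hm : ∀ p ∈ U, m ((x₀, y₀) + p) = α p * stdFun n f γ E p)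
    (ε : ℝ) (d : ℕ) (hball : BallBound (stdFun n f γ E) ε d) (hε : 1/2 ≤ ε)
    (hex : ∃ (w : ℝ × ℝ) (δw : ℝ) (ew : ℕ), nrm2 w = 1 ∧
      StripBound (stdFun n f γ E) w δw ew ∧ δw < 1/2)
    (v : ℝ × ℝ) (hv : nrm2 v = 1) (δv : ℝ) (ev : ℕ)
    (hstrip : StripBound (stdFun n f γ E) v δv ev)
    (H : ℝ) (hH : 0 < H) :
    ∃ r₁ > (0:ℝ), ∀ φ : ℝ × ℝ → ℝ, IsBump φ x₀ y₀ r₁ →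
      ∃ C > (0:ℝ), ∀ t u : ℝ, |dot2 (t, u) (perp2 v)| ≤ H →
        (δv < 1/2 →
          ‖Kphi φ m t u‖ ≤ C * (2 + nrm2 (t, u)) ^ (-δv) *
            (Real.log (2 + nrm2 (t, u))) ^ ev) ∧
        (1/2 ≤ δv →
          ‖Kphi φ m t u‖ ≤ C * (2 + nrm2 (t, u)) ^ (-(1/2 : ℝ)) *
            (Real.log (2 + nrm2 (t, u))) ^ 2) := by
  obtain ⟨hδ, he, -⟩ := id hstrip
  obtain ⟨r₁, hr₁, h⟩ := kernel_core f γ E hsf x₀ y₀ A hA α m hα U hU hm v hv δv ev hstrip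
    (min δv (1/2)) (le_min hδ.le (by norm_num)) (min_le_left _ _)
    ((min_le_right _ _).trans_lt (by norm_num)) H hH
  refine ⟨r₁, hr₁, fun φ hφ => ?_⟩
  obtain ⟨C, hC, hb⟩ := h φ hφ
  have hl2 : 0 < Real.log 2 := Real.log_pos (by norm_num)
  have hl1 : Real.log 2 ≤ 1 := by
    have := Real.log_le_sub_one_of_pos (show (0:ℝ) < 2 by norm_num)
    linarith
  have hl3 : (Real.log 2) ^ 2 ≤ Real.log 2 := by nlinarith
  refine ⟨C / (Real.log 2) ^ 2, by positivity, fun t u hw => ?_⟩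
  have hN0 : 0 ≤ nrm2 (t, u) := nrm2_nonneg _
  have hlog : Real.log 2 ≤ Real.log (2 + nrm2 (t, u)) := Real.log_le_log (by norm_num) (by linarith)
  have hlog0 : 0 ≤ Real.log (2 + nrm2 (t, u)) := hl2.le.trans hlog
  have hCle : C ≤ C / (Real.log 2) ^ 2 := by
    rw [le_div_iff₀ (by positivity)]
    nlinarith
  have hK := hb t u hw
  constructor
  · intro hlt
    rw [min_eq_left hlt.le] at hK
    refine hK.trans ?_
    gcongr
  · intro hge
    rw [min_eq_right hge] at hK
    refine hK.trans ?_
    have hpw : (Real.log (2 + nrm2 (t, u))) ^ ev * (Real.log 2) ^ 2 ≤ (Real.log (2 + nrm2 (t, u))) ^ 2 := by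
      interval_cases ev
      · rw [pow_zero, one_mul]; gcongr
      · rw [pow_one, sq (Real.log (2 + nrm2 (t, u)))]
        exact mul_le_mul_of_nonneg_left (hl3.trans hlog) hlog0
    rw [div_mul_eq_mul_div, div_mul_eq_mul_div, le_div_iff₀ (by positivity), mul_assoc _ _ (Real.log 2 ^ 2)]
    gcongr
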